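/- Let n ≥ 2, let F_n be the free group on e₁,…,e_n, and let 0 ≤ d < 1/16. Fix a finite system of equations V(x̄,ā) = 1 over F_n, i.e. a finite set of words in the variables x̄ and in fixed elements ā of F_n. For each ℓ let Γ_ℓ be a random group of density d at length ℓ and π_ℓ : F_n → Γ_ℓ the quotient map. Then, with probability tending to 1 as ℓ → ∞, every tuple b̄_ℓ in Γ_ℓ with V(b̄_ℓ, π_ℓ(ā)) = 1 in Γ_ℓ is the image under π_ℓ of a tuple c̄_ℓ in F_n with V(c̄_ℓ, ā) = 1 in F_n. -/

import Mathlib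

open Filter

/-- A boolean combination of equations `w = 1`, where the words `w` range over `α`. -/
inductive BoolComb (α : Type*) : Type _
  | eq : α → BoolComb α
  | not : BoolComb α → BoolComb α
  | and : BoolComb α → BoolComb α → BoolComb α
  | or : BoolComb α → BoolComb α → BoolComb α

/-- Truth of a boolean combination of equations under an evaluation `ev` of the words
in a group `G`. -/
def BoolComb.Holds {α : Type*} {G : Type*} [Group G] (ev : α → G) : BoolComb α → Prop
  | .eq w => ev w = 1
  | .not φ => ¬ BoolComb.Holds ev φ
  | .and φ ψ => BoolComb.Holds ev φ ∧ BoolComb.Holds ev ψ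
  | .or φ ψ => BoolComb.Holds ev φ ∨ BoolComb.Holds ev ψ

/-- The number of relators `⌊(2n-1)^(dℓ)⌋` at density `d` and length `ℓ`. -/
noncomputable def numRel (n : ℕ) (d : ℝ) (ℓ : ℕ) : ℕ :=
  ⌊(2 * (n : ℝ) - 1) ^ (d * (ℓ : ℝ))⌋₊

/-- The tuples of `N` relators, each a reduced word of length `ℓ` in the free group
on `n` generators. -/
def relTuples (n ℓ N : ℕ) : Set (Fin N → FreeGroup (Fin n)) :=
  {r | ∀ i, ((r i).toWord).length = ℓ}

/-- The random group presented by a tuple `r` of relators: the quotient of the free group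
on `n` generators by the normal closure of the relators. -/
abbrev RandGroup {n N : ℕ} (r : Fin N → FreeGroup (Fin n)) : Type :=
  FreeGroup (Fin n) ⧸ Subgroup.normalClosure (Set.range r)

/-- The canonical quotient map `π : F_n → Γ` onto the random group. -/
def randProj {n N : ℕ} (r : Fin N → FreeGroup (Fin n)) :
    FreeGroup (Fin n) →* RandGroup r :=
  QuotientGroup.mk' _

/-- The probability, for a uniformly random `N`-tuple of reduced relators of length `ℓ`
(chosen uniformly and independently), that property `P` holds. -/
noncomputable def relProb (n ℓ N : ℕ) (P : (Fin N → FreeGroup (Fin n)) → Prop) : ℝ :=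
  (Set.ncard {r ∈ relTuples n ℓ N | P r} : ℝ) / (Set.ncard (relTuples n ℓ N) : ℝ)

/-- `P` holds with overwhelming probability in the random group of density `d`:
the probability tends to `1` as `ℓ → ∞`. -/
def wop (n : ℕ) (d : ℝ) (P : ∀ ℓ : ℕ, (Fin (numRel n d ℓ) → FreeGroup (Fin n)) → Prop) : Prop :=
  Tendsto (fun ℓ => relProb n ℓ (numRel n d ℓ) (P ℓ)) atTop (nhds 1)

/-- The inverse of a signed letter. -/
def letterInv {α : Type*} (x : α × Bool) : α × Bool := (x.1, !x.2)

@[simp] lemma letterInv_letterInv {α : Type*} (x : α × Bool) : letterInv (letterInv x) = x := by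
  simp [letterInv]

lemma letterInv_ne {α : Type*} (x : α × Bool) : letterInv x ≠ x := by
  obtain ⟨a, b⟩ := x
  simp [letterInv]

lemma letterInv_inj {α : Type*} {x y : α × Bool} : letterInv x = letterInv y ↔ x = y :=
  ⟨fun h => by rw [← letterInv_letterInv x, h, letterInv_letterInv], fun h => h ▸ rfl⟩

/-- `ConjProd L g`: the element `g` is a product of conjugates of the inverses of the
entries of `L`. -/
inductive ConjProd {G : Type*} [Group G] : List G → G → Prop
  | nil : ConjProd [] 1
  | cons {L : List G} {h : G} (x g : G) : ConjProd L h → ConjProd (x :: L) (g * x⁻¹ * g⁻¹ * h)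

/-- The sides in the list form a path from `u` to `v`, where `st` is the initial vertex of a
side and `al` is the opposite side. -/
def Walk (st al : ℕ → ℕ) : ℕ → List ℕ → ℕ → Prop
  | u, [], v => u = v
  | u, x :: l, v => st x = u ∧ Walk st al (st (al x)) l v

lemma walk_append {st al : ℕ → ℕ} {u v : ℕ} {l₁ l₂ : List ℕ} :
    Walk st al u (l₁ ++ l₂) v ↔ ∃ w, Walk st al u l₁ w ∧ Walk st al w l₂ v := by
  induction l₁ generalizing u with
  | nil => simp [Walk]
  | cons x l ih => simp [Walk, ih, and_assoc]

lemma Walk.map {st al st' al' : ℕ → ℕ} (σ : ℕ → ℕ) {u v : ℕ} {l : List ℕ}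
    (h₁ : ∀ x ∈ l, st' x = σ (st x)) (h₂ : ∀ x ∈ l, st' (al' x) = σ (st (al x)))
    (h : Walk st al u l v) : Walk st' al' (σ u) l (σ v) := by
  induction l generalizing u with
  | nil => exact congrArg σ h
  | cons x l ih =>
    obtain ⟨h3, h4⟩ := h
    refine ⟨by rw [h₁ x (by simp), h3], ?_⟩
    rw [h₂ x (by simp)]
    exact ih (fun y hy => h₁ y (by simp [hy])) (fun y hy => h₂ y (by simp [hy])) h4

/-- The sides of a diagram: those of the boundary and those of the cells. -/
def diaSides {J : Type*} (bd : List ℕ) (cells : List (J × List ℕ)) : List ℕ :=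
  bd ++ (cells.map Prod.snd).flatten

/-- A (spherical) van Kampen diagram with boundary word `W` over the relators `rw`, presented
by its sides: `al` is the opposite side, `st` the initial vertex, `lab` the label of a side. -/
structure IsDia {J α : Type*} (G : Type*) [Group G] (rw : J → List (α × Bool))
    (W : List (α × Bool)) (bd : List ℕ) (cells : List (J × List ℕ)) (al st : ℕ → ℕ)
    (lab : ℕ → α × Bool) (b0 : ℕ) (vs : Finset ℕ) : Prop where
  nodup : (diaSides bd cells).Nodup
  al_mem : ∀ x ∈ diaSides bd cells, al x ∈ diaSides bd cells
  al_al : ∀ x ∈ diaSides bd cells, al (al x) = x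
  lab_al : ∀ x ∈ diaSides bd cells, lab (al x) = letterInv (lab x)
  lab_bd : bd.map lab = W
  lab_cell : ∀ c ∈ cells, c.2.map lab = rw c.1
  walk_bd : Walk st al b0 bd b0
  walk_cell : ∀ c ∈ cells, ∃ u, Walk st al u c.2 u
  vs_sub : ∀ v ∈ vs, v = b0 ∨ ∃ x ∈ diaSides bd cells, st x = v
  euler : (diaSides bd cells).length + 2 ≤ 2 * vs.card + 2 * cells.length
  conj : ∀ φ : ℕ → G, (∀ x ∈ diaSides bd cells, φ (al x) = (φ x)⁻¹) →
    ConjProd (cells.map fun c => (c.2.map φ).prod) ((bd.map φ).prod)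

/-- There is a diagram with boundary `W` and cells of types `js`. -/
def HasDia {J α : Type*} (G : Type*) [Group G] (rw : J → List (α × Bool)) (k : ℕ)
    (W : List (α × Bool)) : Prop :=
  ∃ bd cells al st lab b0 vs, IsDia G rw W bd cells al st lab b0 vs ∧ cells.length = k

section Operations

variable {J α G : Type*} [Group G] {rw : J → List (α × Bool)}

lemma hasDia_nil [Inhabited α] : HasDia G rw 0 [] := by
  refine ⟨[], [], id, id, fun _ => (default, true), 0, {0}, ⟨?_, ?_, ?_, ?_, ?_, ?_, ?_, ?_, ?_, ?_, ?_⟩, rfl⟩ <;>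
    simp [diaSides, Walk, ConjProd.nil]

lemma card_image_merge (vs : Finset ℕ) (u u' : ℕ) :
    vs.card ≤ (vs.image fun v => if v = u' then u else v).card + 1 := by
  have : vs ⊆ insert u' (vs.image fun v => if v = u' then u else v) := by
    intro v hv
    by_cases h : v = u'
    · simp [h]
    · refine Finset.mem_insert_of_mem (Finset.mem_image.2 ⟨v, hv, by simp [h]⟩)
  exact (Finset.card_le_card this).trans (Finset.card_insert_le _ _)

lemma HasDia.detach {k : ℕ} {U V : List (α × Bool)} (j : J)
    (h : HasDia G rw k (U ++ rw j ++ V)) : HasDia G rw (k + 1) (U ++ V) := by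
  obtain ⟨bd, cells, al, st, lab, b0, vs, D, hk⟩ := h
  obtain ⟨bd', V', rfl, hUQ, hV⟩ := List.map_eq_append_iff.1 D.lab_bd
  obtain ⟨U', Q', rfl, hU, hQ⟩ := List.map_eq_append_iff.1 hUQ
  have hperm : (diaSides (U' ++ V') ((j, Q') :: cells)).Perm (diaSides (U' ++ Q' ++ V') cells) := by
    simp only [diaSides, List.map_cons, List.flatten_cons, List.append_assoc]
    refine List.Perm.append_left _ ?_
    rw [← List.append_assoc, ← List.append_assoc]
    exact List.Perm.append_right _ List.perm_append_comm
  have hmem : ∀ x, x ∈ diaSides (U' ++ V') ((j, Q') :: cells) ↔ x ∈ diaSides (U' ++ Q' ++ V') cells :=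
    fun x => hperm.mem_iff
  obtain ⟨u', hUQw, hVw⟩ := walk_append.1 D.walk_bd
  obtain ⟨u, hUw, hQw⟩ := walk_append.1 hUQw
  let σ : ℕ → ℕ := fun v => if v = u' then u else v
  have hσu' : σ u' = u := by simp [σ]
  have hσu : σ u = u := by simp [σ]
  have W0 : ∀ {a b l}, Walk st al a l b → Walk (σ ∘ st) al (σ a) l (σ b) :=
    fun h => h.map σ (fun _ _ => rfl) (fun _ _ => rfl)
  refine ⟨U' ++ V', (j, Q') :: cells, al, σ ∘ st, lab, σ b0, vs.image σ, ⟨?_, ?_, ?_, ?_, ?_, ?_, ?_, ?_, ?_, ?_, ?_⟩, by simp [hk]⟩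
  · exact hperm.nodup_iff.2 D.nodup
  · intro x hx
    exact (hmem _).2 (D.al_mem x ((hmem x).1 hx))
  · exact fun x hx => D.al_al x ((hmem x).1 hx)
  · exact fun x hx => D.lab_al x ((hmem x).1 hx)
  · simp [hU, hV]
  · intro c hc
    rcases List.mem_cons.1 hc with rfl | hc
    · exact hQ
    · exact D.lab_cell c hc
  · refine walk_append.2 ⟨u, ?_, ?_⟩
    · simpa [hσu] using W0 hUw
    · simpa [hσu'] using W0 hVw
  · intro c hc
    rcases List.mem_cons.1 hc with rfl | hc
    · refine ⟨u, ?_⟩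
      have := W0 hQw
      rwa [hσu, hσu'] at this
    · obtain ⟨v, hv⟩ := D.walk_cell c hc
      exact ⟨σ v, W0 hv⟩
  · intro v hv
    obtain ⟨v₀, hv₀, rfl⟩ := Finset.mem_image.1 hv
    rcases D.vs_sub v₀ hv₀ with rfl | ⟨x, hx, rfl⟩
    · exact Or.inl rfl
    · exact Or.inr ⟨x, (hmem x).2 hx, rfl⟩
  · have h1 := card_image_merge vs u u'
    have h2 := D.euler
    rw [hperm.length_eq]
    simp only [List.length_cons]
    change vs.card ≤ (vs.image σ).card + 1 at h1
    omega
  · intro φ hφ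
    have := D.conj φ (fun x hx => hφ x ((hmem x).2 hx))
    have h2 := ConjProd.cons ((Q'.map φ).prod) ((U'.map φ).prod) this
    convert h2 using 1
    · simp
    · simp only [List.map_append, List.prod_append]
      group

lemma HasDia.spur {k : ℕ} {U V : List (α × Bool)} (x : α × Bool)
    (h : HasDia G rw k (U ++ V)) : HasDia G rw k (U ++ x :: letterInv x :: V) := by
  obtain ⟨bd, cells, al, st, lab, b0, vs, D, hk⟩ := h
  obtain ⟨U', V', rfl, hU, hV⟩ := List.map_eq_append_iff.1 D.lab_bd
  obtain ⟨u, hUw, hVw⟩ := walk_append.1 D.walk_bd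
  obtain ⟨p, hp⟩ := Infinite.exists_notMem_finset (diaSides (U' ++ V') cells).toFinset
  obtain ⟨q, hq⟩ := Infinite.exists_notMem_finset (insert p (diaSides (U' ++ V') cells).toFinset)
  obtain ⟨w, hw⟩ := Infinite.exists_notMem_finset vs
  simp only [Finset.mem_insert, List.mem_toFinset, not_or] at hp hq
  obtain ⟨hqp, hq⟩ := hq
  have hperm : (diaSides (U' ++ p :: q :: V') cells).Perm (p :: q :: diaSides (U' ++ V') cells) := by
    simp only [diaSides, List.append_assoc, List.cons_append]
    refine List.perm_middle.trans (List.Perm.cons _ ?_)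
    exact List.perm_middle
  have hmem : ∀ x, x ∈ diaSides (U' ++ p :: q :: V') cells ↔
      x = p ∨ x = q ∨ x ∈ diaSides (U' ++ V') cells :=
    fun x => by rw [hperm.mem_iff]; simp
  have hne : ∀ x ∈ diaSides (U' ++ V') cells, x ≠ p ∧ x ≠ q :=
    fun x hx => ⟨fun h => hp (h ▸ hx), fun h => hq (h ▸ hx)⟩
  let al' : ℕ → ℕ := fun z => if z = p then q else if z = q then p else al z
  let st' : ℕ → ℕ := fun z => if z = p then u else if z = q then w else st z
  let lab' : ℕ → α × Bool := fun z => if z = p then x else if z = q then letterInv x else lab z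
  have al_p : al' p = q := by simp [al']
  have al_q : al' q = p := by simp [al', hqp]
  have al_o : ∀ z ∈ diaSides (U' ++ V') cells, al' z = al z := fun z hz => by
    simp [al', hne z hz]
  have st_p : st' p = u := by simp [st']
  have st_q : st' q = w := by simp [st', hqp]
  have st_o : ∀ z ∈ diaSides (U' ++ V') cells, st' z = st z := fun z hz => by
    simp [st', hne z hz]
  have lab_p : lab' p = x := by simp [lab']
  have lab_q : lab' q = letterInv x := by simp [lab', hqp]
  have lab_o : ∀ z ∈ diaSides (U' ++ V') cells, lab' z = lab z := fun z hz => by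
    simp [lab', hne z hz]
  have memU : ∀ z ∈ U', z ∈ diaSides (U' ++ V') cells := fun z hz => by simp [diaSides, hz]
  have memV : ∀ z ∈ V', z ∈ diaSides (U' ++ V') cells := fun z hz => by simp [diaSides, hz]
  have memC : ∀ c ∈ cells, ∀ z ∈ c.2, z ∈ diaSides (U' ++ V') cells := fun c hc z hz => by
    simp only [diaSides, List.mem_append, List.mem_flatten, List.mem_map]
    exact Or.inr ⟨c.2, ⟨c, hc, rfl⟩, hz⟩
  have W0 : ∀ {a b l}, (∀ z ∈ l, z ∈ diaSides (U' ++ V') cells) → Walk st al a l b →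
      Walk st' al' a l b := fun hl h => h.map id (fun z hz => st_o z (hl z hz)) (fun z hz => by
        rw [al_o z (hl z hz), st_o _ (D.al_mem z (hl z hz))]; rfl)
  have M0 : ∀ l : List ℕ, (∀ z ∈ l, z ∈ diaSides (U' ++ V') cells) → l.map lab' = l.map lab :=
    fun l hl => List.map_congr_left fun z hz => lab_o z (hl z hz)
  refine ⟨U' ++ p :: q :: V', cells, al', st', lab', b0, insert w vs, ⟨?_, ?_, ?_, ?_, ?_, ?_, ?_, ?_, ?_, ?_, ?_⟩, hk⟩
  · rw [hperm.nodup_iff]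
    simp [D.nodup, hp, hq, Ne.symm hqp]
  · intro z hz
    rw [hmem] at hz ⊢
    rcases hz with rfl | rfl | hz
    · simp [al_p]
    · simp [al_q]
    · exact Or.inr (Or.inr (al_o z hz ▸ D.al_mem z hz))
  · intro z hz
    rw [hmem] at hz
    rcases hz with rfl | rfl | hz
    · rw [al_p, al_q]
    · rw [al_q, al_p]
    · rw [al_o z hz, al_o _ (D.al_mem z hz), D.al_al z hz]
  · intro z hz
    rw [hmem] at hz
    rcases hz with rfl | rfl | hz
    · rw [al_p, lab_q, lab_p]
    · rw [al_q, lab_q, lab_p, letterInv_letterInv]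
    · rw [al_o z hz, lab_o _ (D.al_mem z hz), D.lab_al z hz, lab_o z hz]
  · simp [M0 U' memU, M0 V' memV, hU, hV, lab_p, lab_q]
  · intro c hc
    rw [M0 c.2 (memC c hc), D.lab_cell c hc]
  · refine walk_append.2 ⟨u, W0 memU hUw, st_p, ?_⟩
    rw [al_p]
    refine ⟨rfl, ?_⟩
    rw [al_q, st_p]
    exact W0 memV hVw
  · intro c hc
    obtain ⟨v, hv⟩ := D.walk_cell c hc
    exact ⟨v, W0 (memC c hc) hv⟩
  · intro v hv
    rcases Finset.mem_insert.1 hv with rfl | hv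
    · exact Or.inr ⟨q, by simp [hmem], st_q⟩
    · rcases D.vs_sub v hv with rfl | ⟨z, hz, rfl⟩
      · exact Or.inl rfl
      · exact Or.inr ⟨z, (hmem z).2 (Or.inr (Or.inr hz)), st_o z hz⟩
  · have h2 := D.euler
    rw [hperm.length_eq, Finset.card_insert_of_notMem hw]
    simp only [List.length_cons]
    omega
  · intro φ hφ
    have hpq : φ q = (φ p)⁻¹ := by rw [← al_p]; exact hφ p (by simp [hmem])
    have := D.conj φ (fun z hz => by rw [← al_o z hz]; exact hφ z ((hmem z).2 (Or.inr (Or.inr hz))))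
    convert this using 1
    simp [hpq]

lemma HasDia.fold {k : ℕ} {U V : List (α × Bool)} (x : α × Bool)
    (h : HasDia G rw k (U ++ x :: letterInv x :: V)) : HasDia G rw k (U ++ V) := by
  obtain ⟨bd, cells, al, st, lab, b0, vs, D, hk⟩ := h
  obtain ⟨U', R, rfl, hU, hR⟩ := List.map_eq_append_iff.1 D.lab_bd
  obtain ⟨p, R, rfl, lab_p, hR⟩ := List.map_eq_cons_iff.1 hR
  obtain ⟨q, V', rfl, lab_q, hV⟩ := List.map_eq_cons_iff.1 hR
  have hperm : (diaSides (U' ++ p :: q :: V') cells).Perm (p :: q :: diaSides (U' ++ V') cells) := by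
    simp only [diaSides, List.append_assoc, List.cons_append]
    refine List.perm_middle.trans (List.Perm.cons _ ?_)
    exact List.perm_middle
  have hmem : ∀ x, x ∈ diaSides (U' ++ p :: q :: V') cells ↔
      x = p ∨ x = q ∨ x ∈ diaSides (U' ++ V') cells :=
    fun x => by rw [hperm.mem_iff]; simp
  have hnd := D.nodup
  rw [hperm.nodup_iff] at hnd
  simp only [List.nodup_cons, List.mem_cons, not_or] at hnd
  obtain ⟨⟨hpq, hp⟩, hq, hnd⟩ := hnd
  have hne : ∀ x ∈ diaSides (U' ++ V') cells, x ≠ p ∧ x ≠ q :=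
    fun x hx => ⟨fun h => hp (h ▸ hx), fun h => hq (h ▸ hx)⟩
  have pmem := (hmem p).2 (Or.inl rfl)
  have qmem := (hmem q).2 (Or.inr (Or.inl rfl))
  have omem : ∀ z ∈ diaSides (U' ++ V') cells, z ∈ diaSides (U' ++ p :: q :: V') cells :=
    fun z hz => (hmem z).2 (Or.inr (Or.inr hz))
  have al_ne : ∀ z ∈ diaSides (U' ++ p :: q :: V') cells, al z ≠ z := fun z hz h => by
    have := D.lab_al z hz
    rw [h] at this
    exact letterInv_ne _ this.symm
  obtain ⟨u, hUw, hst_p, hst_q, hVw⟩ := walk_append.1 D.walk_bd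
  have memU : ∀ z ∈ U', z ∈ diaSides (U' ++ V') cells := fun z hz => by simp [diaSides, hz]
  have memV : ∀ z ∈ V', z ∈ diaSides (U' ++ V') cells := fun z hz => by simp [diaSides, hz]
  have memC : ∀ c ∈ cells, ∀ z ∈ c.2, z ∈ diaSides (U' ++ V') cells := fun c hc z hz => by
    simp only [diaSides, List.mem_append, List.mem_flatten, List.mem_map]
    exact Or.inr ⟨c.2, ⟨c, hc, rfl⟩, hz⟩
  by_cases hal : al p = q
  · have halq : al q = p := by rw [← hal, D.al_al p pmem]
    have al_o : ∀ z ∈ diaSides (U' ++ V') cells, al z ∈ diaSides (U' ++ V') cells := fun z hz => by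
      rcases (hmem _).1 (D.al_mem z (omem z hz)) with h | h | h
      · have := D.al_al z (omem z hz)
        rw [h, hal] at this
        exact absurd this.symm (hne z hz).2
      · have := D.al_al z (omem z hz)
        rw [h, halq] at this
        exact absurd this.symm (hne z hz).1
      · exact h
    have hu : u = b0 ∨ ∃ z ∈ diaSides (U' ++ V') cells, st z = u := by
      rcases List.eq_nil_or_concat U' with rfl | ⟨U₁, z, rfl⟩
      · exact Or.inl hUw.symm
      · obtain ⟨w, h1, h2, h3⟩ := walk_append.1 (by simpa using hUw)
        exact Or.inr ⟨al z, al_o z (memU z (by simp)), h3⟩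
    refine ⟨U' ++ V', cells, al, st, lab, b0, vs.erase (st q), ⟨hnd, al_o, ?_, ?_, ?_, ?_, ?_, ?_, ?_, ?_, ?_⟩, hk⟩
    · exact fun z hz => D.al_al z (omem z hz)
    · exact fun z hz => D.lab_al z (omem z hz)
    · simp [hU, hV]
    · exact D.lab_cell
    · rw [halq, hst_p] at hVw
      exact walk_append.2 ⟨u, hUw, hVw⟩
    · exact D.walk_cell
    · intro v hv
      obtain ⟨hv1, hv2⟩ := Finset.mem_erase.1 hv
      rcases D.vs_sub v hv2 with h | ⟨z, hz, h⟩
      · exact Or.inl h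
      · rcases (hmem z).1 hz with rfl | rfl | hz
        · rw [← h, hst_p]; exact hu
        · exact absurd h.symm hv1
        · exact Or.inr ⟨z, hz, h⟩
    · have h2 := D.euler
      have h3 := Finset.pred_card_le_card_erase (s := vs) (a := st q)
      rw [hperm.length_eq] at h2
      simp only [List.length_cons] at h2
      omega
    · intro φ hφ
      classical
      let φ' : ℕ → G := fun z => if z = p ∨ z = q then 1 else φ z
      have φo : ∀ z ∈ diaSides (U' ++ V') cells, φ' z = φ z := fun z hz => by
        simp [φ', hne z hz]
      have φp : φ' p = 1 := by simp [φ']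
      have φq : φ' q = 1 := by simp [φ']
      have := D.conj φ' (fun z hz => by
        rcases (hmem z).1 hz with rfl | rfl | hz
        · rw [hal, φp, φq, inv_one]
        · rw [halq, φp, φq, inv_one]
        · rw [φo z hz, φo _ (al_o z hz), hφ z hz])
      have M0 : ∀ l : List ℕ, (∀ z ∈ l, z ∈ diaSides (U' ++ V') cells) → l.map φ' = l.map φ :=
        fun l hl => List.map_congr_left fun z hz => φo z (hl z hz)
      convert this using 1
      · exact List.map_congr_left fun c hc => by rw [M0 _ (memC c hc)]
      · simp [M0 _ memU, M0 _ memV, φp, φq]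
  · have halq : al q ≠ p := fun h => hal (by rw [← h, D.al_al q qmem])
    set y := al p with hy
    set y' := al q with hy'
    have aly : al y = p := D.al_al p pmem
    have aly' : al y' = q := D.al_al q qmem
    have hyne : y ≠ p := al_ne p pmem
    have hyne' : y' ≠ q := al_ne q qmem
    have hyy : y ≠ y' := fun h => hpq (by rw [← aly, h, aly'])
    have ymem : y ∈ diaSides (U' ++ V') cells := by
      rcases (hmem _).1 (D.al_mem p pmem) with h | h | h
      · exact absurd h hyne
      · exact absurd h hal
      · exact h
    have ymem' : y' ∈ diaSides (U' ++ V') cells := by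
      rcases (hmem _).1 (D.al_mem q qmem) with h | h | h
      · exact absurd h halq
      · exact absurd h hyne'
      · exact h
    have al_o : ∀ z ∈ diaSides (U' ++ V') cells, z ≠ y → z ≠ y' →
        al z ∈ diaSides (U' ++ V') cells ∧ al z ≠ y ∧ al z ≠ y' := fun z hz h1 h2 => by
      have h0 := D.al_al z (omem z hz)
      refine ⟨?_, fun h => ?_, fun h => ?_⟩
      · rcases (hmem _).1 (D.al_mem z (omem z hz)) with h | h | h
        · rw [h] at h0; exact absurd h0.symm h1
        · rw [h] at h0; exact absurd h0.symm h2
        · exact h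
      · rw [h, aly] at h0; exact absurd h0.symm (hne z hz).1
      · rw [h, aly'] at h0; exact absurd h0.symm (hne z hz).2
    let u' := st y'
    let σ : ℕ → ℕ := fun v => if v = u' then u else v
    have hσu' : σ u' = u := by simp [σ]
    have hσu : σ u = u := by simp [σ]
    let al' : ℕ → ℕ := fun z => if z = y then y' else if z = y' then y else al z
    have al_y : al' y = y' := by simp [al']
    have al_y' : al' y' = y := by simp [al', Ne.symm hyy]
    have al_z : ∀ z, z ≠ y → z ≠ y' → al' z = al z := fun z h1 h2 => by simp [al', h1, h2]
    have W0 : ∀ {a b l}, (∀ z ∈ l, z ∈ diaSides (U' ++ V') cells) → Walk st al a l b →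
        Walk (σ ∘ st) al' (σ a) l (σ b) := fun hl h => h.map σ (fun _ _ => rfl) (fun z hz => by
          by_cases h1 : z = y
          · subst h1
            simp only [Function.comp]
            rw [al_y, aly, hst_p, hσu]
            exact hσu'
          by_cases h2 : z = y'
          · subst h2
            simp only [Function.comp]
            rw [al_y', aly', hst_q]
          simp only [Function.comp]
          rw [al_z z h1 h2])
    refine ⟨U' ++ V', cells, al', σ ∘ st, lab, σ b0, vs.image σ, ⟨hnd, ?_, ?_, ?_, ?_, ?_, ?_, ?_, ?_, ?_, ?_⟩, hk⟩
    · intro z hz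
      by_cases h1 : z = y
      · rw [h1, al_y]; exact ymem'
      by_cases h2 : z = y'
      · rw [h2, al_y']; exact ymem
      rw [al_z z h1 h2]
      exact (al_o z hz h1 h2).1
    · intro z hz
      by_cases h1 : z = y
      · rw [h1, al_y, al_y']
      by_cases h2 : z = y'
      · rw [h2, al_y', al_y]
      obtain ⟨h3, h4, h5⟩ := al_o z hz h1 h2
      rw [al_z z h1 h2, al_z _ h4 h5, D.al_al z (omem z hz)]
    · have laby : lab y = letterInv x := by rw [D.lab_al p pmem, lab_p]
      have laby' : lab y' = x := by rw [D.lab_al q qmem, lab_q, letterInv_letterInv]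
      intro z hz
      by_cases h1 : z = y
      · rw [h1, al_y, laby, laby', letterInv_letterInv]
      by_cases h2 : z = y'
      · rw [h2, al_y', laby, laby']
      rw [al_z z h1 h2, D.lab_al z (omem z hz)]
    · simp [hU, hV]
    · exact D.lab_cell
    · refine walk_append.2 ⟨σ u, W0 memU hUw, ?_⟩
      rw [hσu, ← hσu']
      exact W0 memV hVw
    · intro c hc
      obtain ⟨v, hv⟩ := D.walk_cell c hc
      exact ⟨σ v, W0 (memC c hc) hv⟩
    · intro v hv
      obtain ⟨v₀, hv₀, rfl⟩ := Finset.mem_image.1 hv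
      rcases D.vs_sub v₀ hv₀ with rfl | ⟨z, hz, rfl⟩
      · exact Or.inl rfl
      · rcases (hmem z).1 hz with rfl | rfl | hz
        · exact Or.inr ⟨y', ymem', by rw [hst_p, hσu]; exact hσu'⟩
        · exact Or.inr ⟨y, ymem, by rw [hst_q]; rfl⟩
        · exact Or.inr ⟨z, hz, rfl⟩
    · have h1 := card_image_merge vs u u'
      have h2 := D.euler
      rw [hperm.length_eq] at h2
      simp only [List.length_cons] at h2
      change vs.card ≤ (vs.image σ).card + 1 at h1
      omega
    · intro φ hφ
      let φ' : ℕ → G := fun z => if z = p then (φ y)⁻¹ else if z = q then φ y else φ z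
      have φo : ∀ z ∈ diaSides (U' ++ V') cells, φ' z = φ z := fun z hz => by
        simp [φ', hne z hz]
      have φp : φ' p = (φ y)⁻¹ := by simp [φ']
      have φq : φ' q = φ y := by simp [φ', Ne.symm hpq]
      have φyy : φ y' = (φ y)⁻¹ := by rw [← al_y]; exact hφ y ymem
      have := D.conj φ' (fun z hz => by
        rcases (hmem z).1 hz with rfl | rfl | hz
        · rw [← hy, φo y ymem, φp, inv_inv]
        · rw [← hy', φo y' ymem', φq, φyy]
        · by_cases h1 : z = y
          · subst h1
            rw [aly, φo _ ymem, φp]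
          by_cases h2 : z = y'
          · subst h2
            rw [aly', φo _ ymem', φq, φyy, inv_inv]
          rw [φo z hz, φo _ (al_o z hz h1 h2).1, ← al_z z h1 h2, hφ z hz])
      have M0 : ∀ l : List ℕ, (∀ z ∈ l, z ∈ diaSides (U' ++ V') cells) → l.map φ' = l.map φ :=
        fun l hl => List.map_congr_left fun z hz => φo z (hl z hz)
      convert this using 1
      · exact List.map_congr_left fun c hc => by rw [M0 _ (memC c hc)]
      · simp [M0 _ memU, M0 _ memV, φp, φq]

lemma hasDia_step {k : ℕ} {W W' : List (α × Bool)} (h : FreeGroup.Red.Step W W') :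
    HasDia G rw k W ↔ HasDia G rw k W' := by
  obtain @⟨L₁, L₂, x, b⟩ := h
  exact ⟨fun h => HasDia.fold (x, b) h, fun h => HasDia.spur (x, b) h⟩

lemma hasDia_red {k : ℕ} {W W' : List (α × Bool)} (h : FreeGroup.Red W W') :
    HasDia G rw k W ↔ HasDia G rw k W' := by
  induction h with
  | refl => rfl
  | tail _ h ih => rw [ih, hasDia_step h]

lemma hasDia_congr {k : ℕ} {W W' : List (α × Bool)} (h : FreeGroup.mk W = FreeGroup.mk W') :
    HasDia G rw k W ↔ HasDia G rw k W' := by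
  obtain ⟨c, h1, h2⟩ := FreeGroup.Red.exact.1 h
  rw [hasDia_red h1, hasDia_red h2]

/-- Van Kampen's lemma. -/
theorem hasDia_of_conjProd [DecidableEq α] [Inhabited α] {js : List J} {W : List (α × Bool)}
    (h : ConjProd (js.map fun j => FreeGroup.mk (rw j)) (FreeGroup.mk W)) :
    HasDia G rw js.length W := by
  generalize hg : FreeGroup.mk W = g at h
  induction js generalizing W g with
  | nil =>
    cases h
    exact (hasDia_congr (W' := []) hg).2 hasDia_nil
  | cons j js ih =>
    generalize hL : (List.map (fun j => FreeGroup.mk (rw j)) (j :: js)) = L at h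
    cases h with
    | nil => simp at hL
    | @cons _ h x g h' =>
      simp only [List.map_cons, List.cons.injEq] at hL
      obtain ⟨rfl, rfl⟩ := hL
      have e := ih (W := g.toWord ++ rw j ++
        (FreeGroup.invRev (rw j) ++ FreeGroup.invRev g.toWord ++ h.toWord)) h
        (by
          simp only [← FreeGroup.mul_mk, ← FreeGroup.inv_mk, FreeGroup.mk_toWord]
          group) h'
      refine (hasDia_congr ?_).1 e.detach
      simp only [hg, ← FreeGroup.mul_mk, ← FreeGroup.inv_mk, FreeGroup.mk_toWord]
      group

end Operations

lemma val_finRotate {n : ℕ} (i : Fin n) :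
    (finRotate n i : ℕ) = if (i : ℕ) + 1 = n then 0 else (i : ℕ) + 1 := by
  cases n with
  | zero => exact i.elim0
  | succ n =>
    rw [coe_finRotate]
    simp [Fin.ext_iff]

lemma Walk.getElem {st al : ℕ → ℕ} {u v : ℕ} {l : List ℕ} (h : Walk st al u l v)
    (p : ℕ) (hp : p < l.length) :
    (p = 0 → st l[p] = u) ∧ (p + 1 = l.length → st (al l[p]) = v) ∧
      ∀ hp' : p + 1 < l.length, st (al l[p]) = st l[p + 1] := by
  induction l generalizing u p with
  | nil => simp at hp
  | cons x l ih =>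
    obtain ⟨h1, h2⟩ := h
    cases p with
    | zero =>
      refine ⟨fun _ => h1, fun h => ?_, fun h => ?_⟩
      · cases l with
        | nil => exact h2
        | cons => simp at h
      · exact ((ih h2 0 (by simpa using h)).1 rfl).symm
    | succ p =>
      obtain ⟨_, h4, h5⟩ := ih h2 p (by simpa using hp)
      refine ⟨fun h => by simp at h, fun h => ?_, fun h => ?_⟩
      · exact h4 (by simpa using h)
      · exact h5 (by simpa using h)

lemma Walk.st_next {st al : ℕ → ℕ} {u : ℕ} {l : List ℕ} (h : Walk st al u l u)
    (i : Fin l.length) : st l[finRotate l.length i] = st (al l[i]) := by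
  have hv := val_finRotate i
  obtain ⟨_, h2, h3⟩ := h.getElem i i.2
  by_cases hi : (i : ℕ) + 1 = l.length
  · have h0 := (h.getElem 0 (by omega)).1 rfl
    have : (finRotate l.length i : ℕ) = 0 := by rw [hv]; simp [hi]
    simp only [Fin.getElem_fin, this]
    rw [h0]
    exact (h2 hi).symm
  · have : (finRotate l.length i : ℕ) = i + 1 := by rw [hv]; simp [hi]
    simp only [Fin.getElem_fin, this]
    exact (h3 (by omega)).symm

/-- The sides of a diagram with boundary of length `p` and cells of lengths `q c`. -/
abbrev SideType {k : ℕ} (p : ℕ) (q : Fin k → ℕ) : Type := Fin p ⊕ Σ c : Fin k, Fin (q c)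

/-- The next side on the same face. -/
def sideNext {k : ℕ} (p : ℕ) (q : Fin k → ℕ) : Equiv.Perm (SideType p q) :=
  Equiv.sumCongr (finRotate p) (Equiv.sigmaCongrRight fun c => finRotate (q c))

/-- A van Kampen diagram with boundary word `W`, with its sides indexed by a finite type. -/
structure SideDia {J α : Type*} (G : Type*) [Group G] (rw : J → List (α × Bool))
    (W : List (α × Bool)) (k : ℕ) where
  /-- the types of the cells -/
  ty : Fin k → J
  /-- the boundary length -/
  p : ℕ
  /-- the lengths of the cells -/
  q : Fin k → ℕ
  /-- the opposite side -/
  al : SideType p q → SideType p q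
  /-- the initial vertex -/
  st : SideType p q → ℕ
  /-- the label -/
  lab : SideType p q → α × Bool
  p_eq : p = W.length
  q_eq : ∀ c, q c = (rw (ty c)).length
  al_al : ∀ y, al (al y) = y
  lab_al : ∀ y, lab (al y) = letterInv (lab y)
  lab_bd : ∀ i : Fin p, W[(i : ℕ)]? = some (lab (Sum.inl i))
  lab_cell : ∀ c (i : Fin (q c)), (rw (ty c))[(i : ℕ)]? = some (lab (Sum.inr ⟨c, i⟩))
  st_next : ∀ y, st (sideNext _ _ y) = st (al y)
  euler : Fintype.card (SideType p q) ≤ 2 * (Finset.univ.image st).card + 2 * k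
  conj : ∀ φ : SideType p q → G, (∀ y, φ (al y) = (φ y)⁻¹) →
    ConjProd (List.ofFn fun c => (List.ofFn fun i => φ (Sum.inr ⟨c, i⟩)).prod)
      (List.ofFn fun i => φ (Sum.inl i)).prod

theorem IsDia.nonempty_sideDia {J α G : Type*} [Group G] {rw : J → List (α × Bool)}
    {bd : List ℕ} {cells : List (J × List ℕ)} {al st : ℕ → ℕ}
    {lab : ℕ → α × Bool} {b0 : ℕ} {vs : Finset ℕ} {W : List (α × Bool)}
    (D : IsDia G rw W bd cells al st lab b0 vs) : Nonempty (SideDia G rw W cells.length) := by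
  classical
  set T := SideType bd.length (fun c : Fin cells.length => cells[c].2.length) with hT
  let e : T → ℕ := Sum.elim (fun i => bd[i]) (fun c => cells[c.1].2[c.2])
  have hnd := D.nodup
  rw [diaSides, List.nodup_append, List.nodup_flatten] at hnd
  obtain ⟨n1, ⟨n2, n3⟩, n4⟩ := hnd
  have hmemC : ∀ (c : Fin cells.length) (i : Fin cells[c].2.length),
      cells[c].2[i] ∈ (cells.map Prod.snd).flatten := fun c i =>
    List.mem_flatten.2 ⟨cells[c].2, List.mem_map.2 ⟨cells[c], by simp, rfl⟩, by simp⟩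
  have hmem : ∀ y : T, e y ∈ diaSides bd cells := by
    rintro (i | ⟨c, i⟩)
    · exact List.mem_append.2 (Or.inl (by simp [e]))
    · exact List.mem_append.2 (Or.inr (hmemC c i))
  have hinj : Function.Injective e := by
    rintro (i | ⟨c, i⟩) (i' | ⟨c', i'⟩) h
    · congr 1
      exact Fin.ext ((List.Nodup.getElem_inj_iff n1).1 h)
    · exact absurd h (n4 _ (by simp [e]) _ (hmemC c' i'))
    · exact absurd h.symm (n4 _ (by simp [e]) _ (hmemC c i))
    · have hc : c = c' := by
        by_contra hne
        rw [List.pairwise_iff_getElem] at n3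
        have key : ∀ c c' : Fin cells.length, c < c' → ∀ (i : Fin cells[c].2.length)
            (i' : Fin cells[c'].2.length), cells[c].2[i] ≠ cells[c'].2[i'] := by
          intro c c' hlt i i' h
          have := n3 c c' (by simp) (by simp) hlt
          simp only [List.getElem_map] at this
          exact this (a := cells[c].2[i]) (by simp) (by rw [h]; simp)
        rcases lt_or_gt_of_ne hne with h1 | h1
        · exact key c c' h1 i i' h
        · exact key c' c h1 i' i h.symm
      subst hc
      have : i = i' := Fin.ext ((List.Nodup.getElem_inj_iff (n2 _ (List.mem_map.2 ⟨cells[c], by simp, rfl⟩))).1 h)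
      rw [this]
  have hsurj : ∀ x ∈ diaSides bd cells, ∃ y, e y = x := by
    intro x hx
    rcases List.mem_append.1 hx with hx | hx
    · obtain ⟨i, hi, rfl⟩ := List.getElem_of_mem hx
      exact ⟨Sum.inl ⟨i, hi⟩, rfl⟩
    · obtain ⟨l, hl, hx⟩ := List.mem_flatten.1 hx
      obtain ⟨c, hc, rfl⟩ := List.mem_map.1 hl
      obtain ⟨j, hj, rfl⟩ := List.getElem_of_mem hc
      obtain ⟨i, hi, rfl⟩ := List.getElem_of_mem hx
      exact ⟨Sum.inr ⟨⟨j, hj⟩, ⟨i, hi⟩⟩, rfl⟩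
  choose inv hinv using hsurj
  have hinv' : ∀ y, inv (e y) (hmem y) = y := fun y => hinj (hinv _ (hmem y))
  let al' : T → T := fun y => inv (al (e y)) (D.al_mem _ (hmem y))
  have he : ∀ y, e (al' y) = al (e y) := fun y => hinv _ _
  refine ⟨⟨fun c => cells[c].1, bd.length, fun c => cells[c].2.length, al', st ∘ e, lab ∘ e,
    ?_, ?_, ?_, ?_, ?_, ?_, ?_, ?_, ?_⟩⟩
  · simp [← D.lab_bd]
  · intro c
    have := D.lab_cell cells[c] (by simp)
    rw [← this, List.length_map]
  · intro y
    apply hinj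
    rw [he, he, D.al_al _ (hmem y)]
  · intro y
    simp only [Function.comp, he]
    exact D.lab_al _ (hmem y)
  · intro i
    simp [← D.lab_bd, e]
  · intro c i
    have := D.lab_cell cells[c] (by simp)
    rw [← this, List.getElem?_map, List.getElem?_eq_getElem i.2]
    rfl
  · rintro (i | ⟨c, i⟩)
    · simp only [Function.comp, he]
      exact D.walk_bd.st_next i
    · simp only [Function.comp, he]
      obtain ⟨u, hu⟩ := D.walk_cell cells[c] (by simp)
      exact hu.st_next i
  · have h1 : Fintype.card T = (diaSides bd cells).length := by
      rw [← List.toFinset_card_of_nodup D.nodup, ← Finset.card_univ,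
        ← Finset.card_image_of_injective _ hinj]
      congr 1
      ext x
      simp only [Finset.mem_image, Finset.mem_univ, true_and, List.mem_toFinset]
      exact ⟨fun ⟨y, h⟩ => h ▸ hmem y, fun h => ⟨inv x h, hinv x h⟩⟩
    have h2 := D.euler
    have h3 : vs ⊆ insert b0 (Finset.univ.image (st ∘ e)) := by
      intro v hv
      rcases D.vs_sub v hv with rfl | ⟨x, hx, rfl⟩
      · simp
      · refine Finset.mem_insert_of_mem (Finset.mem_image.2 ⟨inv x hx, by simp, ?_⟩)
        simp [hinv x hx]
    have h4 := (Finset.card_le_card h3).trans (Finset.card_insert_le _ _)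
    rw [h1]
    omega
  · intro φ hφ
    let φ' : ℕ → G := fun x => if hx : x ∈ diaSides bd cells then φ (inv x hx) else 1
    have hφ' : ∀ y, φ' (e y) = φ y := fun y => by
      simp only [φ', hmem y, dif_pos, hinv']
    have := D.conj φ' (fun x hx => by
      rw [← hinv x hx, ← he, hφ', hφ', hφ])
    convert this using 1
    · refine List.ext_getElem (by simp) fun j h1 h2 => ?_
      simp only [List.getElem_ofFn, List.getElem_map]
      congr 1
      refine List.ext_getElem (by simp) fun i h3 h4 => ?_
      simp only [List.getElem_ofFn, List.getElem_map]
      exact (hφ' (Sum.inr ⟨⟨j, _⟩, ⟨i, _⟩⟩)).symm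
    · congr 1
      refine List.ext_getElem (by simp) fun i h3 h4 => ?_
      simp only [List.getElem_ofFn, List.getElem_map]
      exact (hφ' (Sum.inl ⟨i, _⟩)).symm

theorem HasDia.nonempty_sideDia {J α G : Type*} [Group G] {rw : J → List (α × Bool)}
    {k : ℕ} {W : List (α × Bool)} (h : HasDia G rw k W) : Nonempty (SideDia G rw W k) := by
  obtain ⟨bd, cells, al, st, lab, b0, vs, D, rfl⟩ := h
  exact D.nonempty_sideDia

/-- In a planar map, the number of corners not lying at a vertex of degree two is bounded in
terms of the number of faces and of spurs. -/
theorem card_nonsmooth_le {S V : Type*} [Fintype S] [DecidableEq S] [DecidableEq V] (al : S → S)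
    (nx : Equiv.Perm S) (st : S → V) (k : ℕ) (hal : ∀ y, al (al y) = y)
    (hst : ∀ y, st (nx y) = st (al y))
    (heuler : Fintype.card S ≤ 2 * (Finset.univ.image st).card + 2 * k) :
    (Finset.univ.filter fun y => nx (al y) ≠ al (nx.symm y)).card ≤
      6 * k + 4 * (Finset.univ.filter fun y => al (nx.symm y) = y).card := by
  set I := Finset.univ.image st
  let Nn : V → ℕ := fun v => (Finset.univ.filter fun y => st y = v).card
  let Nb : V → ℕ := fun v =>
    ((Finset.univ.filter fun y => nx (al y) ≠ al (nx.symm y)).filter fun y => st y = v).card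
  let Ns : V → ℕ := fun v =>
    ((Finset.univ.filter fun y => al (nx.symm y) = y).filter fun y => st y = v).card
  have e1 : Fintype.card S = ∑ v ∈ I, Nn v :=
    Finset.card_eq_sum_card_fiberwise (s := Finset.univ) (fun y _ => by simp [I])
  have e2 : (Finset.univ.filter fun y => nx (al y) ≠ al (nx.symm y)).card = ∑ v ∈ I, Nb v :=
    Finset.card_eq_sum_card_fiberwise (fun y _ => by simp [I])
  have e3 : (Finset.univ.filter fun y => al (nx.symm y) = y).card = ∑ v ∈ I, Ns v :=
    Finset.card_eq_sum_card_fiberwise (fun y _ => by simp [I])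
  have hτ : ∀ y, st (nx (al y)) = st y := fun y => by rw [hst, hal]
  have spur_of_fix : ∀ y, nx (al y) = y → al (nx.symm y) = y := fun y h => by
    rw [← Equiv.eq_symm_apply] at h
    rw [← h, hal]
  have key : ∀ v ∈ I, Nb v + 6 ≤ 3 * Nn v + 4 * Ns v := by
    intro v hv
    obtain ⟨y₀, -, hy₀⟩ := Finset.mem_image.1 hv
    have hmono : Nb v ≤ Nn v := Finset.card_le_card (fun y => by simp)
    have hpos : 0 < Nn v := Finset.card_pos.2 ⟨y₀, by simp [hy₀]⟩
    rcases Nat.lt_or_ge (Nn v) 2 with h1 | h1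
    · have h1 : Nn v = 1 := by omega
      obtain ⟨z, hz⟩ := Finset.card_eq_one.1 h1
      have hall : ∀ y, st y = v → y = z := fun y hy => by
        have : y ∈ (Finset.univ.filter fun y => st y = v) := by simp [hy]
        rw [hz] at this
        simpa using this
      have : 0 < Ns v := Finset.card_pos.2 ⟨y₀, by
        simp only [Finset.mem_filter, Finset.mem_univ, true_and]
        refine ⟨spur_of_fix _ ?_, hy₀⟩
        rw [hall y₀ hy₀]
        exact hall _ (by rw [hτ, ← hall y₀ hy₀, hy₀])⟩
      omega
    rcases Nat.lt_or_ge (Nn v) 3 with h2 | h2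
    · have h2 : Nn v = 2 := by omega
      have : Nb v ≤ Ns v := by
        refine Finset.card_le_card fun y hy => ?_
        simp only [Finset.mem_filter, Finset.mem_univ, true_and] at hy ⊢
        refine ⟨?_, hy.2⟩
        by_contra hns
        apply hy.1
        have h3 : nx (al y) ≠ y := fun h => hns (spur_of_fix y h)
        obtain ⟨a, b, hab, hf⟩ := Finset.card_eq_two.1 h2
        have hall : ∀ z, st z = v → z = a ∨ z = b := fun z hz => by
          have : z ∈ (Finset.univ.filter fun y => st y = v) := by simp [hz]
          rw [hf] at this
          simpa using this
        have h4 : nx (al (nx (al y))) ≠ nx (al y) := fun h => h3 (by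
          have := nx.injective h
          have := congrArg al this
          rwa [hal, hal] at this)
        have h5 : nx (al (nx (al y))) = y := by
          have i1 := hall y hy.2
          have i2 := hall (nx (al y)) (by rw [hτ, hy.2])
          have i3 := hall (nx (al (nx (al y)))) (by rw [hτ, hτ, hy.2])
          clear * - h3 h4 i1 i2 i3
          grind
        rw [← Equiv.eq_symm_apply] at h5
        rw [← h5, hal]
      omega
    · omega
  have := Finset.sum_le_sum key
  rw [Finset.sum_add_distrib, Finset.sum_add_distrib, ← Finset.mul_sum, ← Finset.mul_sum,
    ← e1, ← e2, ← e3, Finset.sum_const, smul_eq_mul] at this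
  omega

section Counting

variable {S : Type*}

lemma zpow_add_apply' (f : Equiv.Perm S) (a b : ℤ) (y : S) : (f ^ (a + b)) y = (f ^ a) ((f ^ b) y) := by
  rw [zpow_add]
  rfl

lemma zpow_one_add_apply (f : Equiv.Perm S) (b : ℤ) (y : S) : (f ^ (1 + b)) y = f ((f ^ b) y) := by
  rw [zpow_one_add]
  rfl

lemma zpow_sub_one_apply (f : Equiv.Perm S) (b : ℤ) (y : S) :
    (f ^ (b - 1)) y = f.symm ((f ^ b) y) := by
  rw [sub_eq_neg_add, zpow_add, zpow_neg_one]
  rfl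

/-- Along an unbroken run the opposite sides are traversed backwards. -/
lemma al_run {al : S → S} {nx : Equiv.Perm S} {Bk : S → Prop}
    (hsm : ∀ y, ¬ Bk y → nx (al y) = al (nx.symm y)) (y : S) (t : ℕ)
    (h : ∀ s : ℤ, 1 ≤ s → s ≤ t → ¬ Bk ((nx ^ s) y)) :
    al ((nx ^ (t : ℤ)) y) = (nx ^ (-(t : ℤ))) (al y) := by
  induction t with
  | zero => simp
  | succ t ih =>
    have h1 := hsm _ (h (t + 1 : ℕ) (by omega) le_rfl)
    rw [← zpow_sub_one_apply] at h1
    push_cast at h1 ⊢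
    rw [add_sub_cancel_right, ih fun s h1 h2 => h s h1 (by omega)] at h1
    rw [neg_add, ← sub_eq_add_neg, zpow_sub_one_apply, ← h1, Equiv.symm_apply_apply]

/-- The sides preceding a break by at most `Λ`. -/
lemma card_near_le [Fintype S] [DecidableEq S] (nx : Equiv.Perm S) (Bk : S → Prop) [DecidablePred Bk] (Λ : ℕ) :
    (Finset.univ.filter fun e => ∃ t ∈ Finset.Icc 1 Λ, Bk ((nx ^ (t : ℤ)) e)).card ≤
      Λ * (Finset.univ.filter Bk).card := by
  calc _ ≤ ((Finset.Icc 1 Λ).biUnion fun t =>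
        (Finset.univ.filter Bk).image fun β => (nx ^ (-(t : ℤ))) β).card := by
        refine Finset.card_le_card fun e he => ?_
        simp only [Finset.mem_filter, Finset.mem_univ, true_and] at he
        obtain ⟨t, ht, he⟩ := he
        simp only [Finset.mem_biUnion, Finset.mem_image, Finset.mem_filter, Finset.mem_univ, true_and]
        exact ⟨t, ht, _, he, by rw [← zpow_add_apply']; simp⟩
    _ ≤ ∑ t ∈ Finset.Icc 1 Λ, (Finset.univ.filter Bk).card :=
        Finset.card_biUnion_le.trans (Finset.sum_le_sum fun t _ => Finset.card_image_le)
    _ = _ := by simp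

open Classical in
/-- The combinatorial heart of the argument: if the cells of a diagram have small pieces and
are not adjacent to mirror images, and the boundary windows satisfy the balance inequality
`hG`, then the number of sides of cells is at most `Λ` times the number of breaks. -/
theorem card_cell_le [Fintype S] {α P : Type*} (al : S → S) (nx : Equiv.Perm S) (cell Bk : S → Prop)
    (π : S → P) (sh : Equiv.Perm P) (μ : P → P) (lb : P → α × Bool) (lab : S → α × Bool)
    (A : S → P → Prop) (Λ : ℕ) (hal : ∀ y, al (al y) = y)
    (hsm : ∀ y, ¬ Bk y → nx (al y) = al (nx.symm y)) (hBk : ∀ y, ¬ Bk y → ¬ Bk (nx (al y)))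
    (hcell : ∀ y, cell (nx y) ↔ cell y) (hπ : ∀ y, cell y → π (nx y) = sh (π y))
    (hμsh : ∀ p, μ (sh p) = sh.symm (μ p))
    (hlbμ : ∀ p, lb (μ p) = letterInv (lb p)) (hlab : ∀ y, lab (al y) = letterInv (lab y))
    (hlabc : ∀ y, cell y → lab y = lb (π y))
    (hSC : ∀ p p', (∀ t : ℤ, 0 ≤ t → t < Λ → lb ((sh ^ t) p) = lb ((sh ^ t) p')) → p = p')
    (hmir : ∀ y, cell y → cell (al y) → π (al y) ≠ μ (π y)) (hμμ : ∀ p, μ (μ p) = p)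
    (hA : ∀ b p, ¬ cell b → (∀ s : ℤ, 1 ≤ s → s ≤ Λ → ¬ Bk ((nx ^ s) b)) →
      (∀ s : ℤ, -Λ < s → s ≤ 0 → ¬ Bk ((nx ^ s) b)) →
      (∀ s : ℤ, -Λ ≤ s → s ≤ Λ → lab ((nx ^ s) b) = lb ((sh ^ s) p)) → A b p)
    (hA₁ : ∀ b p, A b p → ∀ t : ℤ, 0 ≤ t → t ≤ Λ → (∀ s : ℤ, 1 ≤ s → s ≤ t → ¬ Bk ((nx ^ s) b)) →
      lab ((nx ^ t) b) = lb ((sh ^ t) p))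
    (hA₂ : ∀ b p, A b p → ∀ t : ℤ, -Λ ≤ t → t ≤ 0 → (∀ s : ℤ, t < s → s ≤ 0 → ¬ Bk ((nx ^ s) b)) →
      lab ((nx ^ t) b) = lb ((sh ^ t) p))
    (hG : (Finset.univ.filter fun b => ¬ cell b ∧ cell (al b) ∧ A b (μ (π (al b)))).card ≤
      (Finset.univ.filter fun b => ¬ cell b ∧ cell (al b) ∧ ∃ p, A b p ∧ p ≠ μ (π (al b))).card +
      (Finset.univ.filter fun b => ¬ cell b ∧ ¬ cell (al b) ∧
        ∃ p, A b p ∧ ¬ A (al b) (μ p)).card) :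
    (Finset.univ.filter cell).card ≤ Λ * (Finset.univ.filter Bk).card := by
  have hcellz : ∀ (t : ℤ) y, cell ((nx ^ t) y) ↔ cell y := by
    intro t y
    induction t with
    | zero => simp
    | succ t ih => rw [add_comm, zpow_one_add_apply, hcell, ih]
    | pred t ih =>
      rw [zpow_sub_one_apply, ← ih, ← hcell (nx.symm _), Equiv.apply_symm_apply]
  have hπz : ∀ (t : ℤ) y, cell y → π ((nx ^ t) y) = (sh ^ t) (π y) := by
    intro t y hy
    induction t with
    | zero => simp
    | succ t ih =>
      rw [add_comm, zpow_one_add_apply, zpow_one_add_apply, hπ _ ((hcellz _ _).2 hy), ih]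
    | pred t ih =>
      rw [zpow_sub_one_apply, zpow_sub_one_apply, ← ih, Equiv.eq_symm_apply, ← hπ,
        Equiv.apply_symm_apply]
      rw [← hcell, Equiv.apply_symm_apply]
      exact (hcellz _ _).2 hy
  have hμz : ∀ (t : ℤ) p, μ ((sh ^ t) p) = (sh ^ (-t)) (μ p) := by
    intro t p
    induction t with
    | zero => simp
    | succ t ih =>
      rw [add_comm, zpow_one_add_apply, hμsh, ih, add_comm, neg_add, ← sub_eq_add_neg,
        zpow_sub_one_apply]
    | pred t ih =>
      rw [show -(-(t : ℤ) - 1) = 1 + -(-(t : ℤ)) by ring, zpow_one_add_apply, ← ih,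
        ← Equiv.symm_apply_eq, ← hμsh, zpow_sub_one_apply, Equiv.apply_symm_apply]
  have hBk' : ∀ y, ¬ Bk (nx (al y)) → ¬ Bk y := fun y h => by
    have h1 := hBk _ h
    rwa [hsm _ h, Equiv.symm_apply_apply, hal] at h1
  -- opposite sides along runs
  have run₁ : ∀ y (t : ℤ), 0 ≤ t → (∀ s : ℤ, 1 ≤ s → s ≤ t → ¬ Bk ((nx ^ s) y)) →
      al ((nx ^ t) y) = (nx ^ (-t)) (al y) := by
    intro y t ht h
    lift t to ℕ using ht
    exact al_run hsm y t h
  have run₂ : ∀ y (t : ℤ), t ≤ 0 → (∀ s : ℤ, t < s → s ≤ 0 → ¬ Bk ((nx ^ s) y)) →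
      al ((nx ^ t) y) = (nx ^ (-t)) (al y) := by
    intro y t ht h
    have := run₁ ((nx ^ t) y) (-t) (by omega) (fun s h1 h2 => by
      rw [← zpow_add_apply']
      exact h _ (by omega) (by omega))
    rw [← zpow_add_apply', neg_add_cancel, neg_neg, zpow_zero, Equiv.Perm.one_apply] at this
    rw [this, ← zpow_add_apply', neg_add_cancel, zpow_zero, Equiv.Perm.one_apply]
  have labrun : ∀ y (t : ℤ), cell (al y) → al ((nx ^ t) y) = (nx ^ (-t)) (al y) →
      lab ((nx ^ t) y) = lb ((sh ^ t) (μ (π (al y)))) := by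
    intro y t hy h
    rw [← hal ((nx ^ t) y), hlab, h, hlabc _ ((hcellz _ _).2 hy), hπz _ _ hy, ← hlbμ, hμz, neg_neg]
  -- breaks of the opposite side
  have bkrun₁ : ∀ y (t : ℤ), (∀ s : ℤ, 1 ≤ s → s ≤ t → ¬ Bk ((nx ^ s) y)) →
      ∀ s : ℤ, -t < s → s ≤ 0 → ¬ Bk ((nx ^ s) (al y)) := by
    intro y t h s h1 h2
    have h3 := run₁ y (-s) (by omega) (fun r h3 h4 => h r h3 (by omega))
    rw [neg_neg] at h3
    have h4 := h (1 + -s) (by omega) (by omega)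
    rw [← h3]
    have h5 := hBk _ h4
    rwa [hsm _ h4, zpow_one_add_apply, Equiv.symm_apply_apply] at h5
  have bkrun₂ : ∀ y (t : ℤ), (∀ s : ℤ, -t < s → s ≤ 0 → ¬ Bk ((nx ^ s) y)) →
      ∀ s : ℤ, 1 ≤ s → s ≤ t → ¬ Bk ((nx ^ s) (al y)) := by
    intro y t h s h1 h2
    have h3 := run₂ y (-(s - 1)) (by omega) (fun r h3 h4 => h r (by omega) h4)
    have h4 := h (-(s - 1)) (by omega) (by omega)
    rw [neg_neg] at h3
    rw [show s = 1 + (s - 1) by ring, zpow_one_add_apply, ← h3]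
    exact hBk _ h4
  have SC' : ∀ (a : ℤ) p p', (∀ t : ℤ, a ≤ t → t < a + Λ → lb ((sh ^ t) p) = lb ((sh ^ t) p')) →
      p = p' := by
    intro a p p' h
    apply (sh ^ a).injective
    apply hSC
    intro t h1 h2
    rw [← zpow_add_apply', ← zpow_add_apply']
    exact h _ (by omega) (by omega)
  let near : S → Prop := fun e => ∃ t ∈ Finset.Icc 1 Λ, Bk ((nx ^ (t : ℤ)) e)
  have far_iff : ∀ e, ¬ near e → ∀ s : ℤ, 1 ≤ s → s ≤ Λ → ¬ Bk ((nx ^ s) e) := by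
    intro e he s h1 h2 h3
    lift s to ℕ using by omega
    exact he ⟨s, by simp; omega, h3⟩
  have near_of : ∀ e, ¬ (∀ s : ℤ, 1 ≤ s → s ≤ Λ → ¬ Bk ((nx ^ s) e)) → near e := by
    intro e he
    by_contra h
    exact he (far_iff e h)
  let back : S → Prop := fun e => ∀ s : ℤ, -Λ < s → s ≤ 0 → ¬ Bk ((nx ^ s) e)
  let N0 := Finset.univ.filter fun y => cell y ∧ near y
  let F0 := Finset.univ.filter fun y => cell y ∧ ¬ near y
  let E1 := Finset.univ.filter fun e => ¬ cell e ∧ cell (al e) ∧ back e ∧ near e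
  let G := Finset.univ.filter fun b => ¬ cell b ∧ cell (al b) ∧ A b (μ (π (al b)))
  let T1 := Finset.univ.filter fun b => ¬ cell b ∧ cell (al b) ∧ ∃ p, A b p ∧ p ≠ μ (π (al b))
  let T2 := Finset.univ.filter fun b => ¬ cell b ∧ ¬ cell (al b) ∧ ∃ p, A b p ∧ ¬ A (al b) (μ p)
  have hal_inj : Function.Injective al := fun a b h => by rw [← hal a, h, hal]
  have cardF : F0.card ≤ E1.card + G.card := by
    refine le_trans ?_ (Finset.card_union_le _ _)
    refine Finset.card_le_card_of_injOn al (fun y hy => ?_) hal_inj.injOn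
    simp only [F0, Finset.coe_filter, Finset.mem_univ, true_and, Set.mem_ofPred_eq] at hy
    obtain ⟨hc, hf⟩ := hy
    have hf' := far_iff y hf
    have hnc : ¬ cell (al y) := by
      intro hc'
      refine hmir y hc hc' ?_
      rw [← hμμ (π (al y))]
      congr 1
      refine SC' 0 _ _ fun t h1 h2 => ?_
      rw [← labrun y t hc' (run₁ y t h1 fun s h3 h4 => hf' s h3 (by omega)),
        hlabc _ ((hcellz _ _).2 hc), hπz _ _ hc]
    have hback : back (al y) := bkrun₁ y Λ hf'
    simp only [Finset.coe_union, Set.mem_union, Finset.mem_coe, E1, G, Finset.mem_filter,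
      Finset.mem_univ, true_and]
    by_cases hn : near (al y)
    · exact Or.inl ⟨hnc, by rwa [hal], hback, hn⟩
    · refine Or.inr ⟨hnc, by rwa [hal], hA _ _ hnc (far_iff _ hn) hback fun s h1 h2 => ?_⟩
      refine labrun _ _ (by rwa [hal]) ?_
      rcases le_total 0 s with h | h
      · exact run₁ _ _ h fun r h3 h4 => far_iff _ hn _ h3 (by omega)
      · exact run₂ _ _ h fun r h3 h4 => hback _ (by omega) h4
  have T1near : ∀ b ∈ T1, near b := by
    intro b hb
    simp only [T1, Finset.mem_filter, Finset.mem_univ, true_and] at hb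
    obtain ⟨-, hc, p, hAp, hne⟩ := hb
    refine near_of _ fun hf => hne (SC' 0 _ _ fun t h1 h2 => ?_)
    rw [← hA₁ b p hAp t h1 (by omega) fun s h3 h4 => hf s h3 (by omega)]
    exact labrun b t hc (run₁ b t h1 fun s h3 h4 => hf s h3 (by omega))
  have T2near : ∀ b ∈ T2, ¬ near b → near (al b) := by
    intro b hb hfb
    simp only [T2, Finset.mem_filter, Finset.mem_univ, true_and] at hb
    obtain ⟨-, hc, p, hAp, hne⟩ := hb
    refine near_of _ fun hf => hne ?_
    have hfb' := far_iff b hfb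
    have hback' := bkrun₁ b Λ hfb'
    have hbackb : back b := by
      have := bkrun₁ (al b) Λ hf
      rwa [hal] at this
    refine hA _ _ hc hf hback' fun s h1 h2 => ?_
    have hrun : al ((nx ^ (-s)) b) = (nx ^ s) (al b) := by
      rcases le_total 0 s with h | h
      · have := run₂ b (-s) (by omega) fun r h3 h4 => hbackb _ (by omega) h4
        rwa [neg_neg] at this
      · have := run₁ b (-s) (by omega) fun r h3 h4 => hfb' _ h3 (by omega)
        rwa [neg_neg] at this
    have hl : lab ((nx ^ (-s)) b) = lb ((sh ^ (-s)) p) := by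
      rcases le_total 0 s with h | h
      · exact hA₂ b p hAp _ (by omega) (by omega) fun r h3 h4 => hbackb _ (by omega) h4
      · exact hA₁ b p hAp _ (by omega) (by omega) fun r h3 h4 => hfb' _ h3 (by omega)
    rw [← hrun, hlab, hl, ← hlbμ, hμz, neg_neg]
  let T2a := T2.filter near
  let T2b := (T2.filter fun b => ¬ near b).image al
  have cardT2 : T2.card = T2a.card + T2b.card := by
    rw [Finset.card_image_of_injective _ hal_inj]
    exact (Finset.card_filter_add_card_filter_not (s := T2) near).symm
  have d1 : Disjoint N0 (E1 ∪ T1 ∪ T2a ∪ T2b) := by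
    rw [Finset.disjoint_left]
    intro e he he'
    simp only [N0, E1, T1, T2a, T2b, T2, Finset.mem_union, Finset.mem_filter, Finset.mem_univ,
      true_and, Finset.mem_image] at he he'
    rcases he' with ((h | h) | h) | ⟨b, h, rfl⟩
    · exact h.1 he.1
    · exact h.1 he.1
    · exact h.1.1 he.1
    · exact h.1.2.1 he.1
  have d2 : Disjoint E1 T1 := by
    rw [Finset.disjoint_left]
    intro e he he'
    simp only [E1, T1, Finset.mem_filter, Finset.mem_univ, true_and] at he he'
    obtain ⟨-, hc, hb, -⟩ := he
    obtain ⟨-, -, p, hAp, hne⟩ := he'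
    refine hne (SC' (1 - Λ) _ _ fun t h1 h2 => ?_)
    rw [← hA₂ e p hAp t (by omega) (by omega) fun s h3 h4 => hb s (by omega) h4]
    exact labrun e t hc (run₂ e t (by omega) fun s h3 h4 => hb s (by omega) h4)
  have d3 : Disjoint (E1 ∪ T1) T2a := by
    rw [Finset.disjoint_left]
    intro e he he'
    simp only [E1, T1, T2a, T2, Finset.mem_union, Finset.mem_filter, Finset.mem_univ,
      true_and] at he he'
    rcases he with h | h
    · exact he'.1.2.1 h.2.1
    · exact he'.1.2.1 h.2.1
  have d4 : Disjoint (E1 ∪ T1 ∪ T2a) T2b := by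
    rw [Finset.disjoint_left]
    intro e he he'
    simp only [E1, T1, T2a, T2b, T2, Finset.mem_union, Finset.mem_filter, Finset.mem_univ,
      true_and, Finset.mem_image] at he he'
    obtain ⟨b, ⟨⟨hb1, hb2, p, hAp, hne⟩, hfb⟩, rfl⟩ := he'
    rcases he with (h | h) | h
    · exact hb1 (by rw [← hal b]; exact h.2.1)
    · exact hb1 (by rw [← hal b]; exact h.2.1)
    · obtain ⟨⟨-, -, p', hAp', -⟩, -⟩ := h
      have hfb' := far_iff b hfb
      have hback := bkrun₁ b Λ hfb'
      apply hne
      suffices p' = μ p from this ▸ hAp'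
      refine SC' (1 - Λ) _ _ fun t h1 h2 => ?_
      rw [← hA₂ _ p' hAp' t (by omega) (by omega) fun s h3 h4 => hback s (by omega) h4]
      have h5 := run₁ b (-t) (by omega) fun s h3 h4 => hfb' s h3 (by omega)
      rw [neg_neg] at h5
      rw [← h5, hlab, hA₁ b p hAp (-t) (by omega) (by omega) fun s h3 h4 => hfb' s h3 (by omega),
        ← hlbμ, hμz, neg_neg]
  have hsub : N0 ∪ (E1 ∪ T1 ∪ T2a ∪ T2b) ⊆ Finset.univ.filter near := by
    intro e he
    simp only [Finset.mem_filter, Finset.mem_univ, true_and]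
    simp only [Finset.mem_union] at he
    rcases he with h | ((h | h) | h) | h
    · exact (Finset.mem_filter.1 h).2.2
    · exact (Finset.mem_filter.1 h).2.2.2.2
    · exact T1near e h
    · exact (Finset.mem_filter.1 h).2
    · obtain ⟨b, hb, rfl⟩ := Finset.mem_image.1 h
      obtain ⟨h1, h2⟩ := Finset.mem_filter.1 hb
      exact T2near b h1 h2
  have c1 := Finset.card_le_card hsub
  rw [Finset.card_union_of_disjoint d1, Finset.card_union_of_disjoint d4,
    Finset.card_union_of_disjoint d3, Finset.card_union_of_disjoint d2] at c1
  have c2 : (Finset.univ.filter near).card ≤ Λ * (Finset.univ.filter Bk).card := by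
    convert card_near_le nx Bk Λ
  have c3 : (Finset.univ.filter cell).card = N0.card + F0.card := by
    rw [← Finset.card_filter_add_card_filter_not (s := Finset.univ.filter cell) near,
      Finset.filter_filter, Finset.filter_filter]
  have c4 : G.card ≤ T1.card + T2.card := hG
  omega

end Counting

section Area

variable {G : Type*} [Group G]

lemma ConjProd.append {L L' : List G} {g h : G} (hg : ConjProd L g) (hh : ConjProd L' h) :
    ConjProd (L ++ L') (g * h) := by
  induction hg with
  | nil => simpa using hh
  | cons x k _ ih =>
    rw [List.cons_append, mul_assoc]
    exact .cons x k ih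

lemma ConjProd.conj {L : List G} {g : G} (hg : ConjProd L g) (x : G) :
    ConjProd L (x * g * x⁻¹) := by
  induction hg with
  | nil => simpa using ConjProd.nil
  | cons y k _ ih =>
    convert ConjProd.cons y (x * k) ih using 1
    group

/-- The element `g` is a product of at most `k` conjugates of inverses of elements of `R`. -/
def AreaLE (R : Set G) (k : ℕ) (g : G) : Prop :=
  ∃ L : List G, (∀ x ∈ L, x ∈ R) ∧ L.length ≤ k ∧ ConjProd L g

variable {R : Set G}

lemma areaLE_one (k : ℕ) : AreaLE R k 1 := ⟨[], by simp, by simp, .nil⟩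

lemma areaLE_zero {g : G} : AreaLE R 0 g ↔ g = 1 := by
  refine ⟨?_, fun h => h ▸ areaLE_one 0⟩
  rintro ⟨L, -, h, hL⟩
  obtain rfl : L = [] := by simpa using h
  cases hL
  rfl

lemma AreaLE.mono {k k' : ℕ} {g : G} (h : AreaLE R k g) (hk : k ≤ k') : AreaLE R k' g := by
  obtain ⟨L, h1, h2, h3⟩ := h
  exact ⟨L, h1, h2.trans hk, h3⟩

lemma AreaLE.mul {k k' : ℕ} {g h : G} (hg : AreaLE R k g) (hh : AreaLE R k' h) :
    AreaLE R (k + k') (g * h) := by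
  obtain ⟨L, h1, h2, h3⟩ := hg
  obtain ⟨L', h1', h2', h3'⟩ := hh
  refine ⟨L ++ L', fun x hx => (List.mem_append.1 hx).elim (h1 x) (h1' x), ?_, h3.append h3'⟩
  rw [List.length_append]
  omega

lemma AreaLE.conj {k : ℕ} {g : G} (hg : AreaLE R k g) (x : G) : AreaLE R k (x * g * x⁻¹) := by
  obtain ⟨L, h1, h2, h3⟩ := hg
  exact ⟨L, h1, h2, h3.conj x⟩

lemma areaLE_inv_of_mem {x : G} (hx : x ∈ R) : AreaLE R 1 x⁻¹ :=
  ⟨[x], by simpa using hx, by simp, by simpa using ConjProd.cons x 1 ConjProd.nil⟩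

lemma AreaLE.inv (hR : ∀ x ∈ R, x⁻¹ ∈ R) {k : ℕ} {g : G} (hg : AreaLE R k g) :
    AreaLE R k g⁻¹ := by
  obtain ⟨L, h1, h2, h3⟩ := hg
  refine AreaLE.mono ?_ h2
  clear h2
  induction h3 with
  | nil => simpa using areaLE_one _
  | cons x y h ih =>
    have h4 := ih fun z hz => h1 z (List.mem_cons_of_mem _ hz)
    have h5 := (areaLE_inv_of_mem (hR x (h1 x (by simp)))).conj y
    convert h4.mul h5 using 1 <;> simp [mul_assoc]

lemma ConjProd.areaLE (hR : ∀ x ∈ R, x⁻¹ ∈ R) {k : ℕ} {f : Fin k → G} {g : G} {a : Fin k → ℕ}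
    (h : ConjProd (List.ofFn f) g) (ha : ∀ c, AreaLE R (a c) (f c)) : AreaLE R (∑ c, a c) g := by
  induction k generalizing g with
  | zero =>
    rw [List.ofFn_zero] at h
    cases h
    exact areaLE_one _
  | succ k ih =>
    rw [List.ofFn_succ] at h
    cases h with
    | cons x y h' =>
      rw [Fin.sum_univ_succ]
      exact (((ha 0).inv hR).conj _).mul (ih h' fun c => ha c.succ)

lemma areaLE_mul_div {a b : ℕ} {g g' h h' : G} (hg : AreaLE R a (g * g'⁻¹))
    (hh : AreaLE R b (h * h'⁻¹)) : AreaLE R (a + b) (g * h * (g' * h')⁻¹) := by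
  convert ((hh.conj g).mul hg).mono (add_comm b a).le using 1
  group

lemma areaLE_prod_div {T : Type*} (l : List T) (f f' : T → G) (a : T → ℕ)
    (h : ∀ t ∈ l, AreaLE R (a t) (f t * (f' t)⁻¹)) :
    AreaLE R (l.map a).sum ((l.map f).prod * ((l.map f').prod)⁻¹) := by
  induction l with
  | nil => simpa using areaLE_one _
  | cons t l ih =>
    simp only [List.map_cons, List.prod_cons, List.sum_cons]
    exact areaLE_mul_div (h t (by simp)) (ih fun t ht => h t (by simp [ht]))

lemma areaLE_ofFn_div {k : ℕ} (f f' : Fin k → G) (a : Fin k → ℕ)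
    (h : ∀ t, AreaLE R (a t) (f t * (f' t)⁻¹)) :
    AreaLE R (∑ i, a i) ((List.ofFn f).prod * ((List.ofFn f').prod)⁻¹) := by
  have := areaLE_prod_div (List.finRange k) f f' a fun t _ => h t
  rwa [← List.ofFn_eq_map, ← List.ofFn_eq_map, ← List.ofFn_eq_map, List.sum_ofFn] at this

lemma exists_areaLE_of_mem_normalClosure (hR : ∀ x ∈ R, x⁻¹ ∈ R) {g : G}
    (hg : g ∈ Subgroup.normalClosure R) : ∃ k, AreaLE R k g := by
  refine Subgroup.closure_induction (p := fun g _ => ∃ k, AreaLE R k g) ?_ ⟨0, areaLE_one 0⟩ ?_ ?_ hg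
  · intro x hx
    obtain ⟨y, hy, hc⟩ := Group.mem_conjugatesOfSet_iff.1 hx
    obtain ⟨c, rfl⟩ := isConj_iff.1 hc
    have := (areaLE_inv_of_mem (hR y hy)).conj c
    rw [inv_inv] at this
    exact ⟨1, this⟩
  · rintro x y - - ⟨k, hk⟩ ⟨k', hk'⟩
    exact ⟨_, hk.mul hk'⟩
  · rintro x - ⟨k, hk⟩
    exact ⟨k, hk.inv hR⟩

lemma AreaLE.mem_normalClosure {k : ℕ} {g : G} (hg : AreaLE R k g) :
    g ∈ Subgroup.normalClosure R := by
  obtain ⟨L, h1, -, h3⟩ := hg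
  induction h3 with
  | nil => exact one_mem _
  | cons x y _ ih =>
    refine mul_mem ?_ (ih fun z hz => h1 z (List.mem_cons_of_mem _ hz))
    exact Subgroup.normalClosure_normal.conj_mem _
      (inv_mem (Subgroup.subset_normalClosure (h1 x (by simp)))) y

end Area

open Classical in
/-- The number of elements with property `P`. -/
noncomputable def cnt {T : Type*} [Fintype T] (P : T → Prop) : ℕ := (Finset.univ.filter P).card

lemma cnt_mono {T : Type*} [Fintype T] {P Q : T → Prop} (h : ∀ t, P t → Q t) : cnt P ≤ cnt Q :=
  Finset.card_le_card fun t => by simpa using h t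

lemma cnt_eq_card {T : Type*} [Fintype T] (P : T → Prop) [DecidablePred P] :
    cnt P = (Finset.univ.filter P).card := by
  unfold cnt
  congr

section Push

open FreeGroup Classical

variable {ι α : Type*}

/-- The relator `s i` or its formal inverse. -/
def relWord (s : ι → List (α × Bool)) (j : ι × Bool) : List (α × Bool) :=
  if j.2 then s j.1 else invRev (s j.1)

lemma length_relWord (s : ι → List (α × Bool)) (j : ι × Bool) :
    (relWord s j).length = (s j.1).length := by
  unfold relWord
  split <;> simp

/-- The relators and their inverses. -/
def relSet (s : ι → List (α × Bool)) : Set (FreeGroup α) :=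
  Set.range fun j => mk (relWord s j)

lemma mk_relWord_false (s : ι → List (α × Bool)) (i : ι) :
    mk (relWord s (i, false)) = (mk (relWord s (i, true)))⁻¹ := by
  simp [relWord, inv_mk]

lemma inv_mem_relSet (s : ι → List (α × Bool)) : ∀ x ∈ relSet s, x⁻¹ ∈ relSet s := by
  rintro _ ⟨⟨i, b⟩, rfl⟩
  refine ⟨(i, !b), ?_⟩
  cases b <;> simp [mk_relWord_false]

/-- The value of the letter at place `z` of `s` computed from the relation `s = 1`. -/
def solveAt (s : List (α × Bool)) (z : ℕ) : FreeGroup α :=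
  (mk (s.take z))⁻¹ * (mk (s.drop (z + 1)))⁻¹

lemma areaLE_mk_relWord (s : ι → List (α × Bool)) (j : ι × Bool) :
    AreaLE (relSet s) 1 (mk (relWord s j)) := by
  have := areaLE_inv_of_mem (inv_mem_relSet s _ ⟨j, rfl⟩)
  rwa [inv_inv] at this

lemma take_mul_letter_mul_drop {s : List (α × Bool)} {z : ℕ} {x : α × Bool}
    (h : s[z]? = some x) : mk (s.take z) * mk [x] * mk (s.drop (z + 1)) = mk s := by
  rw [mul_mk, mul_mk]
  congr 1
  obtain ⟨h1, rfl⟩ := List.getElem?_eq_some_iff.1 h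
  simp

lemma areaLE_solveAt {s : ι → List (α × Bool)} {i : ι} {z : ℕ} {x : α × Bool}
    (h : (s i)[z]? = some x) : AreaLE (relSet s) 1 (solveAt (s i) z * (mk [x])⁻¹) := by
  have h2 := (areaLE_mk_relWord s (i, false)).conj (mk ((s i).take z))⁻¹
  have h3 : mk (relWord s (i, true)) = mk (s i) := by simp [relWord]
  rw [mk_relWord_false, h3, ← take_mul_letter_mul_drop h] at h2
  convert h2 using 1
  unfold solveAt
  group

lemma mk_letterInv (x : α × Bool) : mk [letterInv x] = (mk [x])⁻¹ := by
  simp [inv_mk, letterInv, invRev]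

lemma prod_map_mk (l : List (α × Bool)) : (l.map fun x => mk [x]).prod = mk l := by
  induction l with
  | nil => rfl
  | cons x l ih => simp [ih, mul_mk]


/-- The place of `s j.1` at which side `i` of a cell of type `j` is, and its orientation. -/
def cellTag (s : ι → List (α × Bool)) (j : ι × Bool) (i : ℕ) : ι × ℕ × Bool :=
  (j.1, if j.2 then i else (s j.1).length - 1 - i, j.2)

lemma prod_map_mk_set {l : List (α × Bool)} {i : ℕ} (hi : i < l.length) (v : FreeGroup α) :
    ((l.map fun x => mk [x]).set i v).prod = mk (l.take i) * v * mk (l.drop (i + 1)) := by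
  rw [List.prod_set, if_pos (by simpa using hi), ← List.map_take, ← List.map_drop, prod_map_mk,
    prod_map_mk]

lemma prod_set_solveAt {s : ι → List (α × Bool)} {i₀ : ι} {z : ℕ} (hz : z < (s i₀).length)
    {j : ι × Bool} {i : ℕ} {b : Bool} (hi : i < (relWord s j).length)
    (h : cellTag s j i = (i₀, z, b)) :
    (((relWord s j).map fun x => mk [x]).set i
      (if b then solveAt (s i₀) z else (solveAt (s i₀) z)⁻¹)).prod = 1 := by
  rw [prod_map_mk_set hi]
  rw [length_relWord] at hi
  obtain ⟨j, c⟩ := j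
  simp only [cellTag, Prod.mk.injEq] at h hi ⊢
  obtain ⟨rfl, h, rfl⟩ := h
  cases c
  · simp only [Bool.false_eq_true, if_false] at h ⊢
    have h1 : (relWord s (j, false)).take i = invRev ((s j).drop (z + 1)) := by
      simp only [relWord, invRev, Bool.false_eq_true, if_false]
      rw [List.take_reverse, List.length_map, ← List.map_drop]
      congr 3
      omega
    have h2 : (relWord s (j, false)).drop (i + 1) = invRev ((s j).take z) := by
      simp only [relWord, invRev, Bool.false_eq_true, if_false]
      rw [List.drop_reverse, List.length_map, ← List.map_take]
      congr 3
      omega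
    rw [h1, h2, ← inv_mk, ← inv_mk]
    unfold solveAt
    group
  · simp only [if_true] at h ⊢
    subst h
    simp only [relWord, if_true, solveAt]
    group

lemma cellTag_inj {s : ι → List (α × Bool)} {j : ι × Bool} {i i' z : ℕ} {i₀ : ι} {b b' : Bool}
    (hi : i < (s j.1).length) (hi' : i' < (s j.1).length)
    (h : cellTag s j i = (i₀, z, b)) (h' : cellTag s j i' = (i₀, z, b')) : i = i' := by
  simp only [cellTag, Prod.mk.injEq] at h h'
  have := h.2.1.trans h'.2.1.symm
  split at this <;> omega

/-- Replacing the letters on some sides of a cell by the value solved from a relator. -/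
lemma areaLE_cell {s : ι → List (α × Bool)} {i₀ : ι} {z : ℕ} {x₀ : α × Bool}
    (hz : (s i₀)[z]? = some x₀) {q : ℕ} {j : ι × Bool} (hq : q = (relWord s j).length)
    (φ : Fin q → FreeGroup α) (lab : Fin q → α × Bool) (M M' : Fin q → Prop)
    (hlab : ∀ i : Fin q, (relWord s j)[(i : ℕ)]? = some (lab i))
    (hM : ∀ i, M i → lab i = x₀ ∧ φ i = solveAt (s i₀) z)
    (hM' : ∀ i, M' i → lab i = letterInv x₀ ∧ φ i = (solveAt (s i₀) z)⁻¹)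
    (hMM : ∀ i, ¬ M i → ¬ M' i → φ i = mk [lab i]) :
    ∃ a, AreaLE (relSet s) a (List.ofFn φ).prod ∧
      a + cnt (fun i : Fin q => (M i ∧ cellTag s j i = (i₀, z, true)) ∨
        (M' i ∧ cellTag s j i = (i₀, z, false))) ≤ 1 +
      cnt (fun i : Fin q => (M i ∧ cellTag s j i ≠ (i₀, z, true)) ∨
        (M' i ∧ cellTag s j i ≠ (i₀, z, false))) := by
  have hz' := (List.getElem?_eq_some_iff.1 hz).1
  set Sp : Fin q → Prop := fun i => (M i ∧ cellTag s j i = (i₀, z, true)) ∨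
        (M' i ∧ cellTag s j i = (i₀, z, false)) with hSp
  set Ns : Fin q → Prop := fun i => (M i ∧ cellTag s j i ≠ (i₀, z, true)) ∨
        (M' i ∧ cellTag s j i ≠ (i₀, z, false)) with hNs
  have hMd : ∀ i, M i → ¬ M' i := fun i h h' =>
    letterInv_ne x₀ ((hM' i h').1.symm.trans (hM i h).1)
  have hlt : ∀ i : Fin q, (i : ℕ) < (s j.1).length := fun i => by
    rw [← length_relWord, ← hq]; exact i.2
  have hle : ∀ i, AreaLE (relSet s) 1 (φ i * (mk [lab i])⁻¹) := by
    intro i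
    by_cases h1 : M i
    · rw [(hM i h1).1, (hM i h1).2]
      exact areaLE_solveAt hz
    by_cases h2 : M' i
    · rw [(hM' i h2).1, (hM' i h2).2, mk_letterInv, inv_inv]
      have := ((areaLE_solveAt hz).inv (inv_mem_relSet s)).conj (mk [x₀])⁻¹
      convert this using 1
      group
    · rw [hMM i h1 h2, mul_inv_cancel]
      exact areaLE_one 1
  have hofFn : List.ofFn (fun i => mk [lab i]) = (relWord s j).map fun x => mk [x] := by
    apply List.ext_getElem
    · simpa using hq
    · intro i h1 h2
      simp only [List.length_ofFn] at h1
      have := hlab ⟨i, h1⟩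
      rw [List.getElem?_eq_some_iff] at this
      obtain ⟨h3, h4⟩ := this
      simp [← h4]
  by_cases h : ∃ i, Sp i
  · obtain ⟨i₁, hi₁⟩ := h
    have huniq : cnt Sp ≤ 1 := by
      refine Finset.card_le_one.2 fun a ha b hb => ?_
      simp only [Finset.mem_filter, Finset.mem_univ, true_and, hSp] at ha hb
      refine Fin.ext ?_
      rcases ha with ha | ha <;> rcases hb with hb | hb <;>
        exact cellTag_inj (hlt _) (hlt _) ha.2 hb.2
    refine ⟨cnt Ns, ?_, by omega⟩
    have h1 := areaLE_ofFn_div (R := relSet s) φ (fun i => if i = i₁ then φ i₁ else mk [lab i])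
      (fun i => if Ns i then 1 else 0) ?_
    · rw [Finset.sum_boole, Nat.cast_id, ← cnt_eq_card] at h1
      have h2 : List.ofFn (fun i => if i = i₁ then φ i₁ else mk [lab i]) =
          ((relWord s j).map fun x => mk [x]).set i₁ (φ i₁) := by
        rw [← hofFn]
        apply List.ext_getElem
        · simp
        · intro i h1 h2
          simp [List.getElem_set, Fin.ext_iff, eq_comm]
      rw [h2] at h1
      have h3 : (((relWord s j).map fun x => mk [x]).set i₁ (φ i₁)).prod = 1 := by
        rcases hi₁ with h3 | h3
        · have := prod_set_solveAt hz' (by rw [← hq]; exact i₁.2) h3.2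
          rwa [if_pos rfl, ← (hM _ h3.1).2] at this
        · have := prod_set_solveAt hz' (by rw [← hq]; exact i₁.2) h3.2
          rwa [if_neg (by simp), ← (hM' _ h3.1).2] at this
      rwa [h3, inv_one, mul_one] at h1
    · intro i
      by_cases hi : i = i₁
      · subst hi
        simpa using areaLE_one _
      · simp only [hi, if_false]
        have hns : ¬ Sp i := fun hS => hi
          (Finset.card_le_one.1 huniq i (by simpa using hS) i₁ (by simpa using hi₁))
        by_cases hn : Ns i
        · rw [if_pos hn]
          exact hle i
        · rw [if_neg hn, hMM i, mul_inv_cancel]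
          · exact areaLE_one 0
          · intro hm
            by_cases hc : cellTag s j i = (i₀, z, true)
            · exact hns (.inl ⟨hm, hc⟩)
            · exact hn (.inl ⟨hm, hc⟩)
          · intro hm
            by_cases hc : cellTag s j i = (i₀, z, false)
            · exact hns (.inr ⟨hm, hc⟩)
            · exact hn (.inr ⟨hm, hc⟩)
  · push Not at h
    refine ⟨cnt Ns + 1, ?_, ?_⟩
    · have h1 := areaLE_ofFn_div (R := relSet s) φ (fun i => mk [lab i])
        (fun i => if Ns i then 1 else 0) ?_
      · rw [Finset.sum_boole, Nat.cast_id, ← cnt_eq_card, hofFn, prod_map_mk] at h1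
        have h2 := h1.mul (areaLE_mk_relWord s j)
        rwa [inv_mul_cancel_right] at h2
      · intro i
        by_cases hn : Ns i
        · rw [if_pos hn]
          exact hle i
        · rw [if_neg hn, hMM i, mul_inv_cancel]
          · exact areaLE_one 0
          · intro hm
            by_cases hc : cellTag s j i = (i₀, z, true)
            · exact h i (.inl ⟨hm, hc⟩)
            · exact hn (.inl ⟨hm, hc⟩)
          · intro hm
            by_cases hc : cellTag s j i = (i₀, z, false)
            · exact h i (.inr ⟨hm, hc⟩)
            · exact hn (.inr ⟨hm, hc⟩)
    · have : cnt Sp = 0 := by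
        rw [cnt, Finset.card_eq_zero]
        ext i
        simp [h i]
      omega

end Push

section Tags

open FreeGroup

variable {K α : Type*}

/-- Reading a letter forwards or backwards. -/
def orient (b : Bool) (x : α × Bool) : α × Bool := if b then x else letterInv x

lemma orient_not (b : Bool) (x : α × Bool) : orient (!b) x = letterInv (orient b x) := by
  cases b <;> simp [orient]

/-- The same place with the opposite orientation. -/
def tagFlip (t : K × ℕ × Bool) : K × ℕ × Bool := (t.1, t.2.1, !t.2.2)

@[simp] lemma tagFlip_tagFlip (t : K × ℕ × Bool) : tagFlip (tagFlip t) = t := by simp [tagFlip]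

/-- The letter read at an oriented place. -/
def tagLetter [Inhabited α] (wd : K → List (α × Bool)) (t : K × ℕ × Bool) : α × Bool :=
  orient t.2.2 ((wd t.1).getD t.2.1 default)

lemma tagLetter_tagFlip [Inhabited α] (wd : K → List (α × Bool)) (t : K × ℕ × Bool) :
    tagLetter wd (tagFlip t) = letterInv (tagLetter wd t) := orient_not _ _

/-- The place `u` follows `t`. -/
def TagSucc (t u : K × ℕ × Bool) : Prop :=
  u.1 = t.1 ∧ u.2.2 = t.2.2 ∧ if t.2.2 then u.2.1 = t.2.1 + 1 else t.2.1 = u.2.1 + 1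

/-- The place `t` is the first one of an oriented word. -/
def TagStart (wd : K → List (α × Bool)) (t : K × ℕ × Bool) : Prop :=
  if t.2.2 then t.2.1 = 0 else t.2.1 + 1 = (wd t.1).length

/-- The places of a word, read forwards or backwards. -/
def strandTags (N : ℕ) (k : K) : Bool → List (K × ℕ × Bool)
  | true => (List.range N).map fun z => (k, z, true)
  | false => ((List.range N).map fun z => (k, z, false)).reverse

lemma mem_strandTags {N : ℕ} {k : K} {b : Bool} {t : K × ℕ × Bool} :
    t ∈ strandTags N k b ↔ t.1 = k ∧ t.2.1 < N ∧ t.2.2 = b := by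
  obtain ⟨k', z, b'⟩ := t
  cases b <;> simp [strandTags] <;> grind

lemma length_strandTags (N : ℕ) (k : K) (b : Bool) : (strandTags N k b).length = N := by
  cases b <;> simp [strandTags]

lemma getElem_strandTags {N : ℕ} {k : K} {b : Bool} {i : ℕ} (h : i < (strandTags N k b).length) :
    (strandTags N k b)[i] = (k, if b then i else N - 1 - i, b) := by
  cases b <;> simp [strandTags]

lemma isChain_strandTags (N : ℕ) (k : K) (b : Bool) : (strandTags N k b).IsChain TagSucc := by
  rw [List.isChain_iff_getElem]
  intro i h
  rw [getElem_strandTags, getElem_strandTags]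
  rw [length_strandTags] at h
  cases b <;> simp [TagSucc]
  omega

lemma tagStart_getElem_strandTags {wd : K → List (α × Bool)} {k : K} {b : Bool} {i : ℕ}
    (h : i < (strandTags (wd k).length k b).length) :
    TagStart wd (strandTags (wd k).length k b)[i] ↔ i = 0 := by
  rw [getElem_strandTags]
  rw [length_strandTags] at h
  cases b <;> simp [TagStart]
  omega

/-- The places along a word in the letters `K`. -/
def wordTags (wd : K → List (α × Bool)) (w : List (K × Bool)) : List (K × ℕ × Bool) :=
  w.flatMap fun p => strandTags (wd p.1).length p.1 p.2

lemma lt_of_mem_wordTags {wd : K → List (α × Bool)} {w : List (K × Bool)} {t : K × ℕ × Bool}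
    (h : t ∈ wordTags wd w) : t.2.1 < (wd t.1).length := by
  obtain ⟨p, -, h⟩ := List.mem_flatMap.1 h
  rw [mem_strandTags] at h
  rw [h.1]
  exact h.2.1

lemma tagStart_head_wordTags {wd : K → List (α × Bool)} {w : List (K × Bool)}
    (h : 0 < (wordTags wd w).length) : TagStart wd (wordTags wd w)[0] := by
  induction w with
  | nil => simp [wordTags] at h
  | cons p w ih =>
    by_cases hp : (strandTags (wd p.1).length p.1 p.2) = []
    · have : wordTags wd (p :: w) = wordTags wd w := by simp [wordTags, hp]
      simp only [this] at h ⊢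
      exact ih h
    · have : wordTags wd (p :: w) = strandTags (wd p.1).length p.1 p.2 ++ wordTags wd w := by
        simp [wordTags]
      simp only [this] at h ⊢
      rw [List.getElem_append_left (List.length_pos_of_ne_nil hp), tagStart_getElem_strandTags]

lemma isChain_wordTags (wd : K → List (α × Bool)) (w : List (K × Bool)) :
    (wordTags wd w).IsChain fun t t' => TagStart wd t' ∨ TagSucc t t' := by
  induction w with
  | nil => simp [wordTags]
  | cons p w ih =>
    have : wordTags wd (p :: w) = strandTags (wd p.1).length p.1 p.2 ++ wordTags wd w := by
      simp [wordTags]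
    rw [this, List.isChain_append]
    refine ⟨(isChain_strandTags _ _ _).imp fun _ _ => Or.inr, ih, ?_⟩
    intro x _ y hy
    left
    rw [Option.mem_def, List.head?_eq_getElem?, List.getElem?_eq_some_iff] at hy
    obtain ⟨h1, rfl⟩ := hy
    exact tagStart_head_wordTags h1

open Classical in
lemma countP_tagStart_wordTags_le (wd : K → List (α × Bool)) (w : List (K × Bool)) :
    (wordTags wd w).countP (fun t => TagStart wd t) ≤ w.length := by
  induction w with
  | nil => simp [wordTags]
  | cons p w ih =>
    have : wordTags wd (p :: w) = strandTags (wd p.1).length p.1 p.2 ++ wordTags wd w := by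
      simp [wordTags]
    rw [this, List.countP_append, List.length_cons, add_comm]
    refine Nat.add_le_add ih ?_
    rcases hl : strandTags (wd p.1).length p.1 p.2 with _ | ⟨t, l⟩
    · simp
    · rw [List.countP_cons]
      have : l.countP (fun t => TagStart wd t) = 0 := by
        rw [List.countP_eq_zero]
        intro t' ht'
        obtain ⟨i, hi, rfl⟩ := List.getElem_of_mem ht'
        have h1 := tagStart_getElem_strandTags (wd := wd) (k := p.1) (b := p.2) (i := i + 1)
          (by rw [hl]; simpa using hi)
        simp only [hl, List.getElem_cons_succ] at h1
        simp [h1]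
      rw [this]
      split <;> simp

lemma prod_map_strandTags {G : Type*} [Group G] (N : ℕ) (k : K) (b : Bool) (ψ : K × ℕ × Bool → G)
    (hψ : ∀ t, ψ (tagFlip t) = (ψ t)⁻¹) :
    ((strandTags N k b).map ψ).prod = if b then ((strandTags N k true).map ψ).prod else
      (((strandTags N k true).map ψ).prod)⁻¹ := by
  cases b
  · simp only [strandTags, Bool.false_eq_true, if_false, List.prod_inv_reverse, List.map_reverse,
      List.map_map]
    congr 2
    refine List.map_congr_left fun z _ => ?_
    exact hψ (k, z, true)
  · simp

lemma prod_map_wordTags {G : Type*} [Group G] (wd : K → List (α × Bool)) (w : List (K × Bool))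
    (ψ : K × ℕ × Bool → G) (hψ : ∀ t, ψ (tagFlip t) = (ψ t)⁻¹) :
    ((wordTags wd w).map ψ).prod =
      FreeGroup.lift (fun k => ((strandTags (wd k).length k true).map ψ).prod) (mk w) := by
  rw [FreeGroup.lift_mk]
  induction w with
  | nil => simp [wordTags]
  | cons p w ih =>
    have : wordTags wd (p :: w) = strandTags (wd p.1).length p.1 p.2 ++ wordTags wd w := by
      simp [wordTags]
    rw [this, List.map_append, List.prod_append, ih, prod_map_strandTags _ _ _ _ hψ]
    rw [List.map_cons, List.prod_cons]
    cases p.2 <;> rfl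

lemma prod_map_tagLetter_strandTags [Inhabited α] (wd : K → List (α × Bool)) (k : K) :
    ((strandTags (wd k).length k true).map fun t => mk [tagLetter wd t]).prod = mk (wd k) := by
  rw [← prod_map_mk]
  congr 1
  apply List.ext_getElem
  · simp [strandTags]
  · intro i h1 h2
    simp only [List.length_map] at h2
    simp [strandTags, tagLetter, orient, h2]

end Tags

section PushDiagram

open FreeGroup

lemma cnt_sum {T T' : Type*} [Fintype T] [Fintype T'] (P : T ⊕ T' → Prop) :
    cnt P = cnt (fun t => P (.inl t)) + cnt (fun t => P (.inr t)) := by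
  classical
  simp only [cnt_eq_card, Finset.card_filter, Fintype.sum_sum_type]

lemma cnt_sigma {T : Type*} [Fintype T] {U : T → Type*} [∀ t, Fintype (U t)]
    (P : (Σ t, U t) → Prop) : cnt P = ∑ t, cnt (fun u => P ⟨t, u⟩) := by
  classical
  simp only [cnt_eq_card, Finset.card_filter, Fintype.sum_sigma]

lemma cnt_false {T : Type*} [Fintype T] {P : T → Prop} (h : ∀ t, ¬ P t) : cnt P = 0 := by
  classical
  rw [cnt_eq_card, Finset.card_eq_zero, Finset.filter_eq_empty_iff]
  exact fun t _ => h t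

lemma cnt_pos {T : Type*} [Fintype T] {P : T → Prop} {t : T} (h : P t) : 0 < cnt P := by
  classical
  rw [cnt_eq_card]
  exact Finset.card_pos.2 ⟨t, by simpa using h⟩

lemma cnt_or_le {T : Type*} [Fintype T] (P Q : T → Prop) :
    cnt (fun t => P t ∨ Q t) ≤ cnt P + cnt Q := by
  classical
  rw [cnt_eq_card, cnt_eq_card, cnt_eq_card, Finset.filter_or]
  exact Finset.card_union_le _ _

lemma cnt_le_of_injOn {T T' : Type*} [Fintype T] [Fintype T'] {P : T → Prop} {Q : T' → Prop}
    (f : T → T') (hf : ∀ t, P t → Q (f t)) (hi : ∀ t t', P t → P t' → f t = f t' → t = t') :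
    cnt P ≤ cnt Q := by
  classical
  rw [cnt_eq_card, cnt_eq_card]
  refine Finset.card_le_card_of_injOn f (fun t ht => ?_) fun t ht t' ht' h => ?_
  · simp only [Finset.coe_filter, Finset.mem_univ, true_and, Set.mem_ofPred_eq] at ht ⊢
    exact hf t ht
  · simp only [Finset.coe_filter, Finset.mem_univ, true_and, Set.mem_ofPred_eq] at ht ht'
    exact hi t t' ht ht' h

variable {ι α X : Type*}

/-- The value of a letter after replacing the letters in `M` by the value solved from `s`. -/
noncomputable def pushVal {T : Type*} (s : List (α × Bool)) (z : ℕ) (lt : T → α × Bool)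
    (fl : T → T) (M : T → Prop) (t : T) : FreeGroup α := by
  classical exact if M t then solveAt s z else if M (fl t) then (solveAt s z)⁻¹ else mk [lt t]

section pushVal

variable {T : Type*} {s : List (α × Bool)} {z : ℕ} {lt : T → α × Bool} {fl : T → T}
  {M : T → Prop} {x₀ : α × Bool}

lemma pushVal_of_mem {t : T} (h : M t) : pushVal s z lt fl M t = solveAt s z := by
  simp [pushVal, h]

lemma not_flip_mem (hlt : ∀ t, lt (fl t) = letterInv (lt t)) (hM : ∀ t, M t → lt t = x₀) {t : T}
    (h : M t) : ¬ M (fl t) := fun h' => letterInv_ne x₀ (by rw [← hM t h, ← hlt, hM _ h', hM t h])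

lemma pushVal_of_flip_mem (hlt : ∀ t, lt (fl t) = letterInv (lt t)) (hM : ∀ t, M t → lt t = x₀)
    {t : T} (h : M (fl t)) : pushVal s z lt fl M t = (solveAt s z)⁻¹ := by
  have : ¬ M t := fun h' => not_flip_mem hlt hM h' h
  simp [pushVal, h, this]

lemma pushVal_of_not {t : T} (h : ¬ M t) (h' : ¬ M (fl t)) :
    pushVal s z lt fl M t = mk [lt t] := by
  simp [pushVal, h, h']

lemma pushVal_flip (hlt : ∀ t, lt (fl t) = letterInv (lt t)) (hM : ∀ t, M t → lt t = x₀)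
    (hfl : ∀ t, fl (fl t) = t) (t : T) :
    pushVal s z lt fl M (fl t) = (pushVal s z lt fl M t)⁻¹ := by
  by_cases h : M t
  · rw [pushVal_of_mem h, pushVal_of_flip_mem hlt hM (by rwa [hfl])]
  by_cases h' : M (fl t)
  · rw [pushVal_of_mem h', pushVal_of_flip_mem hlt hM h', inv_inv]
  · rw [pushVal_of_not h h', pushVal_of_not h' (by rwa [hfl]), hlt, mk_letterInv]

lemma areaLE_pushVal {ι : Type*} {s : ι → List (α × Bool)} {i : ι} (hz : (s i)[z]? = some x₀)
    (hlt : ∀ t, lt (fl t) = letterInv (lt t)) (hM : ∀ t, M t → lt t = x₀) (t : T) :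
    AreaLE (relSet s) 1 (pushVal (s i) z lt fl M t * (mk [lt t])⁻¹) := by
  by_cases h : M t
  · rw [pushVal_of_mem h, hM t h]
    exact areaLE_solveAt hz
  by_cases h' : M (fl t)
  · have h3 := hM _ h'
    rw [hlt] at h3
    rw [pushVal_of_flip_mem hlt hM h', ← letterInv_letterInv (lt t), h3, mk_letterInv, inv_inv]
    have := ((areaLE_solveAt hz).inv (inv_mem_relSet s)).conj (mk [x₀])⁻¹
    convert this using 1
    group
  · rw [pushVal_of_not h h', mul_inv_cancel]
    exact areaLE_one 1

end pushVal

variable [Inhabited α]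

/-- The place of a side of a diagram whose boundary is read along the places `tags`. -/
def sideTag (s : ι → List (α × Bool)) {k p : ℕ} {q : Fin k → ℕ} (ty : Fin k → ι × Bool)
    (tags : List (X × ℕ × Bool)) (hp : p = tags.length) :
    SideType p q → (ι ⊕ X) × ℕ × Bool
  | .inl i => let t := tags[(i : ℕ)]; (.inr t.1, t.2)
  | .inr ⟨c, i⟩ => let t := cellTag s (ty c) i; (.inl t.1, t.2)

lemma SideDia.lab_eq_tagLetter {G : Type*} [Group G] {s : ι → List (α × Bool)}
    {wd : X → List (α × Bool)} {k : ℕ} {tags : List (X × ℕ × Bool)}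
    (D : SideDia G (relWord s) (tags.map (tagLetter wd)) k)
    (hp : D.p = tags.length) (y : SideType D.p D.q) :
    D.lab y = tagLetter (Sum.elim s wd) (sideTag s D.ty tags hp y) := by
  rcases y with i | ⟨c, i⟩
  · have h := D.lab_bd i
    rw [List.getElem?_map, List.getElem?_eq_getElem (by rw [← hp]; exact i.2), Option.map_some,
      Option.some_inj] at h
    exact h.symm
  · have h := D.lab_cell c i
    have hi : (i : ℕ) < (s (D.ty c).1).length := by
      rw [← length_relWord, ← D.q_eq]; exact i.2
    obtain ⟨h1, h2⟩ := List.getElem?_eq_some_iff.1 h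
    rw [← h2]
    simp only [sideTag, tagLetter, cellTag, Sum.elim_inl, relWord, orient]
    split_ifs with hb
    · simp [hi]
    · simp only [invRev, List.getElem_reverse, List.getElem_map, List.length_map]
      rw [List.getD_eq_getElem _ _ (by omega)]
      rfl

lemma sideTag_lt {G : Type*} [Group G] {s : ι → List (α × Bool)}
    {wd : X → List (α × Bool)} {k : ℕ} {tags : List (X × ℕ × Bool)}
    (D : SideDia G (relWord s) (tags.map (tagLetter wd)) k)
    (hp : D.p = tags.length) (ht : ∀ t ∈ tags, t.2.1 < (wd t.1).length) (y : SideType D.p D.q) :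
    (sideTag s D.ty tags hp y).2.1 <
      (Sum.elim s wd (sideTag s D.ty tags hp y).1).length := by
  rcases y with i | ⟨c, i⟩
  · exact ht _ (List.getElem_mem _)
  · have hi : (i : ℕ) < (s (D.ty c).1).length := by
      rw [← length_relWord, ← D.q_eq]; exact i.2
    simp only [sideTag, cellTag, Sum.elim_inl]
    split <;> omega

/-- Pushing the letters in `M` and `M'` of a diagram and of its boundary across a relator. -/
lemma SideDia.push {s : ι → List (α × Bool)}
    {wd : X → List (α × Bool)} {k : ℕ} {tags : List (X × ℕ × Bool)}
    (D : SideDia (FreeGroup α) (relWord s) (tags.map (tagLetter wd)) k)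
    (hp : D.p = tags.length) {i₀ : ι} {z : ℕ} {x₀ : α × Bool} (hz : (s i₀)[z]? = some x₀)
    (M : SideType D.p D.q → Prop) (M' : X × ℕ × Bool → Prop)
    (hM : ∀ y, M y → D.lab y = x₀) (hM' : ∀ t, M' t → tagLetter wd t = x₀) :
    ∃ a, AreaLE (relSet s) a
        (tags.map (pushVal (s i₀) z (tagLetter wd) tagFlip M')).prod ∧
      a + cnt (fun y => (M y ∧ sideTag s D.ty tags hp y = (.inl i₀, z, true)) ∨
          (M (D.al y) ∧ sideTag s D.ty tags hp y = (.inl i₀, z, false))) ≤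
        k + cnt (fun y => (sideTag s D.ty tags hp y).1.isLeft ∧
          ((M y ∧ sideTag s D.ty tags hp y ≠ (.inl i₀, z, true)) ∨
          (M (D.al y) ∧ sideTag s D.ty tags hp y ≠ (.inl i₀, z, false)))) +
        cnt (fun y => ∃ t : X × ℕ × Bool, sideTag s D.ty tags hp y = (.inr t.1, t.2) ∧
          (¬ (M y ↔ M' t) ∨ ¬ (M (D.al y) ↔ M' (tagFlip t)))) := by
  classical
  set φ := pushVal (s i₀) z D.lab D.al M with hφ
  have hcells := fun c => areaLE_cell hz (D.q_eq c) (fun i => φ (.inr ⟨c, i⟩))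
    (fun i => D.lab (.inr ⟨c, i⟩)) (fun i => M (.inr ⟨c, i⟩)) (fun i => M (D.al (.inr ⟨c, i⟩)))
    (D.lab_cell c) (fun i h => ⟨hM _ h, pushVal_of_mem h⟩)
    (fun i h => ⟨by rw [← hM _ h, D.lab_al, letterInv_letterInv],
      pushVal_of_flip_mem D.lab_al hM h⟩) (fun i h h' => pushVal_of_not h h')
  choose a ha ha' using hcells
  have h1 := (D.conj φ (pushVal_flip D.lab_al hM D.al_al)).areaLE (inv_mem_relSet s) ha
  set ψ := pushVal (s i₀) z (tagLetter wd) tagFlip M' with hψ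
  have hlen : ∀ i : Fin D.p, (i : ℕ) < tags.length := fun i => by rw [← hp]; exact i.2
  have hlab : ∀ i : Fin D.p, D.lab (.inl i) = tagLetter wd tags[(i : ℕ)] := fun i =>
    D.lab_eq_tagLetter hp (.inl i)
  have h2 := areaLE_ofFn_div (R := relSet s) (fun i : Fin D.p => ψ tags[(i : ℕ)])
    (fun i => φ (.inl i)) (fun i => if ¬ (M (.inl i) ↔ M' tags[(i : ℕ)]) ∨
      ¬ (M (D.al (.inl i)) ↔ M' (tagFlip tags[(i : ℕ)])) then 1 else 0) ?_
  · have h3 : List.ofFn (fun i : Fin D.p => ψ tags[(i : ℕ)]) = tags.map ψ := by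
      apply List.ext_getElem <;> simp [hp]
    rw [h3] at h2
    have h4 := h2.mul h1
    rw [inv_mul_cancel_right, Finset.sum_boole, Nat.cast_id, ← cnt_eq_card] at h4
    refine ⟨_, h4, ?_⟩
    rw [cnt_sum, cnt_sum, cnt_sum, cnt_sigma, cnt_sigma, cnt_sigma]
    have e1 : ∀ (c : Fin k) (i : ℕ) (b : Bool), ((Sum.inl (cellTag s (D.ty c) i).1 : ι ⊕ X),
        (cellTag s (D.ty c) i).2) = (.inl i₀, z, b) ↔ cellTag s (D.ty c) i = (i₀, z, b) := by
      intro c i b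
      simp [Prod.ext_iff]
    have e2 : cnt (fun i : Fin D.p => (M (.inl i) ∧ sideTag s (q := D.q) D.ty tags hp (.inl i) =
        (.inl i₀, z, true)) ∨ (M (D.al (.inl i)) ∧ sideTag s (q := D.q) D.ty tags hp (.inl i) =
        (.inl i₀, z, false))) = 0 := cnt_false fun i => by simp [sideTag]
    rw [e2]
    have e3 : cnt (fun i : Fin D.p => ¬ (M (.inl i) ↔ M' tags[(i : ℕ)]) ∨
      ¬ (M (D.al (.inl i)) ↔ M' (tagFlip tags[(i : ℕ)]))) ≤
      cnt (fun i : Fin D.p => ∃ t : X × ℕ × Bool,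
        sideTag s (q := D.q) D.ty tags hp (.inl i) = (.inr t.1, t.2) ∧
          (¬ (M (.inl i) ↔ M' t) ∨ ¬ (M (D.al (.inl i)) ↔ M' (tagFlip t)))) :=
      cnt_mono fun i h => ⟨tags[(i : ℕ)], rfl, h⟩
    have e4 := Finset.sum_le_sum fun c (_ : c ∈ Finset.univ) => ha' c
    rw [Finset.sum_add_distrib, Finset.sum_add_distrib] at e4
    simp only [Finset.sum_const, Finset.card_univ, Fintype.card_fin, smul_eq_mul, mul_one] at e4
    have e5 : ∀ (c : Fin k) (i : Fin (D.q c)) (b : Bool),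
        sideTag s D.ty tags hp (.inr ⟨c, i⟩) = (.inl i₀, z, b) ↔
          cellTag s (D.ty c) i = (i₀, z, b) := fun c i b => e1 c i b
    have e6 : ∀ (c : Fin k) (i : Fin (D.q c)),
        (sideTag s D.ty tags hp (.inr ⟨c, i⟩)).1.isLeft = true := fun c i => rfl
    simp only [ne_eq, e5, e6, true_and]
    simp only [ne_eq] at e4
    omega
  · intro i
    split_ifs with h
    · by_cases hm : M (.inl i) ∨ M (D.al (.inl i))
      · by_cases hm' : M' tags[(i : ℕ)] ∨ M' (tagFlip tags[(i : ℕ)])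
        · exfalso
          have a1 := hM (.inl i)
          have a2 := hM (D.al (.inl i))
          have a3 := hM' tags[(i : ℕ)]
          have a4 := hM' (tagFlip tags[(i : ℕ)])
          rw [D.lab_al] at a2
          rw [tagLetter_tagFlip] at a4
          rw [hlab] at a1 a2
          have b1 : M (.inl i) → ¬ M (D.al (.inl i)) := not_flip_mem D.lab_al hM
          have b2 : M' tags[(i : ℕ)] → ¬ M' (tagFlip tags[(i : ℕ)]) :=
            not_flip_mem (tagLetter_tagFlip wd) hM'
          have b3 : tagLetter wd tags[(i : ℕ)] = x₀ → letterInv (tagLetter wd tags[(i : ℕ)]) ≠ x₀ :=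
            fun h h' => letterInv_ne x₀ (by rw [h] at h'; exact h')
          tauto
        · push Not at hm'
          rw [hψ, pushVal_of_not hm'.1 hm'.2, ← hlab]
          have := (areaLE_pushVal hz D.lab_al hM (.inl i)).inv (inv_mem_relSet s)
          rwa [mul_inv_rev, inv_inv] at this
      · push Not at hm
        rw [hφ, pushVal_of_not hm.1 hm.2, hlab]
        exact areaLE_pushVal hz (tagLetter_tagFlip wd) hM' _
    · push Not at h
      have : ψ tags[(i : ℕ)] = φ (.inl i) := by
        simp only [hφ, hψ, pushVal]
        rw [h.1, h.2, hlab]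
      rw [this, mul_inv_cancel]
      exact areaLE_one 0

end PushDiagram

section Configuration

open FreeGroup

variable {ι α X : Type} [Inhabited α]

/-- The diagrams of a minimal solution: `s` are the relators, `wd` the reduced words of the
values of the letters, `con` the letters whose values may not be changed, `L` the total length of
the equations, and `F` the number of cells. -/
structure Cfg (s : ι → List (α × Bool)) (wd : X → List (α × Bool)) (con : Set X) (L F : ℕ) where
  /-- the sides -/
  S : Type
  /-- there are finitely many sides -/
  fin : Fintype S
  /-- the opposite side -/
  al : S → S
  /-- the next side -/
  nx : Equiv.Perm S
  /-- the place of a side -/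
  tp : S → (ι ⊕ X) × ℕ × Bool
  al_al : ∀ y, al (al y) = y
  lab_al : ∀ y, tagLetter (Sum.elim s wd) (tp (al y)) =
    letterInv (tagLetter (Sum.elim s wd) (tp y))
  tp_lt : ∀ y, (tp y).2.1 < (Sum.elim s wd (tp y).1).length
  next_cell : ∀ y i z b, tp y = (.inl i, z, b) → tp (nx y) =
    (.inl i, if b then (z + 1) % (s i).length else (z + (s i).length - 1) % (s i).length, b)
  next_bd : ∀ y, (tp y).1.isRight → (tp (nx y)).1.isRight
  next : ∀ y, TagStart (Sum.elim s wd) (tp (nx y)) ∨ TagSucc (tp y) (tp (nx y))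
  card_start_cell : cnt (fun y => (tp y).1.isLeft ∧ TagStart (Sum.elim s wd) (tp y)) ≤ F
  card_start_bd : cnt (fun y => (tp y).1.isRight ∧ TagStart (Sum.elim s wd) (tp y)) ≤ L
  card_cell : ∀ M : ℕ, (∀ i, M ≤ (s i).length) → M * F ≤ cnt fun y => (tp y).1.isLeft
  nonsmooth : cnt (fun y => nx (al y) ≠ al (nx.symm y)) ≤
    6 * F + 4 * cnt (fun y => al (nx.symm y) = y)
  push : ∀ (i : ι) (z : ℕ) (x₀ : α × Bool) (M : S → Prop) (M' : X × ℕ × Bool → Prop),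
    (s i)[z]? = some x₀ → (∀ y, M y → tagLetter (Sum.elim s wd) (tp y) = x₀) →
    (∀ t, M' t → tagLetter wd t = x₀ ∧ t.1 ∉ con) →
    cnt (fun y => (M y ∧ tp y = (.inl i, z, true)) ∨ (M (al y) ∧ tp y = (.inl i, z, false))) ≤
      cnt (fun y => (tp y).1.isLeft ∧ ((M y ∧ tp y ≠ (.inl i, z, true)) ∨
        (M (al y) ∧ tp y ≠ (.inl i, z, false)))) +
      cnt (fun y => ∃ t : X × ℕ × Bool, tp y = (.inr t.1, t.2) ∧
        (¬ (M y ↔ M' t) ∨ ¬ (M (al y) ↔ M' (tagFlip t))))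

attribute [instance] Cfg.fin

lemma sideNext_inl {k p : ℕ} {q : Fin k → ℕ} (i : Fin p) :
    sideNext p q (.inl i) = .inl (finRotate p i) := rfl

lemma sideNext_inr {k p : ℕ} {q : Fin k → ℕ} (c : Fin k) (i : Fin (q c)) :
    sideNext p q (.inr ⟨c, i⟩) = .inr ⟨c, finRotate (q c) i⟩ := rfl

open Classical in
lemma cnt_getElem {T : Type*} (l : List T) (P : T → Prop) :
    cnt (fun i : Fin l.length => P l[i]) = l.countP (fun t => P t) := by
  induction l with
  | nil => exact cnt_false fun i => i.elim0
  | cons x l ih =>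
    rw [List.countP_cons, ← ih, cnt_eq_card, cnt_eq_card, Finset.card_filter, Finset.card_filter]
    simp only [List.length_cons]
    rw [Fin.sum_univ_succ, add_comm]
    simp only [Fin.getElem_fin, Fin.val_zero, List.getElem_cons_zero, Fin.val_succ,
      List.getElem_cons_succ, decide_eq_true_eq]
    congr

section Single

variable {s : ι → List (α × Bool)} {wd : X → List (α × Bool)} {k : ℕ} {w : List (X × Bool)}
  (D : SideDia (FreeGroup α) (relWord s) ((wordTags wd w).map (tagLetter wd)) k)
  (hp : D.p = (wordTags wd w).length)

include hp in
lemma sideTag_next_cell (y : SideType D.p D.q) (i : ι) (z : ℕ) (b : Bool)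
    (hy : sideTag s D.ty _ hp y = (.inl i, z, b)) :
    sideTag s D.ty _ hp (sideNext _ _ y) =
      (.inl i, if b then (z + 1) % (s i).length else (z + (s i).length - 1) % (s i).length, b) := by
  rcases y with j | ⟨c, j⟩
  · simp [sideTag] at hy
  · rw [sideNext_inr]
    have hj := j.2
    have hlen : D.q c = (s (D.ty c).1).length := by rw [D.q_eq, length_relWord]
    simp only [sideTag, cellTag, val_finRotate, Prod.mk.injEq, Sum.inl.injEq] at hy ⊢
    obtain ⟨rfl, rfl, rfl⟩ := hy
    refine ⟨rfl, ?_, rfl⟩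
    rw [← hlen]
    by_cases h : (j : ℕ) + 1 = D.q c
    · rw [if_pos h]
      split_ifs with hb
      · rw [h, Nat.mod_self]
      · rw [show D.q c - 1 - j + D.q c - 1 = D.q c - 1 by omega, Nat.mod_eq_of_lt (by omega)]
        omega
    · rw [if_neg h]
      split_ifs with hb
      · rw [Nat.mod_eq_of_lt (by omega)]
      · rw [show D.q c - 1 - j + D.q c - 1 = (D.q c - 1 - (j + 1)) + D.q c by omega,
          Nat.add_mod_right, Nat.mod_eq_of_lt (by omega)]

include hp in
lemma sideTag_next (y : SideType D.p D.q) :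
    TagStart (Sum.elim s wd) (sideTag s D.ty _ hp (sideNext _ _ y)) ∨
      TagSucc (sideTag s D.ty _ hp y) (sideTag s D.ty _ hp (sideNext _ _ y)) := by
  rcases y with j | ⟨c, j⟩
  · rw [sideNext_inl]
    have hj := j.2
    have hr := val_finRotate j
    by_cases h : (j : ℕ) + 1 = D.p
    · left
      rw [if_pos h] at hr
      have := tagStart_head_wordTags (wd := wd) (w := w) (by omega)
      simpa only [sideTag, TagStart, hr, Sum.elim_inr] using this
    · rw [if_neg h] at hr
      have := List.isChain_iff_getElem.1 (isChain_wordTags wd w) j (by omega)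
      simpa only [sideTag, TagStart, TagSucc, hr, Sum.elim_inr, Sum.inr.injEq] using this
  · rw [sideNext_inr]
    have hj := j.2
    have hr := val_finRotate j
    have hlen : D.q c = (s (D.ty c).1).length := by rw [D.q_eq, length_relWord]
    simp only [sideTag, TagStart, TagSucc, cellTag, hr, Sum.elim_inl, ← hlen]
    by_cases h : (j : ℕ) + 1 = D.q c
    · left
      split_ifs <;> omega
    · right
      rw [if_neg h]
      refine ⟨trivial, trivial, ?_⟩
      split_ifs <;> omega

include hp in
lemma card_start_bd_le : cnt (fun y : SideType D.p D.q => (sideTag s D.ty _ hp y).1.isRight ∧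
    TagStart (Sum.elim s wd) (sideTag s D.ty _ hp y)) ≤ w.length := by
  classical
  rw [cnt_sum]
  have h1 : cnt (fun t : (Σ c, Fin (D.q c)) => (sideTag s D.ty _ hp (.inr t)).1.isRight ∧
    TagStart (Sum.elim s wd) (sideTag s D.ty _ hp (.inr t))) = 0 :=
    cnt_false fun t h => by simp [sideTag] at h
  rw [h1, add_zero]
  refine le_trans ?_ (countP_tagStart_wordTags_le wd w)
  have h2 : cnt (fun t : Fin D.p => (sideTag s (q := D.q) D.ty _ hp (.inl t)).1.isRight ∧
    TagStart (Sum.elim s wd) (sideTag s (q := D.q) D.ty _ hp (.inl t))) =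
    cnt fun t : Fin (wordTags wd w).length => TagStart wd (wordTags wd w)[t] := by
    refine le_antisymm (cnt_le_of_injOn (Fin.cast hp) ?_ ?_)
      (cnt_le_of_injOn (Fin.cast hp.symm) ?_ ?_)
    · intro t h
      exact h.2
    · intro t t' _ _ h
      simpa using h
    · intro t h
      exact ⟨rfl, h⟩
    · intro t t' _ _ h
      simpa using h
  rw [h2, cnt_getElem]

include hp in
lemma card_start_cell_le : cnt (fun y : SideType D.p D.q => (sideTag s D.ty _ hp y).1.isLeft ∧
    TagStart (Sum.elim s wd) (sideTag s D.ty _ hp y)) ≤ k := by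
  have h1 : cnt (fun _ : Fin k => True) = k := by
    classical
    rw [cnt_eq_card]
    simp
  rw [cnt_sum, cnt_false (P := fun t => (sideTag s (q := D.q) D.ty _ hp (.inl t)).1.isLeft ∧ _),
    zero_add]
  · refine (cnt_le_of_injOn (fun t => t.1) (fun _ _ => trivial) ?_).trans h1.le
    rintro ⟨c, i⟩ ⟨c', i'⟩ ⟨-, h⟩ ⟨-, h'⟩ (rfl : c = c')
    have hlen : D.q c = (s (D.ty c).1).length := by rw [D.q_eq, length_relWord]
    have hi := i.2
    have hi' := i'.2
    simp only [sideTag, TagStart, cellTag, Sum.elim_inl, ← hlen] at h h'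
    congr
    split_ifs at h h' <;> omega
  · intro t h
    simp [sideTag] at h

include hp in
lemma mul_le_card_cell (M : ℕ) (hM : ∀ i, M ≤ (s i).length) :
    M * k ≤ cnt fun y : SideType D.p D.q => (sideTag s D.ty _ hp y).1.isLeft := by
  classical
  rw [cnt_sum, cnt_sigma]
  have : ∀ c, M ≤ cnt fun u : Fin (D.q c) =>
      (sideTag s D.ty (wordTags wd w) hp (.inr ⟨c, u⟩)).1.isLeft := by
    intro c
    have hlen : D.q c = (s (D.ty c).1).length := by rw [D.q_eq, length_relWord]
    rw [cnt_eq_card]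
    simp only [sideTag, Sum.isLeft_inl, Finset.filter_true, Finset.card_univ, Fintype.card_fin]
    exact (hM _).trans hlen.ge
  refine le_trans ?_ (Nat.le_add_left _ _)
  refine le_trans ?_ (Finset.sum_le_sum fun c _ => this c)
  simp [mul_comm]

end Single

omit [Inhabited α] in
lemma SideDia.card_nonsmooth_le {J : Type*} {G : Type*} [Group G] {rw : J → List (α × Bool)}
    {W : List (α × Bool)} {k : ℕ} (D : SideDia G rw W k) :
    cnt (fun y => sideNext D.p D.q (D.al y) ≠ D.al ((sideNext D.p D.q).symm y)) ≤
      6 * k + 4 * cnt (fun y => D.al ((sideNext D.p D.q).symm y) = y) := by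
  classical
  rw [cnt_eq_card, cnt_eq_card]
  exact _root_.card_nonsmooth_le D.al _ D.st k D.al_al D.st_next D.euler

variable [DecidableEq X] [DecidableEq α]

/-- A solution modulo the relators can be changed, without changing the elements it represents
and the values of the constants, to one which is minimal. -/
theorem exists_cfg (s : ι → List (α × Bool)) (V : Finset (FreeGroup X)) (con : Set X)
    (u₀ : X → FreeGroup α)
    (hu₀ : ∀ w ∈ V, FreeGroup.lift u₀ w ∈ Subgroup.normalClosure (relSet s)) :
    ∃ u : X → FreeGroup α, (∀ x ∈ con, u x = u₀ x) ∧
      (∀ x, u x * (u₀ x)⁻¹ ∈ Subgroup.normalClosure (relSet s)) ∧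
      ∃ F, (F = 0 → ∀ w ∈ V, FreeGroup.lift u w = 1) ∧
        Nonempty (Cfg s (fun x => (u x).toWord) con (∑ w ∈ V, w.toWord.length) F) := by
  classical
  set N := Subgroup.normalClosure (relSet s) with hN
  let P : ℕ → Prop := fun T => ∃ u : X → FreeGroup α, (∀ x ∈ con, u x = u₀ x) ∧
    (∀ x, u x * (u₀ x)⁻¹ ∈ N) ∧ ∃ f : V → ℕ, (∀ w, AreaLE (relSet s) (f w)
      (FreeGroup.lift u w.1)) ∧ ∑ w, f w = T
  have hP : ∃ T, P T := by
    choose f hf using fun w : V =>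
      exists_areaLE_of_mem_normalClosure (inv_mem_relSet s) (hu₀ w.1 w.2)
    exact ⟨_, u₀, fun _ _ => rfl, fun x => by simp [one_mem], f, hf, rfl⟩
  obtain ⟨u, hu1, hu2, f, hf, hfT⟩ := Nat.find_spec hP
  have hmin : ∀ T, P T → Nat.find hP ≤ T := fun T h => Nat.find_min' hP h
  set wd : X → List (α × Bool) := fun x => (u x).toWord with hwd
  have hlift : ∀ w : FreeGroup X,
      FreeGroup.lift u w = mk ((wordTags wd w.toWord).map (tagLetter wd)) := by
    intro w
    rw [← prod_map_mk, List.map_map]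
    refine Eq.trans ?_ (prod_map_wordTags wd w.toWord (fun t => mk [tagLetter wd t]) ?_).symm
    · congr 1
      · congr 1
        ext x
        rw [prod_map_tagLetter_strandTags, hwd, mk_toWord]
      · rw [mk_toWord]
    · intro t
      simp only [tagLetter_tagFlip, mk_letterInv]
  have hdia : ∀ w : V, ∃ k, k ≤ f w ∧ AreaLE (relSet s) k (FreeGroup.lift u w.1) ∧
      Nonempty (SideDia (FreeGroup α) (relWord s)
        ((wordTags wd w.1.toWord).map (tagLetter wd)) k) := by
    intro w
    obtain ⟨Ls, h1, h2, h3⟩ := hf w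
    have : ∃ js : List (ι × Bool), js.map (fun j => mk (relWord s j)) = Ls := by
      have : Ls ∈ Set.range (List.map fun j => mk (relWord s j)) := by
        rw [Set.range_list_map]
        exact h1
      exact this
    obtain ⟨js, rfl⟩ := this
    refine ⟨js.length, by simpa using h2, ⟨_, h1, by simp, h3⟩, ?_⟩
    rw [hlift] at h3
    exact (hasDia_of_conjProd h3).nonempty_sideDia
  choose k hkf hk D using hdia
  replace D := fun w => Classical.choice (D w)
  have hp : ∀ w, (D w).p = (wordTags wd w.1.toWord).length := fun w => by
    rw [(D w).p_eq, List.length_map]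
  refine ⟨u, hu1, hu2, ∑ w, k w, ?_, ⟨?_⟩⟩
  · intro h w hw
    rw [Finset.sum_eq_zero_iff] at h
    have := hk ⟨w, hw⟩
    rwa [h ⟨w, hw⟩ (Finset.mem_univ _), areaLE_zero] at this
  let tpf : ∀ w : V, SideType (D w).p (D w).q → (ι ⊕ X) × ℕ × Bool :=
    fun w => sideTag s (D w).ty _ (hp w)
  have hVL : ∑ w ∈ V, w.toWord.length = ∑ w : V, w.1.toWord.length :=
    (Finset.sum_coe_sort V fun w => w.toWord.length).symm
  refine {
    S := Σ w : V, SideType (D w).p (D w).q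
    fin := inferInstance
    al := fun y => ⟨y.1, (D y.1).al y.2⟩
    nx := Equiv.sigmaCongrRight fun w => sideNext (D w).p (D w).q
    tp := fun y => tpf y.1 y.2
    al_al := fun y => by simp [(D y.1).al_al]
    lab_al := fun y => ?_
    tp_lt := fun y => ?_
    next_cell := fun y i z b h => sideTag_next_cell (D y.1) (hp y.1) y.2 i z b h
    next_bd := fun y h => ?_
    next := fun y => sideTag_next (D y.1) (hp y.1) y.2
    card_start_cell := ?_
    card_start_bd := ?_
    card_cell := fun M hM => ?_
    nonsmooth := ?_
    push := fun i z x₀ M M' hz hM hM' => ?_ }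
  · have := (D y.1).lab_al y.2
    rwa [(D y.1).lab_eq_tagLetter (hp y.1), (D y.1).lab_eq_tagLetter (hp y.1)] at this
  · exact sideTag_lt (D y.1) (hp y.1) (fun t ht => lt_of_mem_wordTags ht) y.2
  · obtain ⟨w, i | ⟨c, i⟩⟩ := y
    · rfl
    · simp [tpf, sideTag] at h
  · rw [cnt_sigma]
    exact Finset.sum_le_sum fun w _ => card_start_cell_le (D w) (hp w)
  · rw [cnt_sigma, hVL]
    exact Finset.sum_le_sum fun w _ => card_start_bd_le (D w) (hp w)
  · rw [cnt_sigma, Finset.mul_sum]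
    exact Finset.sum_le_sum fun w _ => mul_le_card_cell (D w) (hp w) M hM
  · rw [cnt_sigma, cnt_sigma, Finset.mul_sum, Finset.mul_sum, ← Finset.sum_add_distrib]
    refine Finset.sum_le_sum fun w _ => ?_
    have h1 := (D w).card_nonsmooth_le
    refine le_trans (cnt_mono fun y h => ?_) (h1.trans (Nat.add_le_add_left (Nat.mul_le_mul_left _
      (cnt_mono fun y h => ?_)) _))
    · intro h'
      exact h (congrArg (Sigma.mk w) h')
    · exact congrArg (Sigma.mk w) h
  · have hpush := fun w => (D w).push (hp w) hz (fun y => M ⟨w, y⟩) M'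
      (fun y h => by rw [(D w).lab_eq_tagLetter (hp w)]; exact hM _ h) (fun t h => (hM' t h).1)
    choose a ha ha' using hpush
    have hM1 : ∀ t, M' t → tagLetter wd t = x₀ := fun t h => (hM' t h).1
    set ψ := pushVal (s i) z (tagLetter wd) tagFlip M' with hψ
    have hT : P (∑ w, a w) := by
      refine ⟨fun x => ((strandTags (wd x).length x true).map ψ).prod, ?_, ?_, a, ?_, rfl⟩
      · intro x hx
        rw [← hu1 x hx]
        have h1 : ((strandTags (wd x).length x true).map ψ) =
            (strandTags (wd x).length x true).map fun t => mk [tagLetter wd t] := by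
          refine List.map_congr_left fun t ht => ?_
          have h2 := (mem_strandTags.1 ht).1
          exact pushVal_of_not (fun h => (hM' _ h).2 (by rwa [h2]))
            (fun h => (hM' _ h).2 (by rwa [← h2] at hx))
        simp only [h1]
        rw [prod_map_tagLetter_strandTags, hwd, mk_toWord]
      · intro x
        have h1 := (areaLE_prod_div (strandTags (wd x).length x true) ψ
          (fun t => mk [tagLetter wd t]) (fun _ => 1) fun t _ =>
            areaLE_pushVal hz (tagLetter_tagFlip wd) hM1 t).mem_normalClosure
        rw [prod_map_tagLetter_strandTags, hwd, mk_toWord] at h1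
        have h3 := mul_mem h1 (hu2 x)
        rwa [mul_assoc, inv_mul_cancel_left] at h3
      · intro w
        have h1 := ha w
        rw [prod_map_wordTags _ _ _ (pushVal_flip (tagLetter_tagFlip wd) hM1 tagFlip_tagFlip),
          mk_toWord] at h1
        exact h1
    have h1 : ∑ w, k w ≤ ∑ w, a w :=
      (Finset.sum_le_sum fun w _ => hkf w).trans (hfT.le.trans (hmin _ hT))
    have h2 := Finset.sum_le_sum fun w (_ : w ∈ Finset.univ) => ha' w
    rw [Finset.sum_add_distrib, Finset.sum_add_distrib, Finset.sum_add_distrib] at h2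
    have h3 : ∀ A B C : ℕ, ∑ w, a w + A ≤ ∑ w, k w + B + C → A ≤ B + C := by omega
    rw [cnt_sigma, cnt_sigma, cnt_sigma]
    exact h3 _ _ _ h2

end Configuration

section RelPos

variable {ι α X : Type}

/-- The oriented places of the relators. -/
abbrev RelPos (s : ι → List (α × Bool)) : Type := (Σ i, Fin (s i).length) × Bool

/-- The next oriented place of a relator, cyclically. -/
def relShift (s : ι → List (α × Bool)) : Equiv.Perm (RelPos s) where
  toFun p := (⟨p.1.1, if p.2 then finRotate _ p.1.2 else (finRotate _).symm p.1.2⟩, p.2)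
  invFun p := (⟨p.1.1, if p.2 then (finRotate _).symm p.1.2 else finRotate _ p.1.2⟩, p.2)
  left_inv := by
    rintro ⟨⟨i, z⟩, b⟩
    cases b <;> simp only [if_true, if_false, Bool.false_eq_true, Equiv.symm_apply_apply,
      Equiv.apply_symm_apply]
  right_inv := by
    rintro ⟨⟨i, z⟩, b⟩
    cases b <;> simp only [if_true, if_false, Bool.false_eq_true, Equiv.symm_apply_apply,
      Equiv.apply_symm_apply]

/-- The same place of a relator with the opposite orientation. -/
def relFlip {s : ι → List (α × Bool)} (p : RelPos s) : RelPos s := (p.1, !p.2)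

lemma relFlip_relFlip {s : ι → List (α × Bool)} (p : RelPos s) : relFlip (relFlip p) = p := by
  simp [relFlip]

lemma relFlip_relShift {s : ι → List (α × Bool)} (p : RelPos s) :
    relFlip (relShift s p) = (relShift s).symm (relFlip p) := by
  obtain ⟨⟨i, z⟩, b⟩ := p
  cases b <;> rfl

/-- The place of a relator as a place of a letter. -/
def relTag (X : Type) {s : ι → List (α × Bool)} (p : RelPos s) : (ι ⊕ X) × ℕ × Bool :=
  (.inl p.1.1, p.1.2, p.2)

lemma relTag_inj {s : ι → List (α × Bool)} {p p' : RelPos s} (h : relTag X p = relTag X p') :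
    p = p' := by
  obtain ⟨⟨i, z⟩, b⟩ := p
  obtain ⟨⟨i', z'⟩, b'⟩ := p'
  simp only [relTag, Prod.mk.injEq, Sum.inl.injEq] at h
  obtain ⟨rfl, h, rfl⟩ := h
  rw [Fin.ext h]

lemma val_finRotate_symm {n : ℕ} (z : Fin n) :
    (((finRotate n).symm z : Fin n) : ℕ) = (z + n - 1) % n := by
  obtain ⟨w, rfl⟩ := (finRotate n).surjective z
  rw [Equiv.symm_apply_apply, val_finRotate]
  have := w.2
  split_ifs with h
  · rw [Nat.mod_eq_of_lt] <;> omega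
  · rw [show (w : ℕ) + 1 + n - 1 = w + n by omega, Nat.add_mod_right, Nat.mod_eq_of_lt this]

lemma val_finRotate_mod {n : ℕ} (z : Fin n) : ((finRotate n z : Fin n) : ℕ) = (z + 1) % n := by
  rw [val_finRotate]
  have := z.2
  split_ifs with h
  · rw [h, Nat.mod_self]
  · rw [Nat.mod_eq_of_lt (by omega)]

lemma relTag_relShift {s : ι → List (α × Bool)} (p : RelPos s) :
    relTag X (relShift s p) = (.inl p.1.1, if p.2 then ((p.1.2 : ℕ) + 1) % (s p.1.1).length else
      ((p.1.2 : ℕ) + (s p.1.1).length - 1) % (s p.1.1).length, p.2) := by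
  obtain ⟨⟨i, z⟩, b⟩ := p
  cases b
  · simp only [relTag, relShift, Equiv.coe_fn_mk, Bool.false_eq_true, if_false, val_finRotate_symm]
  · simp only [relTag, relShift, Equiv.coe_fn_mk, if_true, val_finRotate_mod]

lemma relTag_relShift_pow {s : ι → List (α × Bool)} (p : RelPos s) (t : ℕ)
    (ht : t ≤ (s p.1.1).length) :
    relTag X ((relShift s ^ t) p) = (.inl p.1.1, if p.2 then ((p.1.2 : ℕ) + t) % (s p.1.1).length else
      ((p.1.2 : ℕ) + ((s p.1.1).length - t)) % (s p.1.1).length, p.2) := by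
  obtain ⟨⟨i, z⟩, b⟩ := p
  dsimp only at ht ⊢
  have hz := z.2
  induction t with
  | zero =>
    rw [pow_zero, Equiv.Perm.one_apply]
    cases b <;> simp [relTag, Nat.mod_eq_of_lt z.2]
  | succ t ih =>
    have ih' := ih (by omega)
    rw [pow_succ', Equiv.Perm.mul_apply]
    rw [relTag_relShift]
    generalize (relShift s ^ t) (⟨i, z⟩, b) = p' at ih'
    obtain ⟨⟨i', z'⟩, b'⟩ := p'
    simp only [relTag, Prod.mk.injEq, Sum.inl.injEq] at ih' ⊢
    obtain ⟨rfl, h2, rfl⟩ := ih'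
    rw [h2]
    refine ⟨rfl, ?_, rfl⟩
    cases b'
    · simp only [Bool.false_eq_true, if_false]
      clear ih h2 z'
      obtain ⟨z, _⟩ := z
      dsimp only at hz ⊢
      generalize (s i').length = N at *
      have hN : 0 < N := by omega
      rw [Nat.add_sub_assoc (by omega), Nat.mod_add_mod,
        show z + (N - t) + (N - 1) = z + (N - (t + 1)) + N by omega, Nat.add_mod_right]
    · simp only [if_true]
      rw [Nat.mod_add_mod, add_assoc]

end RelPos

section Cells

lemma cnt_exists_le {T U : Type*} [Fintype T] [Fintype U] (Q : U → T → Prop) :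
    cnt (fun t => ∃ u, Q u t) ≤ ∑ u, cnt (Q u) := by
  classical
  simp only [cnt_eq_card]
  refine le_trans (Finset.card_le_card ?_) Finset.card_biUnion_le
  intro t
  simp

lemma sum_cnt_le {T U : Type*} [Fintype T] [Fintype U] (Q : U → T → Prop)
    (h : ∀ t u u', Q u t → Q u' t → u = u') : ∑ u, cnt (Q u) ≤ cnt (fun t => ∃ u, Q u t) := by
  classical
  simp only [cnt_eq_card]
  rw [← Finset.card_biUnion]
  · refine Finset.card_le_card ?_
    intro t
    simp
  · intro u _ u' _ huu
    rw [Function.onFun, Finset.disjoint_left]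
    intro t ht ht'
    simp only [Finset.mem_filter, Finset.mem_univ, true_and] at ht ht'
    exact huu (h t u u' ht ht')

variable {ι α X : Type} [Inhabited α] {s : ι → List (α × Bool)} {wd : X → List (α × Bool)}
  {con : Set X} {L F : ℕ}

/-- The letter read at an oriented place of a relator. -/
def relLetter (s : ι → List (α × Bool)) (p : RelPos s) : α × Bool :=
  orient p.2 ((s p.1.1).getD p.1.2 default)

lemma tagLetter_relTag (p : RelPos s) :
    tagLetter (Sum.elim s wd) (relTag X p) = relLetter s p := rfl

lemma relLetter_relFlip (p : RelPos s) : relLetter s (relFlip p) = letterInv (relLetter s p) :=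
  orient_not _ _

/-- The words `s` are cyclically reduced. -/
def CycRed (s : List (α × Bool)) : Prop :=
  ∀ z < s.length, s.getD ((z + 1) % s.length) default ≠ letterInv (s.getD z default)

/-- The place `t'` is at distance `d` after `t`. -/
def TagAt (t : X × ℕ × Bool) (d : ℤ) (t' : X × ℕ × Bool) : Prop :=
  t'.1 = t.1 ∧ t'.2.2 = t.2.2 ∧ (t'.2.1 : ℤ) = t.2.1 + if t.2.2 then d else -d

/-- Around the oriented place `t` one reads the same letters, at distance at most `Λ`, as around the
place `p` of a relator. -/
def Window (s : ι → List (α × Bool)) (wd : X → List (α × Bool)) (con : Set X) (Λ : ℕ)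
    (t : X × ℕ × Bool) (p : RelPos s) : Prop :=
  t.1 ∉ con ∧ Λ ≤ t.2.1 ∧ t.2.1 + Λ < (wd t.1).length ∧ ∀ d : ℤ, -Λ ≤ d → d ≤ Λ →
    ∀ t', TagAt t d t' → tagLetter wd t' = relLetter s ((relShift s ^ d) p)

omit [Inhabited α] in
lemma relFlip_relShift_zpow (d : ℤ) (p : RelPos s) :
    relFlip ((relShift s ^ d) p) = (relShift s ^ (-d)) (relFlip p) := by
  induction d with
  | zero => simp
  | succ t ih =>
    rw [add_comm, zpow_one_add_apply, relFlip_relShift, ih, add_comm, neg_add, ← sub_eq_add_neg,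
      zpow_sub_one_apply]
  | pred t ih =>
    rw [show -(-(t : ℤ) - 1) = 1 + -(-(t : ℤ)) by ring, zpow_one_add_apply, ← ih,
      ← Equiv.symm_apply_eq, ← relFlip_relShift, zpow_sub_one_apply, Equiv.apply_symm_apply]

lemma Window.flip {Λ : ℕ} {t : X × ℕ × Bool} {p : RelPos s} (h : Window s wd con Λ t p) :
    Window s wd con Λ (tagFlip t) (relFlip p) := by
  obtain ⟨h1, h2, h3, h4⟩ := h
  refine ⟨h1, h2, h3, fun d hd hd' t' ht' => ?_⟩
  have h5 := h4 (-d) (by omega) (by omega) (tagFlip t') ?_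
  · rw [tagLetter_tagFlip] at h5
    rw [← letterInv_letterInv (tagLetter wd t'), h5, ← relLetter_relFlip, relFlip_relShift_zpow,
      neg_neg]
  · obtain ⟨e1, e2, e3⟩ := ht'
    refine ⟨e1, ?_, ?_⟩
    · simp only [tagFlip] at e2 ⊢
      rw [e2, Bool.not_not]
    · simp only [tagFlip] at e3 ⊢
      rw [e3]
      split_ifs <;> simp_all

lemma window_flip {Λ : ℕ} {t : X × ℕ × Bool} {p : RelPos s} :
    Window s wd con Λ (tagFlip t) (relFlip p) ↔ Window s wd con Λ t p :=
  ⟨fun h => by simpa [relFlip_relFlip] using h.flip, Window.flip⟩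

/-- Distinct oriented places of the relators have distinct continuations of length `Λ`. -/
def SmallCanc (s : ι → List (α × Bool)) (Λ : ℕ) : Prop :=
  ∀ p p' : RelPos s, (∀ t < Λ, relLetter s ((relShift s ^ t) p) =
    relLetter s ((relShift s ^ t) p')) → p = p'

lemma Window.unique {Λ : ℕ} (hSC : SmallCanc s Λ) {t : X × ℕ × Bool} {p p' : RelPos s}
    (h : Window s wd con Λ t p) (h' : Window s wd con Λ t p') : p = p' := by
  refine hSC p p' fun d hd => ?_
  have e : TagAt t d (t.1, (t.2.1 + if t.2.2 then (d : ℤ) else -d).toNat, t.2.2) := by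
    refine ⟨rfl, rfl, ?_⟩
    have := h.2.1
    dsimp only
    split_ifs <;> omega
  have h1 := h.2.2.2 d (by omega) (by omega) _ e
  have h2 := h'.2.2.2 d (by omega) (by omega) _ e
  rw [← zpow_natCast, ← h1, h2, zpow_natCast]

end Cells

section Bound

variable {ι α X : Type} [Inhabited α] {s : ι → List (α × Bool)} {wd : X → List (α × Bool)}
  {con : Set X} {L F : ℕ}

namespace Cfg

/-- The side belongs to a cell. -/
def IsCell (C : Cfg s wd con L F) (y : C.S) : Prop := (C.tp y).1.isLeft

/-- The side is the first one of a value of a letter. -/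
def BdStart (C : Cfg s wd con L F) (y : C.S) : Prop :=
  (C.tp y).1.isRight ∧ TagStart (Sum.elim s wd) (C.tp y)

/-- A strand breaks before the side. -/
def Brk (C : Cfg s wd con L F) (y : C.S) : Prop :=
  C.nx (C.al y) ≠ C.al (C.nx.symm y) ∨ C.BdStart y ∨ C.BdStart (C.nx (C.al y))

/-- The letter of a side. -/
def lab (C : Cfg s wd con L F) (y : C.S) : α × Bool := tagLetter (Sum.elim s wd) (C.tp y)

/-- The side carries a window of the relator place `p`. -/
def Assigned (C : Cfg s wd con L F) (Λ : ℕ) (y : C.S) (p : RelPos s) : Prop :=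
  ∃ t : X × ℕ × Bool, C.tp y = (.inr t.1, t.2) ∧ Window s wd con Λ t p

variable (C : Cfg s wd con L F)

lemma exists_of_isCell {y : C.S} (h : C.IsCell y) : ∃ p : RelPos s, relTag X p = C.tp y := by
  have h1 := C.tp_lt y
  unfold IsCell at h
  rcases hy : C.tp y with ⟨k, z, b⟩
  rw [hy] at h h1
  rcases k with i | x
  · exact ⟨(⟨i, z, h1⟩, b), rfl⟩
  · simp at h

lemma exists_of_not_isCell {y : C.S} (h : ¬ C.IsCell y) :
    ∃ t : X × ℕ × Bool, C.tp y = (.inr t.1, t.2) := by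
  unfold IsCell at h
  rcases hy : C.tp y with ⟨k, z, b⟩
  rw [hy] at h
  rcases k with i | x
  · simp at h
  · exact ⟨(x, z, b), rfl⟩

lemma not_isCell_of_eq {y : C.S} {t : X × ℕ × Bool} (h : C.tp y = (.inr t.1, t.2)) :
    ¬ C.IsCell y := by
  simp [IsCell, h]

lemma isCell_of_eq {y : C.S} {p : RelPos s} (h : relTag X p = C.tp y) : C.IsCell y := by
  simp [IsCell, ← h, relTag]

open Classical in
/-- The place of a relator at a side of a cell. -/
noncomputable def pos [Nonempty (RelPos s)] (y : C.S) : RelPos s :=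
  if h : ∃ p : RelPos s, relTag X p = C.tp y then h.choose else Classical.arbitrary _

lemma relTag_pos [Nonempty (RelPos s)] {y : C.S} (h : C.IsCell y) :
    relTag X (C.pos y) = C.tp y := by
  have h' := C.exists_of_isCell h
  rw [pos, dif_pos h']
  exact h'.choose_spec

lemma pos_eq [Nonempty (RelPos s)] {y : C.S} {p : RelPos s} (h : relTag X p = C.tp y) :
    C.pos y = p :=
  relTag_inj ((C.relTag_pos (C.isCell_of_eq h)).trans h.symm)

lemma relTag_relShift_eq {y : C.S} {p : RelPos s} (h : relTag X p = C.tp y) :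
    relTag X (relShift s p) = C.tp (C.nx y) := by
  rw [C.next_cell y _ _ _ h.symm, relTag_relShift]

lemma isCell_nx (y : C.S) : C.IsCell (C.nx y) ↔ C.IsCell y := by
  constructor
  · intro h
    by_contra h'
    obtain ⟨t, ht⟩ := C.exists_of_not_isCell h'
    have := C.next_bd y (by simp [ht])
    unfold IsCell at h
    cases hk : (C.tp (C.nx y)).1 <;> simp_all
  · intro h
    obtain ⟨p, hp⟩ := C.exists_of_isCell h
    exact C.isCell_of_eq (C.relTag_relShift_eq hp)

lemma lab_al' (y : C.S) : C.lab (C.al y) = letterInv (C.lab y) := C.lab_al y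

lemma spurs_le (hwd : ∀ x z, z + 1 < (wd x).length →
    (wd x).getD (z + 1) default ≠ letterInv ((wd x).getD z default))
    (hs : ∀ i, CycRed (s i)) : cnt (fun y => C.al (C.nx.symm y) = y) ≤ L := by
  refine le_trans (cnt_mono fun y hy => ?_) C.card_start_bd
  obtain ⟨w, rfl⟩ := C.nx.surjective y
  rw [Equiv.symm_apply_apply] at hy
  have hl := C.lab_al w
  rw [hy] at hl
  by_cases hc : C.IsCell w
  · exfalso
    obtain ⟨p, hp⟩ := C.exists_of_isCell hc
    rw [← hp, ← C.relTag_relShift_eq hp, relTag_relShift] at hl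
    obtain ⟨⟨i, z⟩, b⟩ := p
    have hz := z.2
    cases b
    · simp only [tagLetter, relTag, orient, Sum.elim_inl, Bool.false_eq_true, if_false,
        letterInv_letterInv] at hl
      have := hs i ((z + (s i).length - 1) % (s i).length) (Nat.mod_lt _ (by omega))
      rw [Nat.mod_add_mod, show (z : ℕ) + (s i).length - 1 + 1 = z + (s i).length by omega,
        Nat.add_mod_right, Nat.mod_eq_of_lt hz, hl] at this
      exact this rfl
    · simp only [tagLetter, relTag, orient, Sum.elim_inl, if_true] at hl
      exact hs i z hz hl
  · obtain ⟨t, ht⟩ := C.exists_of_not_isCell hc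
    have hr := C.next_bd w (by simp [ht])
    refine ⟨hr, (C.next w).resolve_right fun hsu => ?_⟩
    have h1 := C.tp_lt w
    have h2 := C.tp_lt (C.nx w)
    obtain ⟨x, z, b⟩ := t
    rcases hy' : C.tp (C.nx w) with ⟨k', z', b'⟩
    rw [hy'] at hsu hl h2
    rw [ht] at hsu hl h1
    simp only [TagSucc] at hsu
    obtain ⟨rfl, rfl, hsu⟩ := hsu
    cases b'
    · simp only [Bool.false_eq_true, if_false] at hsu
      subst hsu
      simp only [tagLetter, orient, Sum.elim_inr, Bool.false_eq_true, if_false,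
        letterInv_letterInv] at hl
      refine hwd x z' h1 ?_
      rw [hl]
    · simp only [if_true] at hsu
      subst hsu
      exact hwd x z h2 hl

lemma brk_al {y : C.S} (h : ¬ C.Brk y) : ¬ C.Brk (C.nx (C.al y)) := by
  simp only [Brk, not_or, not_not] at h ⊢
  obtain ⟨h1, h2, h3⟩ := h
  have e : C.al (C.nx (C.al y)) = C.nx.symm y := by rw [h1, C.al_al]
  rw [e, Equiv.symm_apply_apply, Equiv.apply_symm_apply, C.al_al]
  exact ⟨rfl, h3, h2⟩

lemma cnt_bdStart_al : cnt (fun y => C.BdStart (C.nx (C.al y))) ≤ L := by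
  refine le_trans (cnt_le_of_injOn (fun y => C.nx (C.al y)) (fun y hy => hy) ?_) C.card_start_bd
  intro y _ y' _ h
  have h' := congrArg C.al (C.nx.injective h)
  rwa [C.al_al, C.al_al] at h'

lemma cnt_brk_le (hwd : ∀ x z, z + 1 < (wd x).length →
    (wd x).getD (z + 1) default ≠ letterInv ((wd x).getD z default))
    (hs : ∀ i, CycRed (s i)) : cnt C.Brk ≤ 6 * F + 6 * L := by
  have h1 := C.spurs_le hwd hs
  have h2 := C.nonsmooth
  have h3 := C.cnt_bdStart_al
  have h4 : cnt C.BdStart ≤ L := C.card_start_bd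
  have h5 := cnt_or_le (fun y => C.nx (C.al y) ≠ C.al (C.nx.symm y))
    (fun y => C.BdStart y ∨ C.BdStart (C.nx (C.al y)))
  have h6 := cnt_or_le C.BdStart (fun y => C.BdStart (C.nx (C.al y)))
  have h7 : cnt C.Brk = cnt (fun y => C.nx (C.al y) ≠ C.al (C.nx.symm y) ∨
    (C.BdStart y ∨ C.BdStart (C.nx (C.al y)))) := rfl
  omega

/-- Along an unbroken strand the places follow each other. -/
lemma exists_tagAt {b : C.S} {t : X × ℕ × Bool} (hb : C.tp b = (.inr t.1, t.2)) (d : ℤ)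
    (h1 : ∀ e : ℤ, 1 ≤ e → e ≤ d → ¬ C.BdStart ((C.nx ^ e) b))
    (h2 : ∀ e : ℤ, d < e → e ≤ 0 → ¬ C.BdStart ((C.nx ^ e) b)) :
    ∃ t', C.tp ((C.nx ^ d) b) = (.inr t'.1, t'.2) ∧ TagAt t d t' := by
  have key : ∀ w : C.S, ¬ C.BdStart (C.nx w) → ¬ C.IsCell w →
      TagSucc (C.tp w) (C.tp (C.nx w)) := by
    intro w hw hc
    refine (C.next w).resolve_left fun hst => hw ⟨C.next_bd w ?_, hst⟩
    obtain ⟨t, ht⟩ := C.exists_of_not_isCell hc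
    simp [ht]
  induction d with
  | zero => exact ⟨t, hb, rfl, rfl, by simp⟩
  | succ d ih =>
    obtain ⟨t', ht', e1, e2, e3⟩ := ih (fun e he he' => h1 e he (by omega)) (by omega)
    have h3 := h1 (d + 1) (by omega) le_rfl
    rw [add_comm, zpow_one_add_apply] at h3 ⊢
    have h4 := key _ h3 (C.not_isCell_of_eq ht')
    rcases hy : C.tp (C.nx ((C.nx ^ (d : ℤ)) b)) with ⟨k, z, c⟩
    rw [ht', hy] at h4
    obtain ⟨f1, f2, f3⟩ := h4
    dsimp only at f1 f2 f3
    subst f1 f2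
    refine ⟨(t'.1, z, t'.2.2), rfl, e1, e2, ?_⟩
    dsimp only
    split_ifs at * <;> simp_all <;> omega
  | pred d ih =>
    obtain ⟨t', ht', e1, e2, e3⟩ := ih (by omega) (fun e he he' => h2 e (by omega) he')
    have h3 := h2 (-d) (by omega) (by omega)
    rw [zpow_sub_one_apply]
    have hn : ¬ C.IsCell (C.nx.symm ((C.nx ^ (-d : ℤ)) b)) := by
      rw [← C.isCell_nx, Equiv.apply_symm_apply]
      exact C.not_isCell_of_eq ht'
    have h4 := key _ (by rwa [Equiv.apply_symm_apply]) hn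
    obtain ⟨t'', ht''⟩ := C.exists_of_not_isCell hn
    rw [Equiv.apply_symm_apply, ht', ht''] at h4
    obtain ⟨f1, f2, f3⟩ := h4
    dsimp only at f1 f2 f3
    refine ⟨t'', ht'', ?_, ?_, ?_⟩
    · rw [← e1, Sum.inr.inj f1]
    · rw [← e2, f2]
    · rw [← f2, e2] at f3
      split_ifs at * <;> omega

end Cfg

end Bound

section Bound

variable {ι α X : Type} [Inhabited α] {s : ι → List (α × Bool)} {wd : X → List (α × Bool)}
  {con : Set X} {L F : ℕ}

namespace Cfg

variable (C : Cfg s wd con L F)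

lemma lab_eq_relLetter {y : C.S} {p : RelPos s} (h : relTag X p = C.tp y) :
    C.lab y = relLetter s p := by
  rw [lab, ← h, tagLetter_relTag]

lemma lab_eq_tagLetter {y : C.S} {t : X × ℕ × Bool} (h : C.tp y = (Sum.inr t.1, t.2)) :
    C.lab y = tagLetter wd t := by
  rw [lab, h]
  rfl

lemma Assigned.lab_eq {C : Cfg s wd con L F} {Λ : ℕ} {y : C.S} {p : RelPos s}
    (h : C.Assigned Λ y p) : C.lab y = relLetter s p := by
  obtain ⟨t, ht, h1, h2, h3, h4⟩ := h
  rw [C.lab_eq_tagLetter ht, h4 0 (by omega) (by omega) t ⟨rfl, rfl, by simp⟩]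
  rfl

lemma Assigned.unique {C : Cfg s wd con L F} {Λ : ℕ} (hSC : SmallCanc s Λ) {y : C.S}
    {p p' : RelPos s} (h : C.Assigned Λ y p) (h' : C.Assigned Λ y p') : p = p' := by
  obtain ⟨t, ht, hw⟩ := h
  obtain ⟨t', ht', hw'⟩ := h'
  have : t = t' := by
    rw [ht] at ht'
    simp only [Prod.mk.injEq, Sum.inr.injEq] at ht'
    exact Prod.ext ht'.1 ht'.2
  subst this
  exact hw.unique hSC hw'

lemma assigned_iff {Λ : ℕ} {y : C.S} {t : X × ℕ × Bool} (ht : C.tp y = (Sum.inr t.1, t.2))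
    (p : RelPos s) : C.Assigned Λ y p ↔ Window s wd con Λ t p := by
  constructor
  · rintro ⟨t', ht', hw⟩
    have : t = t' := by
      rw [ht] at ht'
      simp only [Prod.mk.injEq, Sum.inr.injEq] at ht'
      exact Prod.ext ht'.1 ht'.2
    rwa [this]
  · exact fun h => ⟨t, ht, h⟩

lemma pos_al_ne [Nonempty (RelPos s)] {y : C.S} (hy : C.IsCell y) (hy' : C.IsCell (C.al y)) :
    C.pos (C.al y) ≠ relFlip (C.pos y) := by
  have key : ∀ (y : C.S) (i : ι) (z : Fin (s i).length), C.tp y = (Sum.inl i, (z : ℕ), true) →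
      C.tp (C.al y) = (Sum.inl i, (z : ℕ), false) → False := by
    intro y i z h h'
    have hp := C.push i z (C.lab y) (fun w => w = y) (fun _ => False) ?_ ?_ ?_
    · have h0 : cnt (fun w => (C.tp w).1.isLeft ∧ ((w = y ∧ C.tp w ≠ (Sum.inl i, (z : ℕ), true)) ∨
          (C.al w = y ∧ C.tp w ≠ (Sum.inl i, (z : ℕ), false)))) = 0 := by
        refine cnt_false fun w => ?_
        rintro ⟨-, ⟨rfl, hw⟩ | ⟨rfl, hw⟩⟩
        · exact hw h
        · rw [C.al_al] at h'
          exact hw h'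
      have h1 : cnt (fun w => ∃ t : X × ℕ × Bool, C.tp w = (Sum.inr t.1, t.2) ∧
          (¬ (w = y ↔ False) ∨ ¬ (C.al w = y ↔ False))) = 0 := by
        refine cnt_false fun w => ?_
        rintro ⟨t, ht, hw | hw⟩
        · rw [iff_false, not_not] at hw
          subst hw
          simp [h] at ht
        · rw [iff_false, not_not] at hw
          subst hw
          rw [C.al_al, ht] at h'
          simp at h'
      rw [h0, h1] at hp
      have h2 : 0 < cnt (fun w => (w = y ∧ C.tp w = (Sum.inl i, (z : ℕ), true)) ∨
          (C.al w = y ∧ C.tp w = (Sum.inl i, (z : ℕ), false))) := cnt_pos (t := y) (.inl ⟨rfl, h⟩)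
      omega
    · rw [lab, h]
      simp [tagLetter, orient]
    · rintro w rfl
      rfl
    · exact fun t ht => ht.elim
  intro he
  have h1 := C.relTag_pos hy
  have h2 := C.relTag_pos hy'
  rw [he] at h2
  rcases hp : C.pos y with ⟨⟨i, z⟩, b⟩
  rw [hp] at h1 h2
  cases b
  · refine key (C.al y) i z h2.symm ?_
    rw [C.al_al]
    exact h1.symm
  · exact key y i z h1.symm h2.symm

lemma cnt_al (P : C.S → Prop) : cnt (fun y => P (C.al y)) = cnt P := by
  apply le_antisymm
  · refine cnt_le_of_injOn C.al (fun y hy => hy) fun y _ y' _ h => ?_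
    rw [← C.al_al y, h, C.al_al]
  · refine cnt_le_of_injOn C.al (fun y hy => by rwa [C.al_al]) fun y _ y' _ h => ?_
    rw [← C.al_al y, h, C.al_al]

lemma cnt_assigned_le [Fintype ι] [Nonempty (RelPos s)] {Λ : ℕ} (hSC : SmallCanc s Λ) :
    cnt (fun b => ¬ C.IsCell b ∧ C.IsCell (C.al b) ∧
      C.Assigned Λ b (relFlip (C.pos (C.al b)))) ≤
    cnt (fun b => ¬ C.IsCell b ∧ C.IsCell (C.al b) ∧
      ∃ p, C.Assigned Λ b p ∧ p ≠ relFlip (C.pos (C.al b))) +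
    cnt (fun b => ¬ C.IsCell b ∧ ¬ C.IsCell (C.al b) ∧
      ∃ p, C.Assigned Λ b p ∧ ¬ C.Assigned Λ (C.al b) (relFlip p)) := by
  let M : (Σ i, Fin (s i).length) → C.S → Prop := fun u y =>
    (¬ C.IsCell y ∨ ¬ C.IsCell (C.al y)) ∧ (¬ C.IsCell y → C.Assigned Λ y (u, true)) ∧
      (¬ C.IsCell (C.al y) → C.Assigned Λ (C.al y) (u, false))
  let Q₁ : (Σ i, Fin (s i).length) → C.S → Prop := fun u y => C.IsCell y ∧ ¬ C.IsCell (C.al y) ∧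
    ∃ β, C.Assigned Λ (C.al y) (u, β) ∧ (u, β) ≠ relFlip (C.pos y)
  let Q₂ : (Σ i, Fin (s i).length) → C.S → Prop := fun u y => ¬ C.IsCell y ∧
    ¬ C.IsCell (C.al y) ∧ ∃ β, C.Assigned Λ y (u, β) ∧ ¬ C.Assigned Λ (C.al y) (u, !β)
  let Q₀ : (Σ i, Fin (s i).length) → C.S → Prop := fun u y =>
    (M u y ∧ C.tp y = (Sum.inl u.1, (u.2 : ℕ), true)) ∨ (M u (C.al y) ∧ C.tp y = (Sum.inl u.1, (u.2 : ℕ), false))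
  have hM : ∀ u, cnt (Q₀ u) ≤ cnt (Q₁ u) + cnt (Q₂ u) := by
    intro u
    refine le_trans (C.push u.1 u.2 (relLetter s (u, true)) (M u)
      (fun t => Window s wd con Λ t (u, true)) ?_ ?_ ?_) (Nat.add_le_add (cnt_mono ?_) (cnt_mono ?_))
    · simp [relLetter, orient]
    · rintro y ⟨h1 | h1, h2, h3⟩
      · exact (h2 h1).lab_eq
      · have := (h3 h1).lab_eq
        rw [C.lab_al'] at this
        have h4 : relLetter s (u, false) = letterInv (relLetter s (u, true)) :=
          relLetter_relFlip (u, true)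
        rw [h4] at this
        exact letterInv_inj.1 this
    · intro t ht
      exact ⟨ht.2.2.2 0 (by omega) (by omega) t ⟨rfl, rfl, by simp⟩, ht.1⟩
    · rintro y ⟨hy, ⟨h1, h2⟩ | ⟨h1, h2⟩⟩
      · have hc : ¬ C.IsCell (C.al y) := h1.1.resolve_left (not_not.2 hy)
        refine ⟨hy, hc, false, h1.2.2 hc, fun he => h2 ?_⟩
        rw [← C.relTag_pos hy, ← relFlip_relFlip (C.pos y), ← he]
        rfl
      · have hc : ¬ C.IsCell (C.al y) := h1.1.resolve_right (by rw [C.al_al]; exact not_not.2 hy)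
        refine ⟨hy, hc, true, h1.2.1 hc, fun he => h2 ?_⟩
        rw [← C.relTag_pos hy, ← relFlip_relFlip (C.pos y), ← he]
        rfl
    · rintro y ⟨t, ht, h⟩
      have hc := C.not_isCell_of_eq ht
      have e1 : Window s wd con Λ t (u, true) ↔ C.Assigned Λ y (u, true) :=
        (C.assigned_iff ht _).symm
      have e2 : Window s wd con Λ (tagFlip t) (u, true) ↔ C.Assigned Λ y (u, false) := by
        rw [C.assigned_iff ht, ← window_flip, tagFlip_tagFlip]
        rfl
      rw [e1, e2] at h
      simp only [M, C.al_al, hc, not_false_eq_true, true_or, or_true, true_and,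
        true_implies] at h
      refine ⟨hc, ?_⟩
      rcases h with h | h
      · have h1 : C.Assigned Λ y (u, true) ∧ ¬ C.IsCell (C.al y) ∧
            ¬ C.Assigned Λ (C.al y) (u, false) := by tauto
        exact ⟨h1.2.1, true, h1.1, h1.2.2⟩
      · have h1 : C.Assigned Λ y (u, false) ∧ ¬ C.IsCell (C.al y) ∧
            ¬ C.Assigned Λ (C.al y) (u, true) := by tauto
        exact ⟨h1.2.1, false, h1.1, h1.2.2⟩
  rw [← C.cnt_al]
  calc _ ≤ cnt (fun y => ∃ u, Q₀ u y) := ?_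
    _ ≤ ∑ u, cnt (Q₀ u) := cnt_exists_le _
    _ ≤ ∑ u, (cnt (Q₁ u) + cnt (Q₂ u)) := Finset.sum_le_sum fun u _ => hM u
    _ = ∑ u, cnt (Q₁ u) + ∑ u, cnt (Q₂ u) := Finset.sum_add_distrib
    _ ≤ cnt (fun y => ∃ u, Q₁ u y) + cnt (fun y => ∃ u, Q₂ u y) :=
      Nat.add_le_add (sum_cnt_le _ ?_) (sum_cnt_le _ ?_)
    _ ≤ _ := Nat.add_le_add ?_ ?_
  · refine cnt_mono fun y hy => ?_
    rw [C.al_al] at hy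
    obtain ⟨h1, h2, h3⟩ := hy
    rcases hp : C.pos y with ⟨u, b⟩
    have ht := C.relTag_pos h2
    rw [hp] at h3 ht
    refine ⟨u, ?_⟩
    cases b
    · refine .inr ⟨⟨.inl h1, fun _ => h3, fun h => absurd h2 ?_⟩, ht.symm⟩
      rwa [C.al_al] at h
    · exact .inl ⟨⟨.inr h1, fun h => absurd h2 h, fun _ => h3⟩, ht.symm⟩
  · rintro y u u' ⟨-, -, β, h, -⟩ ⟨-, -, β', h', -⟩
    exact congrArg Prod.fst (h.unique hSC h')
  · rintro y u u' ⟨-, -, β, h, -⟩ ⟨-, -, β', h', -⟩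
    exact congrArg Prod.fst (h.unique hSC h')
  · rw [← C.cnt_al]
    refine cnt_mono ?_
    rintro y ⟨u, h1, h2, β, h3, h4⟩
    rw [C.al_al] at h2 h3
    exact ⟨h2, h1, (u, β), h3, h4⟩
  · refine cnt_mono ?_
    rintro y ⟨u, h1, h2, β, h3, h4⟩
    exact ⟨h1, h2, (u, β), h3, h4⟩

/-- The number of cells of the diagrams of a minimal solution is bounded. -/
theorem cells_le [Fintype ι] (C : Cfg s wd con L F) {Λ : ℕ} (hΛ : 1 ≤ Λ) (hSC : SmallCanc s Λ)
    (hs : ∀ i, CycRed (s i)) (hlen : ∀ i, 7 * Λ ≤ (s i).length)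
    (hwd : ∀ x z, z + 1 < (wd x).length →
      (wd x).getD (z + 1) default ≠ letterInv ((wd x).getD z default))
    (hcon : ∀ x ∈ con, (wd x).length ≤ 2 * Λ) : F ≤ 6 * L := by
  classical
  have hF := C.card_cell (7 * Λ) hlen
  by_cases hN : Nonempty (RelPos s)
  swap
  · have h0 : cnt (fun y => (C.tp y).1.isLeft) = 0 := by
      refine cnt_false fun y hy => hN ?_
      exact (C.exists_of_isCell (y := y) hy).nonempty
    rw [h0, Nat.le_zero, Nat.mul_eq_zero] at hF
    omega
  have hBk : ∀ y, ¬ C.Brk y → ¬ C.BdStart y := fun y hy h => hy (.inr (.inl h))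
  have key := card_cell_le C.al C.nx C.IsCell C.Brk C.pos (relShift s) relFlip (relLetter s) C.lab
    (C.Assigned Λ) Λ C.al_al ?_ (fun y => C.brk_al) C.isCell_nx ?_ relFlip_relShift
    relLetter_relFlip C.lab_al' ?_ ?_ (fun y => C.pos_al_ne) relFlip_relFlip ?_ ?_ ?_ ?_
  · rw [← cnt_eq_card, ← cnt_eq_card] at key
    have h1 : cnt C.IsCell ≤ Λ * (6 * F + 6 * L) :=
      key.trans (Nat.mul_le_mul_left _ (C.cnt_brk_le hwd hs))
    have h2 : Λ * (7 * F) ≤ Λ * (6 * F + 6 * L) := by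
      refine le_trans ?_ h1
      calc Λ * (7 * F) = 7 * Λ * F := by ring
        _ ≤ _ := hF
    have := Nat.le_of_mul_le_mul_left h2 hΛ
    omega
  · intro y hy
    by_contra h
    exact hy (.inl h)
  · intro y hy
    exact C.pos_eq (C.relTag_relShift_eq (C.relTag_pos hy))
  · intro y hy
    exact C.lab_eq_relLetter (C.relTag_pos hy)
  · intro p p' h
    refine hSC p p' fun t ht => ?_
    simpa using h t (by omega) (by omega)
  · intro b p hb h1 h2 h3
    obtain ⟨t, ht⟩ := C.exists_of_not_isCell hb
    have hrun : ∀ d : ℤ, -Λ ≤ d → d ≤ Λ →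
        ∃ t', C.tp ((C.nx ^ d) b) = (.inr t'.1, t'.2) ∧ TagAt t d t' := fun d hd hd' =>
      C.exists_tagAt ht d (fun e he he' => hBk _ (h1 e he (by omega)))
        (fun e he he' => hBk _ (h2 e (by omega) he'))
    obtain ⟨t₁, g1, e1, e2, e3⟩ := hrun Λ (by omega) le_rfl
    obtain ⟨t₂, g2, f1, f2, f3⟩ := hrun (-Λ) le_rfl (by omega)
    have l1 := C.tp_lt ((C.nx ^ (Λ : ℤ)) b)
    have l2 := C.tp_lt ((C.nx ^ (-Λ : ℤ)) b)
    rw [g1, Sum.elim_inr, e1] at l1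
    rw [g2, Sum.elim_inr, f1] at l2
    have l3 : Λ ≤ t.2.1 ∧ t.2.1 + Λ < (wd t.1).length := by
      split_ifs at e3 f3 <;> dsimp only at * <;> omega
    refine ⟨t, ht, fun hc => ?_, l3.1, l3.2, fun d hd hd' t' ht' => ?_⟩
    · have := hcon _ hc
      omega
    · obtain ⟨t'', g3, i1, i2, i3⟩ := hrun d hd hd'
      obtain ⟨j1, j2, j3⟩ := ht'
      have : t' = t'' := by
        refine Prod.ext (j1.trans i1.symm) (Prod.ext ?_ (j2.trans i2.symm))
        omega
      rw [this, ← C.lab_eq_tagLetter g3]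
      exact h3 d hd hd'
  · rintro b p ⟨t, ht, hw⟩ d hd hd' h
    obtain ⟨t', h1, h2⟩ := C.exists_tagAt ht d (fun e he he' => hBk _ (h e he he'))
      (by omega)
    rw [C.lab_eq_tagLetter h1]
    exact hw.2.2.2 d (by omega) hd' t' h2
  · rintro b p ⟨t, ht, hw⟩ d hd hd' h
    obtain ⟨t', h1, h2⟩ := C.exists_tagAt ht d (by omega)
      (fun e he he' => hBk _ (h e he he'))
    rw [C.lab_eq_tagLetter h1]
    exact hw.2.2.2 d hd (by omega) t' h2
  · have := C.cnt_assigned_le hSC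
    simp only [cnt_eq_card] at this
    convert this

end Cfg

end Bound

section Linked

variable {ι α X : Type} [Inhabited α] {s : ι → List (α × Bool)} {wd : X → List (α × Bool)}
  {con : Set X} {L F : ℕ}

namespace Cfg

variable (C : Cfg s wd con L F)

/-- Two places are glued by the diagrams. -/
def Link (t t' : (ι ⊕ X) × ℕ × Bool) : Prop := ∃ y, C.tp y = t ∧ tagFlip (C.tp (C.al y)) = t'

lemma Link.flip {C : Cfg s wd con L F} {t t' : (ι ⊕ X) × ℕ × Bool} (h : C.Link t t') :
    C.Link (tagFlip t') (tagFlip t) := by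
  obtain ⟨y, rfl, rfl⟩ := h
  exact ⟨C.al y, by simp, by rw [C.al_al]⟩

lemma Link.letter {C : Cfg s wd con L F} {t t' : (ι ⊕ X) × ℕ × Bool} (h : C.Link t t') :
    tagLetter (Sum.elim s wd) t = tagLetter (Sum.elim s wd) t' := by
  obtain ⟨y, rfl, rfl⟩ := h
  rw [tagLetter_tagFlip, C.lab_al, letterInv_letterInv]

lemma Link.letter_of_eqvGen {C : Cfg s wd con L F} {t t' : (ι ⊕ X) × ℕ × Bool}
    (h : Relation.EqvGen C.Link t t') :
    tagLetter (Sum.elim s wd) t = tagLetter (Sum.elim s wd) t' := by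
  induction h with
  | rel _ _ h => exact h.letter
  | refl => rfl
  | symm _ _ _ ih => exact ih.symm
  | trans _ _ _ _ _ ih ih' => exact ih.trans ih'

lemma eqvGen_al {t : (ι ⊕ X) × ℕ × Bool} (y : C.S) :
    Relation.EqvGen C.Link t (C.tp (C.al y)) ↔
      Relation.EqvGen C.Link t (tagFlip (C.tp y)) := by
  have h : C.Link (C.tp (C.al y)) (tagFlip (C.tp y)) := ⟨C.al y, rfl, by rw [C.al_al]⟩
  exact ⟨fun h' => h'.trans _ _ _ (.rel _ _ h), fun h' => h'.trans _ _ _ (.symm _ _ (.rel _ _ h))⟩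

lemma Link.lt_of_eqvGen {C : Cfg s wd con L F} {t t' : (ι ⊕ X) × ℕ × Bool}
    (h : Relation.EqvGen C.Link t t') :
    t.2.1 < (Sum.elim s wd t.1).length ↔ t'.2.1 < (Sum.elim s wd t'.1).length := by
  induction h with
  | rel _ _ h =>
    obtain ⟨y, rfl, rfl⟩ := h
    exact iff_of_true (C.tp_lt _) (C.tp_lt (C.al y))
  | refl => rfl
  | symm _ _ _ ih => exact ih.symm
  | trans _ _ _ _ _ ih ih' => exact ih.trans ih'

/-- Every place of a relator which occurs in a cell is glued to another place of a relator or to a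
place of a constant. -/
theorem exists_linked {y₀ : C.S} {i : ι} {z : Fin (s i).length} {b : Bool}
    (hy : C.tp y₀ = (.inl i, (z : ℕ), b)) :
    ∃ t, Relation.EqvGen C.Link (relTag X (⟨i, z⟩, true)) t ∧
      t.2.1 < (Sum.elim s wd t.1).length ∧
      ((∃ i', t.1 = .inl i' ∧ (i', t.2.1) ≠ (i, (z : ℕ))) ∨ ∃ x ∈ con, t.1 = .inr x) := by
  suffices h : ∃ t, Relation.EqvGen C.Link (relTag X (⟨i, z⟩, true)) t ∧
      ((∃ i', t.1 = .inl i' ∧ (i', t.2.1) ≠ (i, (z : ℕ))) ∨ ∃ x ∈ con, t.1 = .inr x) by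
    obtain ⟨t, h1, h2⟩ := h
    exact ⟨t, h1, (Link.lt_of_eqvGen h1).1 z.2, h2⟩
  by_contra! hcon
  have key : ∀ b, Relation.EqvGen C.Link (relTag X (⟨i, z⟩, true)) (.inl i, (z : ℕ), b) →
      b = true := by
    intro b hb
    by_contra hb'
    rw [Bool.not_eq_true] at hb'
    subst hb'
    have := Link.letter_of_eqvGen hb
    simp only [tagLetter, relTag, orient, if_true, Bool.false_eq_true, if_false] at this
    exact letterInv_ne _ this.symm
  have key' : ∀ t, Relation.EqvGen C.Link (relTag X (⟨i, z⟩, true)) t → t.1.isLeft →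
      t = (.inl i, (z : ℕ), true) := by
    rintro ⟨k, z', b⟩ ht hk
    rcases k with i' | x
    · have := (hcon _ ht).1 i' rfl
      simp only [Prod.mk.injEq] at this
      obtain ⟨rfl, rfl⟩ := this
      rw [key b ht]
    · simp at hk
  have hp := C.push i z (relLetter s (⟨i, z⟩, true))
    (fun y => Relation.EqvGen C.Link (relTag X (⟨i, z⟩, true)) (C.tp y))
    (fun t => Relation.EqvGen C.Link (relTag X (⟨i, z⟩, true)) (.inr t.1, t.2)) ?_ ?_ ?_
  · refine absurd hp (not_le.2 ?_)
    rw [cnt_false, cnt_false]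
    · cases b
      · refine cnt_pos (t := y₀) (.inr ⟨?_, hy⟩)
        rw [C.eqvGen_al, hy]
        exact .refl _
      · refine cnt_pos (t := y₀) (.inl ⟨?_, hy⟩)
        rw [hy]
        exact .refl _
    · rintro y ⟨t, ht, h | h⟩
      · rw [ht] at h
        exact h Iff.rfl
      · rw [C.eqvGen_al, ht] at h
        exact h Iff.rfl
    · rintro y ⟨hc, ⟨h1, h2⟩ | ⟨h1, h2⟩⟩
      · exact h2 (key' _ h1 hc)
      · rw [C.eqvGen_al] at h1
        have := key' _ h1 hc
        exact h2 (by rw [← tagFlip_tagFlip (C.tp y), this]; rfl)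
  · simp [relLetter, orient]
  · exact fun y h => (Link.letter_of_eqvGen h).symm
  · exact fun t h => ⟨(Link.letter_of_eqvGen h).symm, fun hc => (hcon _ h).2 _ hc rfl⟩

end Cfg

end Linked

section Bands

variable {Q α κ : Type}

/-- Move forward along an oriented word. -/
def adv (t : Q × ℤ × Bool) (j : ℤ) : Q × ℤ × Bool :=
  (t.1, if t.2.2 then t.2.1 + j else t.2.1 - j, t.2.2)

/-- The same place with the opposite orientation. -/
def zFlip (t : Q × ℤ × Bool) : Q × ℤ × Bool := (t.1, t.2.1, !t.2.2)

@[simp] lemma zFlip_zFlip (t : Q × ℤ × Bool) : zFlip (zFlip t) = t := by simp [zFlip]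

@[simp] lemma adv_zero (t : Q × ℤ × Bool) : adv t 0 = t := by simp [adv]

lemma adv_adv (t : Q × ℤ × Bool) (i j : ℤ) : adv (adv t i) j = adv t (i + j) := by
  obtain ⟨x, z, b⟩ := t
  cases b <;> simp [adv] <;> ring

lemma adv_zFlip (t : Q × ℤ × Bool) (j : ℤ) : adv (zFlip t) j = zFlip (adv t (-j)) := by
  obtain ⟨x, z, b⟩ := t
  cases b <;> simp [adv, zFlip]
  ring

/-- The letter read at an oriented place. -/
def zLetter (lt : Q → ℤ → α × Bool) (t : Q × ℤ × Bool) : α × Bool := orient t.2.2 (lt t.1 t.2.1)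

lemma zLetter_zFlip (lt : Q → ℤ → α × Bool) (t : Q × ℤ × Bool) :
    zLetter lt (zFlip t) = letterInv (zLetter lt t) := orient_not _ _

/-- The place lies inside its word. -/
def InLen (len : Q → ℕ) (t : Q × ℤ × Bool) : Prop := 0 ≤ t.2.1 ∧ t.2.1 < len t.1

/-- A gluing of two oriented intervals of the same length. -/
structure Band (Q : Type) where
  /-- the first place of the first interval -/
  fst : Q × ℤ × Bool
  /-- the first place of the second interval -/
  snd : Q × ℤ × Bool
  /-- the length of the intervals -/
  n : ℕ

namespace Band

/-- The pairs of places glued by a band. -/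
def Link (β : Band Q) (t t' : Q × ℤ × Bool) : Prop :=
  ∃ j : ℕ, j < β.n ∧ ((t = adv β.fst j ∧ t' = adv β.snd j) ∨
    (t = zFlip (adv β.fst j) ∧ t' = zFlip (adv β.snd j)))

/-- The intervals of the band lie inside their words. -/
def Valid (len : Q → ℕ) (β : Band Q) : Prop :=
  ∀ j : ℕ, j < β.n → InLen len (adv β.fst j) ∧ InLen len (adv β.snd j)

/-- The intervals of the band carry the same letters. -/
def Cons (lt : Q → ℤ → α × Bool) (β : Band Q) : Prop :=
  ∀ j : ℕ, j < β.n → zLetter lt (adv β.fst j) = zLetter lt (adv β.snd j)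

lemma Link.flip {β : Band Q} {t t' : Q × ℤ × Bool} (h : β.Link t t') :
    β.Link (zFlip t) (zFlip t') := by
  obtain ⟨j, hj, ⟨rfl, rfl⟩ | ⟨rfl, rfl⟩⟩ := h
  · exact ⟨j, hj, .inr ⟨rfl, rfl⟩⟩
  · exact ⟨j, hj, .inl ⟨by simp, by simp⟩⟩

/-- The relation generated by the bands. -/
def Rel (B : κ → Band Q) : Q × ℤ × Bool → Q × ℤ × Bool → Prop :=
  Relation.EqvGen fun t t' => ∃ k, (B k).Link t t'

lemma Rel.flip {B : κ → Band Q} {t t' : Q × ℤ × Bool} (h : Rel B t t') :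
    Rel B (zFlip t) (zFlip t') := by
  induction h with
  | rel _ _ h => exact .rel _ _ (h.imp fun _ => Link.flip)
  | refl => exact .refl _
  | symm _ _ _ ih => exact .symm _ _ ih
  | trans _ _ _ _ _ ih ih' => exact .trans _ _ _ ih ih'

lemma Rel.letter {lt : Q → ℤ → α × Bool} {B : κ → Band Q} (hB : ∀ k, (B k).Cons lt)
    {t t' : Q × ℤ × Bool} (h : Rel B t t') : zLetter lt t = zLetter lt t' := by
  induction h with
  | rel _ _ h =>
    obtain ⟨k, j, hj, ⟨rfl, rfl⟩ | ⟨rfl, rfl⟩⟩ := h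
    · exact hB k j hj
    · rw [zLetter_zFlip, zLetter_zFlip, hB k j hj]
  | refl => rfl
  | symm _ _ _ ih => exact ih.symm
  | trans _ _ _ _ _ ih ih' => exact ih.trans ih'

lemma Rel.map {Q' κ' : Type} {B : κ → Band Q} {B' : κ' → Band Q'}
    {ρ : Q × ℤ × Bool → Q' × ℤ × Bool} (hρ : ∀ t, ρ (zFlip t) = zFlip (ρ t))
    (h : ∀ k, ∀ j : ℕ, j < (B k).n → Rel B' (ρ (adv (B k).fst j)) (ρ (adv (B k).snd j)))
    {t t' : Q × ℤ × Bool} (ht : Rel B t t') : Rel B' (ρ t) (ρ t') := by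
  induction ht with
  | rel _ _ h' =>
    obtain ⟨k, j, hj, ⟨rfl, rfl⟩ | ⟨rfl, rfl⟩⟩ := h'
    · exact h k j hj
    · rw [hρ, hρ]
      exact (h k j hj).flip
  | refl => exact .refl _
  | symm _ _ _ ih => exact .symm _ _ ih
  | trans _ _ _ _ _ ih ih' => exact .trans _ _ _ ih ih'

lemma Rel.of_link {B : κ → Band Q} {k : κ} {j : ℕ} (hj : j < (B k).n) :
    Rel B (adv (B k).fst j) (adv (B k).snd j) := .rel _ _ ⟨k, j, hj, .inl ⟨rfl, rfl⟩⟩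

/-- The band `β` can be replaced by `β'`. -/
structure Sim (lt : Q → ℤ → α × Bool) (len : Q → ℕ) (β β' : Band Q) : Prop where
  n : β'.n = β.n
  valid : β.Valid len → β'.Valid len
  cons : β.Cons lt → β'.Cons lt
  link : ∀ t t', β.Link t t' → β'.Link t t' ∨ β'.Link t' t

lemma Sim.refl (lt : Q → ℤ → α × Bool) (len : Q → ℕ) (β : Band Q) : Sim lt len β β :=
  ⟨rfl, id, id, fun _ _ => .inl⟩

lemma Sim.trans {lt : Q → ℤ → α × Bool} {len : Q → ℕ} {β β' β'' : Band Q} (h : Sim lt len β β')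
    (h' : Sim lt len β' β'') : Sim lt len β β'' where
  n := h'.n.trans h.n
  valid := h'.valid ∘ h.valid
  cons := h'.cons ∘ h.cons
  link t t' ht := by
    rcases h.link t t' ht with h1 | h1
    · exact h'.link _ _ h1
    · exact (h'.link _ _ h1).symm

/-- The band with its two intervals exchanged. -/
def swap (β : Band Q) : Band Q := ⟨β.snd, β.fst, β.n⟩

/-- The band read backwards. -/
def rev (β : Band Q) : Band Q :=
  ⟨zFlip (adv β.fst ((β.n : ℤ) - 1)), zFlip (adv β.snd ((β.n : ℤ) - 1)), β.n⟩

lemma sim_swap (lt : Q → ℤ → α × Bool) (len : Q → ℕ) (β : Band Q) : Sim lt len β β.swap where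
  n := rfl
  valid h j hj := (h j hj).symm
  cons h j hj := (h j hj).symm
  link t t' := by
    rintro ⟨j, hj, h | h⟩
    · exact .inr ⟨j, hj, .inl h.symm⟩
    · exact .inr ⟨j, hj, .inr h.symm⟩

lemma adv_rev {n j : ℕ} (hj : j < n) (t : Q × ℤ × Bool) :
    adv (zFlip (adv t ((n : ℤ) - 1))) j = zFlip (adv t ((n - 1 - j : ℕ) : ℤ)) := by
  rw [adv_zFlip, adv_adv]
  congr 2
  omega

lemma sim_rev (lt : Q → ℤ → α × Bool) (len : Q → ℕ) (β : Band Q) : Sim lt len β β.rev where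
  n := rfl
  valid h j hj := by
    have hj' : j < β.n := hj
    simp only [rev, adv_rev hj']
    exact h _ (by omega)
  cons h j hj := by
    have hj' : j < β.n := hj
    simp only [rev, adv_rev hj', zLetter_zFlip]
    rw [h _ (by omega)]
  link t t' := by
    rintro ⟨j, hj, h⟩
    have hj' : β.n - 1 - j < β.n := by omega
    refine .inl ⟨β.n - 1 - j, hj', ?_⟩
    simp only [rev, adv_rev hj', zFlip_zFlip]
    rw [show β.n - 1 - (β.n - 1 - j) = j by omega]
    exact h.symm

/-- The place is the place `e` of the word `x`. -/
def AtPlace (x : Q) (e : ℤ) (t : Q × ℤ × Bool) : Prop := t.1 = x ∧ t.2.1 = e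

lemma atPlace_zFlip {x : Q} {e : ℤ} {t : Q × ℤ × Bool} : AtPlace x e (zFlip t) ↔ AtPlace x e t :=
  Iff.rfl

/-- One of the intervals of the band contains the place `e` of the word `x`. -/
def Touches (x : Q) (e : ℤ) (β : Band Q) : Prop :=
  ∃ j : ℕ, j < β.n ∧ (AtPlace x e (adv β.fst j) ∨ AtPlace x e (adv β.snd j))

lemma exists_sim {lt : Q → ℤ → α × Bool} {len : Q → ℕ} {x : Q} {e : ℕ} (he : len x = e + 1)
    {β : Band Q} (hv : β.Valid len) (h : β.Touches x e) :
    ∃ τ, Sim lt len β ⟨(x, e, false), τ, β.n⟩ := by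
  have key : ∀ β : Band Q, β.Valid len → (∃ j : ℕ, j < β.n ∧ AtPlace x e (adv β.fst j)) →
      ∃ τ, Sim lt len β ⟨(x, e, false), τ, β.n⟩ := by
    rintro ⟨⟨y, z, b⟩, t', n⟩ hv ⟨j, hj, h1, h2⟩
    dsimp only [adv] at hj h1 h2
    subst h1
    cases b
    · have h3 := (hv 0 (by dsimp only; omega)).1
      simp only [InLen, adv, Bool.false_eq_true, if_false, he] at h3 h2
      have : z = e := by push_cast at *; omega
      subst this
      exact ⟨t', Sim.refl _ _ _⟩
    · have h3 := (hv (n - 1) (by dsimp only; omega)).1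
      simp only [InLen, adv, if_true, he] at h3 h2
      have : z + ((n : ℤ) - 1) = e := by
        have : ((n - 1 : ℕ) : ℤ) = (n : ℤ) - 1 := by omega
        push_cast at *
        omega
      have hs := sim_rev lt len ⟨(y, z, true), t', n⟩
      refine ⟨zFlip (adv t' ((n : ℤ) - 1)), ?_⟩
      rw [← this]
      exact hs
  obtain ⟨j, hj, h | h⟩ := h
  · exact key β hv ⟨j, hj, h⟩
  · have hs := sim_swap lt len β
    obtain ⟨τ, hτ⟩ := key β.swap (hs.valid hv) ⟨j, hj, h⟩
    exact ⟨τ, hs.trans hτ⟩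

lemma snd_eq_of_atPlace {lt : Q → ℤ → α × Bool} {len : Q → ℕ} {x : Q} {e : ℕ}
    (he : len x = e + 1)
    (hred : ∀ z : ℤ, 0 ≤ z → z + 1 ≤ e → lt x (z + 1) ≠ letterInv (lt x z))
    {τ : Q × ℤ × Bool} {n : ℕ} (hv : Valid len ⟨(x, e, false), τ, n⟩)
    (hc : Cons lt ⟨(x, e, false), τ, n⟩) {j : ℕ} (hj : j < n) (h : AtPlace x e (adv τ j)) :
    τ = (x, (e : ℤ), false) := by
  obtain ⟨y, z, b⟩ := τ
  obtain ⟨h1, h2⟩ := h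
  dsimp only [adv] at h1 h2
  subst h1
  cases b
  · have h3 := (hv 0 (by dsimp only; omega)).2
    simp only [InLen, adv, Bool.false_eq_true, if_false, he] at h3 h2
    have : z = e := by push_cast at *; omega
    rw [this]
  · exfalso
    have h3 := hv (n - 1) (by dsimp only; omega)
    simp only [InLen, adv, if_true, Bool.false_eq_true, if_false, he] at h3 h2
    have hn : ((n - 1 : ℕ) : ℤ) = (n : ℤ) - 1 := by omega
    have hj' : (j : ℤ) = n - 1 := by
      push_cast at *
      omega
    have h4 := hc ((n - 1) / 2) (by dsimp only; omega)
    simp only [zLetter, orient, adv, if_true, Bool.false_eq_true, if_false] at h4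
    rcases Nat.even_or_odd' (n - 1) with ⟨m, hm | hm⟩
    · rw [hm, show 2 * m / 2 = m by omega, show (z + m : ℤ) = e - m by omega] at h4
      exact letterInv_ne _ h4
    · rw [hm, show (2 * m + 1) / 2 = m by omega] at h4
      have h5 := hred (z + m) (by push_cast at *; omega) (by push_cast at *; omega)
      rw [show (z + m + 1 : ℤ) = e - m by omega, ← h4, letterInv_letterInv] at h5
      exact h5 rfl

end Band

end Bands

section Elimination

variable {Q α κ : Type}

lemma InLen.update [DecidableEq Q] {len : Q → ℕ} {x : Q} {e : ℕ} (he : len x = e + 1)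
    {t : Q × ℤ × Bool} (h : InLen len t) (h' : ¬ Band.AtPlace x e t) :
    InLen (Function.update len x e) t := by
  obtain ⟨h1, h2⟩ := h
  refine ⟨h1, ?_⟩
  by_cases hx : t.1 = x
  · rw [hx, Function.update_self]
    rw [hx, he] at h2
    have : t.2.1 ≠ e := fun h => h' ⟨hx, h⟩
    push_cast at *
    omega
  · rwa [Function.update_of_ne hx]

namespace Band

lemma not_atPlace_of_inLen [DecidableEq Q] {len : Q → ℕ} {x : Q} {e : ℕ} {t : Q × ℤ × Bool}
    (h : InLen (Function.update len x e) t) : ¬ AtPlace x e t := by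
  rintro ⟨h1, h2⟩
  have := h.2
  rw [h1, Function.update_self] at this
  omega

/-- The last place of a word can be removed without losing any gluing of the other places. -/
theorem exists_update [DecidableEq Q] [Finite κ] {lt : Q → ℤ → α × Bool} {len : Q → ℕ}
    {x : Q} {e : ℕ} (he : len x = e + 1)
    (hred : ∀ z : ℤ, 0 ≤ z → z + 1 ≤ e → lt x (z + 1) ≠ letterInv (lt x z)) (B : κ → Band Q)
    (hv : ∀ k, (B k).Valid len) (hc : ∀ k, (B k).Cons lt) :
    ∃ B' : κ → Band Q, (∀ k, (B' k).Valid (Function.update len x e)) ∧ (∀ k, (B' k).Cons lt) ∧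
      ∀ t t', InLen (Function.update len x e) t → InLen (Function.update len x e) t' →
        Rel B t t' → Rel B' t t' := by
  classical
  wlog hn : ∀ k, (B k).Touches x e → (B k).fst = (x, (e : ℤ), false) generalizing B
  · have h1 : ∀ k, ∃ β, Sim lt len (B k) β ∧ (β.Touches x e → β.fst = (x, (e : ℤ), false)) := by
      intro k
      by_cases hk : (B k).Touches x e
      · obtain ⟨τ, hτ⟩ := exists_sim (lt := lt) he (hv k) hk
        exact ⟨_, hτ, fun _ => rfl⟩
      · exact ⟨_, Sim.refl _ _ _, fun h => absurd h hk⟩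
    choose B₁ hB₁ hB₁' using h1
    obtain ⟨B', h2, h3, h4⟩ := this B₁ (fun k => (hB₁ k).valid (hv k))
      (fun k => (hB₁ k).cons (hc k)) hB₁'
    refine ⟨B', h2, h3, fun t t' ht ht' h => h4 t t' ht ht' ?_⟩
    clear ht ht'
    induction h with
    | rel _ _ h =>
      obtain ⟨k, h⟩ := h
      rcases (hB₁ k).link _ _ h with h | h
      · exact .rel _ _ ⟨k, h⟩
      · exact .symm _ _ (.rel _ _ ⟨k, h⟩)
    | refl => exact .refl _
    | symm _ _ _ ih => exact .symm _ _ ih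
    | trans _ _ _ _ _ ih ih' => exact .trans _ _ _ ih ih'
  have hid : ∀ k, (B k).Touches x e → ∀ j : ℕ, j < (B k).n → AtPlace x e (adv (B k).snd j) →
      (B k).snd = (x, (e : ℤ), false) := by
    intro k hk j hj h
    have hv' := hv k
    have hc' := hc k
    have hf := hn k hk
    rcases hB : B k with ⟨f, τ, n⟩
    rw [hB] at hv' hc' hf hj h
    dsimp only at hf hj h ⊢
    subst hf
    exact snd_eq_of_atPlace he hred hv' hc' hj h
  have hfst : ∀ k, ∀ j : ℕ, j < (B k).n → (B k).fst = (x, (e : ℤ), false) →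
      AtPlace x e (adv (B k).fst j) → j = 0 := by
    rintro k j hj h1 ⟨-, h2⟩
    rw [h1] at h2
    simp only [adv, Bool.false_eq_true, if_false] at h2
    omega
  by_cases hcar : ∃ k, (B k).Touches x e ∧ (B k).snd ≠ (x, (e : ℤ), false)
  swap
  · push Not at hcar
    refine ⟨fun k => if (B k).Touches x e then ⟨(B k).fst, (B k).snd, 0⟩ else B k, ?_, ?_, ?_⟩
    · intro k
      dsimp only
      by_cases hk : (B k).Touches x e
      · rw [if_pos hk]
        intro j hj
        exact absurd hj (Nat.not_lt_zero _)
      · rw [if_neg hk]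
        intro j hj
        have h := hv k j hj
        exact ⟨h.1.update he fun h' => hk ⟨j, hj, .inl h'⟩,
          h.2.update he fun h' => hk ⟨j, hj, .inr h'⟩⟩
    · intro k
      dsimp only
      by_cases hk : (B k).Touches x e
      · rw [if_pos hk]
        intro j hj
        exact absurd hj (Nat.not_lt_zero _)
      · rw [if_neg hk]
        exact hc k
    · intro t t' _ _ h
      refine Rel.map (ρ := id) (fun _ => rfl) ?_ h
      intro k j hj
      by_cases hk : (B k).Touches x e
      · rw [hn k hk, hcar k hk]
        exact .refl _
      · refine .rel _ _ ⟨k, ?_⟩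
        dsimp only
        rw [if_neg hk]
        exact ⟨j, hj, .inl ⟨rfl, rfl⟩⟩
  obtain ⟨k₀, ⟨hk₀, hk₀'⟩, hmax⟩ : ∃ k, ((B k).Touches x e ∧ (B k).snd ≠ (x, (e : ℤ), false)) ∧
      ∀ k', (B k').Touches x e → (B k').snd ≠ (x, (e : ℤ), false) → (B k').n ≤ (B k).n := by
    obtain ⟨k, hk, h⟩ := Set.exists_max_image
      {k | (B k).Touches x e ∧ (B k).snd ≠ (x, (e : ℤ), false)} (fun k => (B k).n)
      (Set.toFinite _) hcar
    exact ⟨k, hk, fun k' h1 h2 => h k' ⟨h1, h2⟩⟩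
  set τ := (B k₀).snd with hτ
  have hpos : ∀ k, (B k).Touches x e → 0 < (B k).n := fun k ⟨j, hj, _⟩ => by omega
  let B' : κ → Band Q := fun k => if (B k).Touches x e then
    if (B k).snd = (x, (e : ℤ), false) then ⟨(B k).fst, (B k).snd, 0⟩ else
    if k = k₀ then ⟨adv (B k).fst 1, adv τ 1, (B k).n - 1⟩ else ⟨τ, (B k).snd, (B k).n⟩
    else B k
  have hB1 : ∀ k, ¬ (B k).Touches x e → B' k = B k := fun k h => if_neg h
  have hB2 : ∀ k, (B k).Touches x e → (B k).snd = (x, (e : ℤ), false) →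
      B' k = ⟨(B k).fst, (B k).snd, 0⟩ := fun k h h' => by simp only [B', if_pos h, if_pos h']
  have hB3 : ∀ k, (B k).Touches x e → (B k).snd ≠ (x, (e : ℤ), false) → k ≠ k₀ →
      B' k = ⟨τ, (B k).snd, (B k).n⟩ := fun k h h' h'' => by
    simp only [B', if_pos h, if_neg h', if_neg h'']
  have hB4 : B' k₀ = ⟨adv (B k₀).fst 1, adv τ 1, (B k₀).n - 1⟩ := by
    simp only [B', if_pos hk₀, ← hτ, if_neg hk₀', if_true]
  have hcast : ∀ j : ℕ, (1 : ℤ) + j = ((j + 1 : ℕ) : ℤ) := fun j => by push_cast; ring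
  refine ⟨B', ?_, ?_, ?_⟩
  · intro k j hj
    by_cases hk : (B k).Touches x e
    · by_cases hk' : (B k).snd = (x, (e : ℤ), false)
      · rw [hB2 k hk hk'] at hj
        exact absurd hj (Nat.not_lt_zero _)
      · by_cases hkk : k = k₀
        · subst hkk
          rw [hB4] at hj ⊢
          dsimp only at hj ⊢
          rw [adv_adv, adv_adv, hcast]
          have h := hv k (j + 1) (by omega)
          refine ⟨h.1.update he fun h' => ?_, h.2.update he fun h' => ?_⟩
          · have := hfst k (j + 1) (by omega) (hn k hk) h'
            omega
          · exact hk' (hid k hk _ (by omega) h')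
        · rw [hB3 k hk hk' hkk] at hj ⊢
          dsimp only at hj ⊢
          have hj' : j < (B k₀).n := lt_of_lt_of_le hj (hmax k hk hk')
          exact ⟨(hv k₀ j hj').2.update he fun h' => hk₀' (hid k₀ hk₀ _ hj' h'),
            (hv k j hj).2.update he fun h' => hk' (hid k hk _ hj h')⟩
    · rw [hB1 k hk] at hj ⊢
      have h := hv k j hj
      exact ⟨h.1.update he fun h' => hk ⟨j, hj, .inl h'⟩,
        h.2.update he fun h' => hk ⟨j, hj, .inr h'⟩⟩
  · intro k j hj
    by_cases hk : (B k).Touches x e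
    · by_cases hk' : (B k).snd = (x, (e : ℤ), false)
      · rw [hB2 k hk hk'] at hj
        exact absurd hj (Nat.not_lt_zero _)
      · by_cases hkk : k = k₀
        · subst hkk
          rw [hB4] at hj ⊢
          dsimp only at hj ⊢
          rw [adv_adv, adv_adv, hcast]
          exact hc k (j + 1) (by omega)
        · rw [hB3 k hk hk' hkk] at hj ⊢
          dsimp only at hj ⊢
          have hj' : j < (B k₀).n := lt_of_lt_of_le hj (hmax k hk hk')
          rw [← hc k j hj, ← hc k₀ j hj', hn k hk, hn k₀ hk₀]
    · rw [hB1 k hk] at hj ⊢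
      exact hc k j hj
  · let ρ : Q × ℤ × Bool → Q × ℤ × Bool := fun t =>
      if AtPlace x e t then if t.2.2 then zFlip τ else τ else t
    have hρ : ∀ t, ¬ AtPlace x e t → ρ t = t := fun t h => if_neg h
    have hρe : ρ (x, (e : ℤ), false) = τ := by simp [ρ, AtPlace]
    have hcarr : ∀ j : ℕ, 0 < j → j < (B k₀).n →
        Rel B' (adv (x, (e : ℤ), false) j) (adv τ j) := by
      intro j hj hj'
      have h := Rel.of_link (B := B') (k := k₀) (j := j - 1) (by rw [hB4]; dsimp only; omega)
      rw [hB4] at h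
      dsimp only at h
      rwa [adv_adv, adv_adv, hcast, show j - 1 + 1 = j by omega, hn k₀ hk₀] at h
    intro t t' ht ht' h
    rw [← hρ t (not_atPlace_of_inLen ht), ← hρ t' (not_atPlace_of_inLen ht')]
    refine Rel.map ?_ ?_ h
    · intro t
      by_cases h : AtPlace x e t
      · simp only [ρ, if_pos h, if_pos (atPlace_zFlip.2 h)]
        obtain ⟨x', z', b⟩ := t
        cases b <;> simp [zFlip]
      · rw [hρ t h, hρ _ (mt atPlace_zFlip.1 h)]
    · intro k j hj
      by_cases hk : (B k).Touches x e
      · by_cases hk' : (B k).snd = (x, (e : ℤ), false)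
        · rw [hn k hk, hk']
          exact .refl _
        · rw [hρ (adv (B k).snd j) fun h' => hk' (hid k hk _ hj h')]
          have hj₀ : j < (B k₀).n := lt_of_lt_of_le hj (hmax k hk hk')
          have h1 : Rel B' (ρ (adv (B k).fst j)) (adv τ j) := by
            rw [hn k hk]
            rcases Nat.eq_zero_or_pos j with rfl | hj0
            · rw [Nat.cast_zero, adv_zero, adv_zero, hρe]
              exact .refl _
            · rw [hρ]
              · exact hcarr j hj0 hj₀
              · intro h'
                rw [← hn k hk] at h'
                have := hfst k j hj (hn k hk) h'
                omega
          refine h1.trans _ _ _ ?_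
          by_cases hkk : k = k₀
          · subst hkk
            exact .refl _
          · have h := Rel.of_link (B := B') (k := k) (j := j) (by rwa [hB3 k hk hk' hkk])
            rwa [hB3 k hk hk' hkk] at h
      · rw [hρ _ fun h' => hk ⟨j, hj, .inl h'⟩, hρ _ fun h' => hk ⟨j, hj, .inr h'⟩]
        have h := Rel.of_link (B := B') (k := k) (j := j) (by rwa [hB1 k hk])
        rwa [hB1 k hk] at h

/-- Words can be removed without losing any gluing of the places of the other words. -/
theorem exists_eliminate [DecidableEq Q] [Finite κ] {lt : Q → ℤ → α × Bool} (E : Finset Q)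
    (len : Q → ℕ) (hred : ∀ x ∈ E, ∀ z : ℤ, 0 ≤ z → z + 1 < len x →
      lt x (z + 1) ≠ letterInv (lt x z)) (B : κ → Band Q)
    (hv : ∀ k, (B k).Valid len) (hc : ∀ k, (B k).Cons lt) :
    ∃ B' : κ → Band Q, (∀ k, (B' k).Valid (fun x => if x ∈ E then 0 else len x)) ∧
      (∀ k, (B' k).Cons lt) ∧ ∀ t t', t.1 ∉ E → t'.1 ∉ E → InLen len t → InLen len t' →
        Rel B t t' → Rel B' t t' := by
  induction hN : ∑ x ∈ E, len x generalizing len B with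
  | zero =>
    rw [Finset.sum_eq_zero_iff] at hN
    refine ⟨B, ?_, hc, fun t t' _ _ _ _ h => h⟩
    convert hv using 3 with k
    split_ifs with h
    · exact (hN _ h).symm
    · rfl
  | succ N ih =>
    obtain ⟨x, hx, hx'⟩ : ∃ x ∈ E, len x ≠ 0 := by
      by_contra! h
      rw [Finset.sum_eq_zero h] at hN
      omega
    obtain ⟨e, he⟩ := Nat.exists_eq_succ_of_ne_zero hx'
    have hle : ∀ y, Function.update len x e y ≤ len y := by
      intro y
      by_cases hy : y = x
      · subst hy
        rw [Function.update_self]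
        omega
      · rw [Function.update_of_ne hy]
    obtain ⟨B₁, h1, h2, h3⟩ := exists_update he
      (fun z h h' => hred x hx z h (by push_cast [he]; omega)) B hv hc
    obtain ⟨B', h4, h5, h6⟩ := ih (Function.update len x e)
      (fun y hy z h h' => hred y hy z h (by have := hle y; omega)) B₁ h1 h2 (by
        rw [Finset.sum_update_of_mem hx]
        rw [← Finset.add_sum_erase _ _ hx, he] at hN
        rw [Finset.sdiff_singleton_eq_erase]
        omega)
    have hup : ∀ t : Q × ℤ × Bool, t.1 ∉ E → InLen len t → InLen (Function.update len x e) t := by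
      rintro t ht h
      exact h.update he fun h' => ht (h'.1 ▸ hx)
    refine ⟨B', ?_, h5, fun t t' ht ht' hl hl' h => ?_⟩
    · convert h4 using 3 with k
      split_ifs with h
      · rfl
      · rw [Function.update_of_ne]
        rintro rfl
        exact h hx
    · exact h6 t t' ht ht' (hup t ht hl) (hup t' ht' hl')
        (h3 t t' (hup t ht hl) (hup t' ht' hl') h)

end Band

end Elimination

section CfgBands

variable {ι α X : Type} [Inhabited α] {s : ι → List (α × Bool)} {wd : X → List (α × Bool)}
  {con : Set X} {L F : ℕ}

/-- A place with integer position. -/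
def intTag {K : Type} (t : K × ℕ × Bool) : K × ℤ × Bool := (t.1, (t.2.1 : ℤ), t.2.2)

/-- The letters of a family of words, with integer positions. -/
def zWord {K : Type} (wd : K → List (α × Bool)) (k : K) (z : ℤ) : α × Bool :=
  (wd k).getD z.toNat default

lemma intTag_tagFlip {K : Type} (t : K × ℕ × Bool) : intTag (tagFlip t) = zFlip (intTag t) := rfl

lemma zLetter_intTag {K : Type} (wd : K → List (α × Bool)) (t : K × ℕ × Bool) :
    zLetter (zWord wd) (intTag t) = tagLetter wd t := by
  simp [zLetter, zWord, intTag, tagLetter]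

lemma intTag_of_tagSucc {K : Type} {t t' : K × ℕ × Bool} (h : TagSucc t t') :
    intTag t' = adv (intTag t) 1 := by
  obtain ⟨k, z, b⟩ := t
  obtain ⟨k', z', b'⟩ := t'
  obtain ⟨h1, h2, h3⟩ := h
  dsimp only at h1 h2 h3
  subst h1 h2
  cases b' <;> simp [intTag, adv] at h3 ⊢ <;> omega

namespace Cfg

variable (C : Cfg s wd con L F)

/-- The side is the first one of a relator. -/
def CellStart (y : C.S) : Prop := (C.tp y).1.isLeft ∧ TagStart (Sum.elim s wd) (C.tp y)

/-- A band breaks before the side. -/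
def Cut (y : C.S) : Prop := C.Brk y ∨ C.CellStart y ∨ C.CellStart (C.nx (C.al y))

lemma cnt_cut_le (hwd : ∀ x z, z + 1 < (wd x).length →
    (wd x).getD (z + 1) default ≠ letterInv ((wd x).getD z default))
    (hs : ∀ i, CycRed (s i)) : cnt C.Cut ≤ 8 * F + 6 * L := by
  have h1 := C.cnt_brk_le hwd hs
  have h2 : cnt C.CellStart ≤ F := C.card_start_cell
  have h3 : cnt (fun y => C.CellStart (C.nx (C.al y))) ≤ F := by
    refine le_trans (cnt_le_of_injOn (fun y => C.nx (C.al y)) (fun y hy => hy) ?_) h2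
    intro y _ y' _ h
    have h' := congrArg C.al (C.nx.injective h)
    rwa [C.al_al, C.al_al] at h'
  have h4 := cnt_or_le C.CellStart (fun y => C.CellStart (C.nx (C.al y)))
  have h5 := cnt_or_le C.Brk (fun y => C.CellStart y ∨ C.CellStart (C.nx (C.al y)))
  have h6 : cnt C.Cut = cnt (fun y => C.Brk y ∨ C.CellStart y ∨ C.CellStart (C.nx (C.al y))) := rfl
  omega

variable {C} in
lemma not_tagStart {y : C.S} (h1 : ¬ C.BdStart y) (h2 : ¬ C.CellStart y) :
    ¬ TagStart (Sum.elim s wd) (C.tp y) := by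
  intro h
  cases hk : (C.tp y).1
  · exact h2 ⟨by simp [hk], h⟩
  · exact h1 ⟨by simp [hk], h⟩

variable {C} in
lemma adv_of_not_cut {y : C.S} (h : ¬ C.Cut (C.nx y)) :
    intTag (C.tp (C.nx y)) = adv (intTag (C.tp y)) 1 ∧
      intTag (tagFlip (C.tp (C.al (C.nx y)))) = adv (intTag (tagFlip (C.tp (C.al y)))) 1 := by
  simp only [Cut, Brk, not_or, not_not] at h
  obtain ⟨⟨h1, h2, h3⟩, h4, h5⟩ := h
  rw [Equiv.symm_apply_apply] at h1
  rw [h1] at h3 h5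
  refine ⟨intTag_of_tagSucc ((C.next y).resolve_left (not_tagStart h2 h4)), ?_⟩
  have h6 := C.next (C.al (C.nx y))
  rw [h1] at h6
  rw [intTag_tagFlip, intTag_tagFlip, intTag_of_tagSucc (h6.resolve_left (not_tagStart h3 h5)),
    adv_zFlip, adv_adv]
  simp

variable {C} in
lemma adv_pow {y : C.S} (j : ℕ) (h : ∀ i, 0 < i → i ≤ j → ¬ C.Cut ((C.nx ^ i) y)) :
    intTag (C.tp ((C.nx ^ j) y)) = adv (intTag (C.tp y)) j ∧
      intTag (tagFlip (C.tp (C.al ((C.nx ^ j) y)))) = adv (intTag (tagFlip (C.tp (C.al y)))) j := by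
  induction j with
  | zero => simp
  | succ j ih =>
    obtain ⟨h1, h2⟩ := ih fun i hi hij => h i hi (by omega)
    have h3 := h (j + 1) (by omega) le_rfl
    rw [pow_succ', Equiv.Perm.mul_apply] at h3 ⊢
    obtain ⟨h4, h5⟩ := adv_of_not_cut h3
    rw [h4, h5, h1, h2, adv_adv, adv_adv]
    push_cast
    exact ⟨rfl, rfl⟩

lemma exists_cut (y : C.S) : ∃ e : ℕ, C.Cut ((C.nx⁻¹ ^ e) y) := by
  by_contra! h
  have hall : ∀ i : ℕ, ¬ C.Cut ((C.nx ^ i) y) := by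
    intro i
    obtain ⟨N, hN, hN'⟩ := (isOfFinOrder_of_finite C.nx).exists_pow_eq_one
    have h1 := h (N * i - i)
    have h2 : C.nx⁻¹ ^ (N * i - i) = C.nx ^ i := by
      rw [inv_pow, inv_eq_iff_mul_eq_one, ← pow_add, Nat.sub_add_cancel (by nlinarith), pow_mul,
        hN', one_pow]
    rwa [h2] at h1
  obtain ⟨N, hN, hN'⟩ := (isOfFinOrder_of_finite C.nx).exists_pow_eq_one
  have h1 := (adv_pow N fun i _ _ => hall i).1
  rw [hN', Equiv.Perm.one_apply] at h1
  have h2 := congrArg (fun t => t.2.1) h1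
  simp only [adv] at h2
  split_ifs at h2 <;> omega

lemma exists_cut_pos (y : C.S) (hy : C.Cut y) : ∃ i, 0 < i ∧ C.Cut ((C.nx ^ i) y) := by
  obtain ⟨N, hN, hN'⟩ := (isOfFinOrder_of_finite C.nx).exists_pow_eq_one
  exact ⟨N, hN, by rwa [hN']⟩

lemma exists_first (y : C.S) : ∃ y₀, C.Cut y₀ ∧ ∃ j : ℕ, (C.nx ^ j) y₀ = y ∧
    ∀ i, 0 < i → i ≤ j → ¬ C.Cut ((C.nx ^ i) y₀) := by
  classical
  have key : ∀ i e, i ≤ e → (C.nx ^ i) ((C.nx⁻¹ ^ e) y) = (C.nx⁻¹ ^ (e - i)) y := by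
    intro i e h
    obtain ⟨d, rfl⟩ := Nat.exists_eq_add_of_le h
    rw [← Equiv.Perm.mul_apply, pow_add, ← mul_assoc, inv_pow, mul_inv_cancel, one_mul,
      Nat.add_sub_cancel_left]
  refine ⟨_, Nat.find_spec (C.exists_cut y), Nat.find (C.exists_cut y), ?_, fun i hi hij => ?_⟩
  · rw [key _ _ le_rfl, Nat.sub_self, pow_zero, Equiv.Perm.one_apply]
  · rw [key _ _ hij]
    exact Nat.find_min (C.exists_cut y) (by omega)

/-- The gluing of a diagram is made of few bands. -/
theorem exists_bands (hwd : ∀ x z, z + 1 < (wd x).length →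
    (wd x).getD (z + 1) default ≠ letterInv ((wd x).getD z default))
    (hs : ∀ i, CycRed (s i)) :
    ∃ (κ : Type) (_ : Fintype κ) (B : κ → Band (ι ⊕ X)), Fintype.card κ ≤ 8 * F + 6 * L ∧
      (∀ k, ∀ j : ℕ, j < (B k).n → (∃ y, adv (B k).fst j = intTag (C.tp y)) ∧
        ∃ y, adv (B k).snd j = intTag (tagFlip (C.tp y))) ∧
      (∀ k, (B k).Cons (zWord (Sum.elim s wd))) ∧
      ∀ t t', Relation.EqvGen C.Link t t' → Band.Rel B (intTag t) (intTag t') := by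
  classical
  have hfirst := C.exists_cut_pos
  let B : {y // C.Cut y} → Band (ι ⊕ X) := fun y =>
    ⟨intTag (C.tp y), intTag (tagFlip (C.tp (C.al y))), Nat.find (hfirst y y.2)⟩
  have hB : ∀ (y : {y // C.Cut y}) (j : ℕ), j < (B y).n →
      adv (B y).fst j = intTag (C.tp ((C.nx ^ j) y)) ∧
      adv (B y).snd j = intTag (tagFlip (C.tp (C.al ((C.nx ^ j) y)))) := by
    intro y j hj
    obtain ⟨h1, h2⟩ := adv_pow (y := y.1) j fun i hi hij hc =>
      Nat.find_min (hfirst y y.2) (lt_of_le_of_lt hij hj) ⟨hi, hc⟩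
    exact ⟨h1.symm, h2.symm⟩
  refine ⟨_, inferInstance, B, ?_, ?_, ?_, ?_⟩
  · rw [Fintype.card_subtype, ← cnt_eq_card]
    exact C.cnt_cut_le hwd hs
  · intro y j hj
    obtain ⟨h1, h2⟩ := hB y j hj
    exact ⟨⟨_, h1⟩, ⟨_, h2⟩⟩
  · intro y j hj
    obtain ⟨h1, h2⟩ := hB y j hj
    rw [h1, h2, zLetter_intTag, zLetter_intTag, tagLetter_tagFlip, C.lab_al, letterInv_letterInv]
  · intro t t' h
    induction h with
    | rel t t' h =>
      obtain ⟨y, rfl, rfl⟩ := h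
      obtain ⟨y₀, hy₀, j, rfl, hj⟩ := C.exists_first y
      have hj' : j < (B ⟨y₀, hy₀⟩).n := by
        by_contra hlt
        obtain ⟨h1, h2⟩ := Nat.find_spec (hfirst y₀ hy₀)
        exact hj _ h1 (not_lt.1 hlt) h2
      have h := Band.Rel.of_link (B := B) hj'
      obtain ⟨h1, h2⟩ := hB ⟨y₀, hy₀⟩ j hj'
      rwa [h1, h2] at h
    | refl => exact .refl _
    | symm _ _ _ ih => exact .symm _ _ ih
    | trans _ _ _ _ _ ih ih' => exact .trans _ _ _ ih ih'

end Cfg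

end CfgBands

section Determined

variable {ι α X Y : Type} [Inhabited α]

/-- The place `p` of one of the `m` words of length `ℓ` is related to another place. -/
def Determined {m ℓ : ℕ} (lk : (Fin m ⊕ Y) × ℤ × Bool → (Fin m ⊕ Y) × ℤ × Bool → Prop)
    (p : Fin m × Fin ℓ) : Prop :=
  ∃ t, Relation.EqvGen lk (.inl p.1, ((p.2 : ℕ) : ℤ), true) t ∧
    ((∃ q : Fin m × Fin ℓ, q ≠ p ∧ t.1 = .inl q.1 ∧ t.2.1 = ((q.2 : ℕ) : ℤ)) ∨
      ∃ y, t.1 = .inr y)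

namespace Cfg

variable {s : ι → List (α × Bool)} {wd : X ⊕ Y → List (α × Bool)} {L F : ℕ}
  (C : Cfg s wd (Set.range .inr) L F)

/-- The relator or letter occurs in the diagrams. -/
def Used (k : ι ⊕ X ⊕ Y) : Prop := ∃ y, (C.tp y).1 = k

lemma used_iff_of_eqvGen {t t' : (ι ⊕ X ⊕ Y) × ℕ × Bool} (h : Relation.EqvGen C.Link t t') :
    C.Used t.1 ↔ C.Used t'.1 := by
  induction h with
  | rel _ _ h =>
    obtain ⟨y, rfl, rfl⟩ := h
    exact iff_of_true ⟨y, rfl⟩ ⟨C.al y, rfl⟩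
  | refl => rfl
  | symm _ _ _ ih => exact ih.symm
  | trans _ _ _ _ _ ih ih' => exact ih.trans ih'

lemma exists_tp_of_used {i : ι} (h : C.Used (.inl i)) :
    ∃ b, ∀ z < (s i).length, ∃ y, C.tp y = (.inl i, z, b) := by
  obtain ⟨y, hy⟩ := h
  obtain ⟨p, hp⟩ := C.exists_of_isCell (y := y) (by simp [IsCell, hy])
  obtain ⟨⟨i', z₀⟩, b⟩ := p
  obtain rfl : i' = i := by
    rw [← hp] at hy
    exact Sum.inl.inj hy
  have hpow : ∀ j : ℕ, relTag (X ⊕ Y) ((relShift s ^ j) (⟨i', z₀⟩, b)) = C.tp ((C.nx ^ j) y) := by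
    intro j
    induction j with
    | zero => exact hp
    | succ j ih =>
      rw [pow_succ', pow_succ', Equiv.Perm.mul_apply, Equiv.Perm.mul_apply]
      exact C.relTag_relShift_eq ih
  refine ⟨b, fun z hz => ?_⟩
  have hz₀ := z₀.2
  cases b
  · by_cases h : z ≤ z₀
    · refine ⟨(C.nx ^ ((z₀ : ℕ) - z)) y, ?_⟩
      rw [← hpow, relTag_relShift_pow _ _ (by dsimp only; omega)]
      simp only [Bool.false_eq_true, if_false, Prod.mk.injEq, true_and, and_true]
      rw [show (z₀ : ℕ) + ((s i').length - (z₀ - z)) = z + (s i').length by omega,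
        Nat.add_mod_right, Nat.mod_eq_of_lt hz]
    · refine ⟨(C.nx ^ ((z₀ : ℕ) + (s i').length - z)) y, ?_⟩
      rw [← hpow, relTag_relShift_pow _ _ (by dsimp only; omega)]
      simp only [Bool.false_eq_true, if_false, Prod.mk.injEq, true_and, and_true]
      rw [show (z₀ : ℕ) + ((s i').length - (z₀ + (s i').length - z)) = z by omega,
        Nat.mod_eq_of_lt hz]
  · by_cases h : z₀ ≤ z
    · refine ⟨(C.nx ^ (z - (z₀ : ℕ))) y, ?_⟩
      rw [← hpow, relTag_relShift_pow _ _ (by dsimp only; omega)]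
      simp only [if_true, Prod.mk.injEq, true_and, and_true]
      rw [show (z₀ : ℕ) + (z - z₀) = z by omega, Nat.mod_eq_of_lt hz]
    · refine ⟨(C.nx ^ (z + (s i').length - (z₀ : ℕ))) y, ?_⟩
      rw [← hpow, relTag_relShift_pow _ _ (by dsimp only; omega)]
      simp only [if_true, Prod.mk.injEq, true_and, and_true]
      rw [show (z₀ : ℕ) + (z + (s i').length - z₀) = z + (s i').length by omega,
        Nat.add_mod_right, Nat.mod_eq_of_lt hz]

lemma card_used_le [Fintype ι] [DecidablePred fun i => C.Used (.inl i)] :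
    (Finset.univ.filter fun i => C.Used (.inl i)).card ≤ F := by
  classical
  refine le_trans ?_ C.card_start_cell
  rw [cnt_eq_card]
  have h : ∀ i : ι, C.Used (.inl i) → ∃ y, (C.tp y).1 = .inl i ∧
      TagStart (Sum.elim s wd) (C.tp y) := by
    intro i hi
    obtain ⟨b, hb⟩ := C.exists_tp_of_used hi
    obtain ⟨y, hy⟩ := hi
    have hlt := C.tp_lt y
    rw [hy] at hlt
    simp only [Sum.elim_inl] at hlt
    obtain ⟨y', hy'⟩ := hb (if b then 0 else (s i).length - 1) (by split_ifs <;> omega)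
    refine ⟨y', by rw [hy'], ?_⟩
    rw [hy']
    cases b <;> simp [TagStart]
    omega
  rcases isEmpty_or_nonempty C.S with hS | hS
  · rw [Finset.filter_false_of_mem fun i _ ⟨y, _⟩ => hS.elim y]
    exact Nat.zero_le _
  choose! f hf hf' using h
  refine Finset.card_le_card_of_injOn f ?_ ?_
  · intro i hi
    simp only [Finset.coe_filter, Finset.mem_univ, true_and, Set.mem_ofPred_eq] at hi ⊢
    exact ⟨by rw [hf i hi]; rfl, hf' i hi⟩
  · intro i hi i' hi' h
    simp only [Finset.coe_filter, Finset.mem_univ, true_and, Set.mem_ofPred_eq] at hi hi'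
    have h1 := hf i hi
    rw [h, hf i' hi'] at h1
    exact (Sum.inl.inj h1).symm

end Cfg

end Determined

section BandFamily

variable {ι α X Y : Type} [Inhabited α]

namespace Band

variable {κ Q : Type}

lemma Rel.mono {κ' : Type} {B : κ → Band Q} {B' : κ' → Band Q}
    (h : ∀ k j, j < (B k).n → ∃ k', (B' k') = B k) {t t' : Q × ℤ × Bool} (ht : Rel B t t') :
    Rel B' t t' := by
  refine Rel.map (ρ := id) (fun _ => rfl) (fun k j hj => ?_) ht
  obtain ⟨k', hk'⟩ := h k j hj
  have := Rel.of_link (B := B') (k := k') (j := j) (by rwa [hk'])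
  rwa [hk'] at this

end Band

/-- A diagram yields few bands which determine most of the letters of the relators. -/
theorem Cfg.exists_band_family [Fintype ι] [Fintype X] {s : ι → List (α × Bool)}
    {wd : X ⊕ Y → List (α × Bool)} {L F M ℓ : ℕ} (C : Cfg s wd (Set.range .inr) L F) (hF : 0 < F)
    (hFL : F ≤ 6 * L) (hM : 1 ≤ M) (hlen : ∀ i, M ≤ (s i).length) (hs : ∀ i, CycRed (s i))
    (hwd : ∀ x z, z + 1 < (wd x).length →
      (wd x).getD (z + 1) default ≠ letterInv ((wd x).getD z default))
    (W : ι → List (α × Bool)) (o : ι → ℕ) (hW : ∀ i, ∀ z < (s i).length, z + o i < ℓ ∧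
      (W i).getD (z + o i) default = (s i).getD z default) :
    ∃ m, 0 < m ∧ m ≤ 6 * L ∧ ∃ f : Fin m → ι, f.Injective ∧
      ∃ B : Fin (54 * L) → Band (Fin m ⊕ Y),
        (∀ k, (B k).Valid (Sum.elim (fun _ => ℓ) fun y => (wd (.inr y)).length)) ∧
        (∀ k, (B k).Cons (zWord (Sum.elim (W ∘ f) (wd ∘ .inr)))) ∧
        m * M ≤ cnt (Determined (ℓ := ℓ) fun t t' => ∃ k, (B k).Link t t') := by
  classical
  set I := Finset.univ.filter fun i => C.Used (.inl i) with hI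
  have hIm : ∀ i, i ∈ I ↔ C.Used (.inl i) := fun i => by simp [hI]
  have hcard : I.card ≤ F := C.card_used_le
  obtain ⟨i₀, hi₀⟩ : I.Nonempty := by
    have h := C.card_cell M hlen
    by_contra hne
    rw [Finset.not_nonempty_iff_eq_empty] at hne
    rw [cnt_false] at h
    · rcases Nat.mul_eq_zero.1 (Nat.le_zero.1 h) with h | h <;> omega
    · intro y hy
      obtain ⟨i, hi⟩ := Sum.isLeft_iff.1 hy
      have : i ∈ I := (hIm i).2 ⟨y, hi⟩
      simp [hne] at this
  let e := I.equivFin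
  have hm : 0 < I.card := Finset.card_pos.2 ⟨i₀, hi₀⟩
  let φ : ι ⊕ X ⊕ Y → Fin I.card ⊕ Y := Sum.elim
    (fun i => .inl (if h : i ∈ I then e ⟨i, h⟩ else ⟨0, hm⟩)) (Sum.elim (fun _ => .inl ⟨0, hm⟩) .inr)
  let off : ι ⊕ X ⊕ Y → ℕ := Sum.elim o fun _ => 0
  let Φ : (ι ⊕ X ⊕ Y) × ℤ × Bool → (Fin I.card ⊕ Y) × ℤ × Bool :=
    fun t => (φ t.1, t.2.1 + off t.1, t.2.2)
  have hΦflip : ∀ t, Φ (zFlip t) = zFlip (Φ t) := fun t => rfl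
  have hΦadv : ∀ t j, Φ (adv t j) = adv (Φ t) j := by
    rintro ⟨k, z, b⟩ j
    cases b <;> simp only [Φ, adv, Bool.false_eq_true, if_true, if_false] <;> congr 2 <;> ring
  let len : ι ⊕ X ⊕ Y → ℕ := fun k => if C.Used k then (Sum.elim s wd k).length else 0
  have hlen_tp : ∀ y, InLen len (intTag (C.tp y)) := by
    intro y
    refine ⟨Int.natCast_nonneg _, ?_⟩
    have h : C.Used (C.tp y).1 := ⟨y, rfl⟩
    simp only [intTag, len, if_pos h]
    exact_mod_cast C.tp_lt y
  let E : Finset (ι ⊕ X ⊕ Y) := Finset.univ.map ⟨fun x : X => .inr (.inl x), fun x x' h => by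
    simpa using h⟩
  have hE : ∀ k, k ∈ E ↔ ∃ x, k = .inr (.inl x) := by
    intro k
    simp only [E, Finset.mem_map, Finset.mem_univ, true_and]
    exact ⟨fun ⟨x, h⟩ => ⟨x, h.symm⟩, fun ⟨x, h⟩ => ⟨x, h.symm⟩⟩
  obtain ⟨κ, _, B₀, hκ, hv₀, hc₀, hR₀⟩ := C.exists_bands hwd hs
  obtain ⟨B₁, hv₁, hc₁, hR₁⟩ := Band.exists_eliminate (lt := zWord (Sum.elim s wd)) E len (by
    intro k hk z hz hz'
    obtain ⟨x, rfl⟩ := (hE k).1 hk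
    obtain ⟨z, rfl⟩ := Int.eq_ofNat_of_zero_le hz
    simp only [len] at hz'
    split_ifs at hz' with hu
    · refine hwd (.inl x) z ?_
      simp only [Sum.elim_inr] at hz'
      exact_mod_cast hz'
    · push_cast at hz'
      omega) B₀ (fun k j hj => by
        obtain ⟨⟨y, h1⟩, ⟨y', h2⟩⟩ := hv₀ k j hj
        rw [h1, h2]
        exact ⟨hlen_tp y, hlen_tp y'⟩) hc₀
  set W' : Fin I.card ⊕ Y → List (α × Bool) := Sum.elim (W ∘ fun i => (e.symm i : ι)) (wd ∘ .inr)
    with hW'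
  have hΦ : ∀ t, InLen (fun k => if k ∈ E then 0 else len k) t →
      InLen (Sum.elim (fun _ => ℓ) fun y => (wd (.inr y)).length) (Φ t) ∧
        zLetter (zWord W') (Φ t) = zLetter (zWord (Sum.elim s wd)) t := by
    rintro ⟨k, z, b⟩ ⟨hz, hz'⟩
    obtain ⟨z, rfl⟩ := Int.eq_ofNat_of_zero_le hz
    dsimp only at hz'
    split_ifs at hz' with h1
    · push_cast at hz'
      omega
    simp only [len] at hz'
    split_ifs at hz' with h2
    swap
    · push_cast at hz'
      omega
    have hz'' : z < (Sum.elim s wd k).length := by exact_mod_cast hz'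
    rcases k with i | x | y
    · have hiI : i ∈ I := (hIm i).2 h2
      obtain ⟨h3, h4⟩ := hW i z hz''
      refine ⟨⟨?_, ?_⟩, ?_⟩
      · simp only [Φ]
        positivity
      · simp only [Φ, φ, off, Sum.elim_inl]
        exact_mod_cast h3
      · have : ((z : ℤ) + (o i : ℤ)).toNat = z + o i := by omega
        simp only [zLetter, zWord, Φ, φ, off, Sum.elim_inl, hW', dif_pos hiI, Function.comp_apply,
          Equiv.symm_apply_apply, this, h4, Int.toNat_natCast]
    · exact absurd ((hE _).2 ⟨x, rfl⟩) h1
    · refine ⟨⟨?_, ?_⟩, ?_⟩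
      · simp only [Φ]
        positivity
      · simp only [Φ, φ, off, Sum.elim_inr]
        simpa using hz''
      · simp [zLetter, zWord, Φ, φ, off, hW']
  let B₂ : κ → Band (Fin I.card ⊕ Y) := fun k => ⟨Φ (B₁ k).fst, Φ (B₁ k).snd, (B₁ k).n⟩
  have hB₂ : ∀ k j, adv (B₂ k).fst j = Φ (adv (B₁ k).fst j) ∧
      adv (B₂ k).snd j = Φ (adv (B₁ k).snd j) := fun k j => ⟨(hΦadv _ _).symm, (hΦadv _ _).symm⟩
  have hR₂ : ∀ t t', Band.Rel B₁ t t' → Band.Rel B₂ (Φ t) (Φ t') := by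
    intro t t' h
    refine Band.Rel.map hΦflip (fun k j hj => ?_) h
    rw [← (hB₂ k j).1, ← (hB₂ k j).2]
    exact Band.Rel.of_link (B := B₂) hj
  let g := Fintype.equivFin κ
  let B₃ : Fin (54 * L) → Band (Fin I.card ⊕ Y) := fun k =>
    if h : (k : ℕ) < Fintype.card κ then B₂ (g.symm ⟨k, h⟩) else
      ⟨(.inl ⟨0, hm⟩, 0, true), (.inl ⟨0, hm⟩, 0, true), 0⟩
  have hB₃ : ∀ k j, j < (B₃ k).n → ∃ k', B₃ k = B₂ k' := by
    intro k j hj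
    by_cases h : (k : ℕ) < Fintype.card κ
    · exact ⟨_, dif_pos h⟩
    · simp only [B₃, dif_neg h] at hj
      omega
  have hR₃ : ∀ t t', Band.Rel B₂ t t' → Band.Rel B₃ t t' := by
    intro t t' h
    have hg : ∀ k, (g k : ℕ) < 54 * L := fun k => lt_of_lt_of_le (g k).2 (by omega)
    refine Band.Rel.mono (fun k j _ => ⟨⟨g k, hg k⟩, ?_⟩) h
    simp only [B₃, dif_pos (g k).2, Fin.eta, Equiv.symm_apply_apply]
  have hvB : ∀ k, (B₃ k).Valid (Sum.elim (fun _ => ℓ) fun y => (wd (.inr y)).length) := by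
    intro k j hj
    obtain ⟨k', hk'⟩ := hB₃ k j hj
    rw [hk'] at hj ⊢
    rw [(hB₂ k' j).1, (hB₂ k' j).2]
    obtain ⟨h1, h2⟩ := hv₁ k' j hj
    exact ⟨(hΦ _ h1).1, (hΦ _ h2).1⟩
  have hcB : ∀ k, (B₃ k).Cons (zWord W') := by
    intro k j hj
    obtain ⟨k', hk'⟩ := hB₃ k j hj
    rw [hk'] at hj ⊢
    rw [(hB₂ k' j).1, (hB₂ k' j).2]
    obtain ⟨h1, h2⟩ := hv₁ k' j hj
    rw [(hΦ _ h1).2, (hΦ _ h2).2]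
    exact hc₁ k' j hj
  refine ⟨I.card, hm, hcard.trans hFL, fun i => (e.symm i : ι),
    Subtype.val_injective.comp e.symm.injective, B₃, hvB, hcB, ?_⟩
  have hdet : ∀ i (hi : i ∈ I) (z : Fin (s i).length), Determined (ℓ := ℓ)
      (fun t t' => ∃ k, (B₃ k).Link t t') (e ⟨i, hi⟩, ⟨z + o i, (hW i z z.2).1⟩) := by
    intro i hi z
    have hu := (hIm i).1 hi
    obtain ⟨b, hb⟩ := C.exists_tp_of_used hu
    obtain ⟨y, hy⟩ := hb z z.2
    obtain ⟨t, h1, h2, h3⟩ := C.exists_linked hy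
    have htu : C.Used t.1 := (C.used_iff_of_eqvGen h1).1 hu
    have htE : t.1 ∉ E := by
      rw [hE]
      rintro ⟨x, hx⟩
      rcases h3 with ⟨i', h3, -⟩ | ⟨x', ⟨y', rfl⟩, h3⟩
      · rw [hx] at h3
        simp at h3
      · rw [hx] at h3
        simp at h3
    have hR := hR₃ _ _ (hR₂ _ _ (hR₁ _ _ (by simp [hE, intTag, relTag]) (by simpa [intTag])
      ⟨Int.natCast_nonneg _, by
        simp only [intTag, relTag, len, if_pos hu, Sum.elim_inl]
        exact_mod_cast z.2⟩
      ⟨Int.natCast_nonneg _, by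
        simp only [intTag, len, if_pos htu]
        exact_mod_cast h2⟩ (hR₀ _ _ h1)))
    refine ⟨Φ (intTag t), ?_, ?_⟩
    · convert hR using 1
      simp only [Φ, φ, off, intTag, relTag, Sum.elim_inl, dif_pos hi]
      push_cast
      rfl
    · rcases t with ⟨k, z', b'⟩
      rcases h3 with ⟨i', h3, h4⟩ | ⟨x', ⟨y', rfl⟩, h3⟩
      · dsimp only at h3 h4 h2 htu
        subst h3
        have hi' := (hIm i').2 htu
        refine .inl ⟨(e ⟨i', hi'⟩, ⟨z' + o i', (hW i' z' h2).1⟩), ?_, ?_, ?_⟩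
        · intro h
          simp only [Prod.mk.injEq, EmbeddingLike.apply_eq_iff_eq, Subtype.mk.injEq,
            Fin.mk.injEq] at h
          obtain ⟨rfl, h⟩ := h
          exact h4 (by simp; omega)
        · simp only [Φ, φ, intTag, Sum.elim_inl, dif_pos hi']
        · simp [Φ, off, intTag]
      · dsimp only at h3
        subst h3
        exact .inr ⟨y', rfl⟩
  calc I.card * M ≤ ∑ i : I, (s i).length := by
        rw [← smul_eq_mul, ← Fintype.card_coe, ← Finset.card_univ]
        exact Finset.card_nsmul_le_sum _ _ _ fun i _ => hlen i
    _ = Fintype.card (Σ i : I, Fin (s i).length) := by simp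
    _ = cnt (fun _ : Σ i : I, Fin (s i).length => True) := by simp [cnt]
    _ ≤ _ := by
      refine cnt_le_of_injOn (fun p => (e p.1, ⟨p.2 + o p.1, (hW p.1 p.2 p.2.2).1⟩))
        (fun p _ => hdet p.1 p.1.2 p.2) ?_
      rintro ⟨⟨i, hi⟩, z⟩ ⟨⟨i', hi'⟩, z'⟩ _ _ h
      simp only [Prod.mk.injEq, EmbeddingLike.apply_eq_iff_eq, Subtype.mk.injEq,
        Fin.mk.injEq] at h
      obtain ⟨rfl, h⟩ := h
      obtain rfl : z = z' := by
        ext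
        omega
      rfl

end BandFamily

section Counting

open FreeGroup

/-- A family of functions has at most as many elements as the product of the numbers of options for
each value, given the previous values. -/
theorem card_le_prod_options {P A : Type*} [Fintype P] [LinearOrder P] [DecidableEq A]
    (T : Finset (P → A)) (c : P → ℕ)
    (h : ∀ p, ∀ f ∈ T, ((T.filter fun g => ∀ q < p, g q = f q).image fun g => g p).card ≤ c p) :
    T.card ≤ ∏ p, c p := by
  classical
  have hidx : ∀ O : Finset A, ∃ r : A → ℕ, Set.InjOn r O ∧ ∀ a ∈ O, r a < O.card := by
    intro O
    refine ⟨fun a => if h : a ∈ O then O.equivFin ⟨a, h⟩ else 0, ?_, ?_⟩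
    · intro a ha b hb hab
      have ha' : a ∈ O := ha
      have hb' : b ∈ O := hb
      simp only [dif_pos ha', dif_pos hb', Fin.val_inj, EmbeddingLike.apply_eq_iff_eq,
        Subtype.mk.injEq] at hab
      exact hab
    · intro a ha
      simp only [dif_pos ha, Fin.is_lt]
  choose r hr hr' using hidx
  let O : P → (P → A) → Finset A := fun p f =>
    (T.filter fun g => ∀ q < p, g q = f q).image fun g => g p
  have hO : ∀ p, ∀ f ∈ T, f p ∈ O p f := fun p f hf =>
    Finset.mem_image.2 ⟨f, Finset.mem_filter.2 ⟨hf, fun _ _ => rfl⟩, rfl⟩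
  have hcard : (Fintype.piFinset fun p => Finset.range (c p)).card = ∏ p, c p := by simp
  rw [← hcard]
  refine Finset.card_le_card_of_injOn (fun f p => r (O p f) (f p)) ?_ ?_
  · intro f hf
    simp only [Finset.mem_coe, Fintype.mem_piFinset, Finset.mem_range]
    exact fun p => lt_of_lt_of_le (hr' _ _ (hO p f hf)) (h p f hf)
  · intro f hf g hg hfg
    funext p
    induction p using WellFoundedLT.induction with
    | ind p ih =>
      have hOO : O p f = O p g := by
        simp only [O]
        congr 2
        funext k
        exact propext ⟨fun h q hq => (h q hq).trans (ih q hq),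
          fun h q hq => (h q hq).trans (ih q hq).symm⟩
      have h1 := congrFun hfg p
      dsimp only at h1
      rw [← hOO] at h1
      exact hr (O p f) (hO p f hf) (hOO ▸ hO p g hg) h1

variable {α : Type} [DecidableEq α]

lemma getD_succ_ne_letterInv [Inhabited α] (g : FreeGroup α) {z : ℕ} (hz : z + 1 < g.toWord.length) :
    g.toWord.getD (z + 1) default ≠ letterInv (g.toWord.getD z default) := by
  have h := (isReduced_toWord (x := g)).getElem z hz
  rw [List.getD_eq_getElem _ _ hz, List.getD_eq_getElem _ _ (by omega)]
  intro h'
  rw [h'] at h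
  have := h rfl
  simp [letterInv] at this

variable [Fintype α]

/-- The elements of the free group of a given length. -/
abbrev Sphere (α : Type) [DecidableEq α] (ℓ : ℕ) : Type := {g : FreeGroup α // g.toWord.length = ℓ}

instance (ℓ : ℕ) : Finite (Sphere α ℓ) :=
  Finite.of_injective (β := List.Vector (α × Bool) ℓ) (fun g => ⟨g.1.toWord, g.2⟩)
    fun _ _ h => Subtype.ext (toWord_injective (congrArg Subtype.val h))

lemma card_ne_letter (x : α × Bool) :
    (Finset.univ.filter fun y => y ≠ x).card = 2 * Fintype.card α - 1 := by
  rw [Finset.filter_ne', Finset.card_erase_of_mem (Finset.mem_univ _), Finset.card_univ,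
    Fintype.card_prod, Fintype.card_bool, mul_comm]

lemma pow_le_card_sphere (ℓ : ℕ) : (2 * Fintype.card α - 1) ^ ℓ ≤ Nat.card (Sphere α ℓ) := by
  induction ℓ with
  | zero =>
    rw [pow_zero]
    have : Nonempty (Sphere α 0) := ⟨⟨1, by simp⟩⟩
    exact Nat.one_le_iff_ne_zero.2 Nat.card_pos.ne'
  | succ ℓ ih =>
    have hx : ∀ L : List (α × Bool), FreeGroup.IsReduced L → ∃ e : Fin (2 * Fintype.card α - 1) → α × Bool,
        e.Injective ∧ ∀ j, FreeGroup.IsReduced (e j :: L) := by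
      intro L hL
      rcases L with _ | ⟨y, L⟩
      · have : Fintype.card (Fin (2 * Fintype.card α - 1)) ≤ Fintype.card (α × Bool) := by
          simp
          omega
        obtain ⟨e⟩ := Function.Embedding.nonempty_of_card_le this
        exact ⟨e, e.injective, fun j => by simp [FreeGroup.IsReduced]⟩
      · have : Fintype.card (Fin (2 * Fintype.card α - 1)) ≤
            Fintype.card {x // x ≠ letterInv y} := by
          rw [Fintype.card_fin, Fintype.card_subtype, card_ne_letter]
        obtain ⟨e⟩ := Function.Embedding.nonempty_of_card_le this
        refine ⟨fun j => e j, Subtype.val_injective.comp e.injective, fun j => ?_⟩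
        unfold FreeGroup.IsReduced at hL ⊢
        rw [List.isChain_cons_cons]
        refine ⟨fun h => ?_, hL⟩
        by_contra h'
        refine (e j).2 (Prod.ext h ?_)
        simpa [letterInv] using Bool.eq_not_of_ne h'
    choose e he he' using hx
    let f : Sphere α ℓ × Fin (2 * Fintype.card α - 1) → Sphere α (ℓ + 1) := fun p =>
      ⟨FreeGroup.mk (e p.1.1.toWord isReduced_toWord p.2 :: p.1.1.toWord), by
        rw [toWord_mk, (he' _ _ _).reduce_eq, List.length_cons, p.1.2]⟩
    have hf : f.Injective := by
      rintro ⟨g, j⟩ ⟨g', j'⟩ h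
      have h1 := congrArg (fun x : Sphere α (ℓ + 1) => x.1.toWord) h
      simp only [f, toWord_mk, (he' _ _ _).reduce_eq, List.cons.injEq] at h1
      obtain rfl : g = g' := Subtype.ext (toWord_injective h1.2)
      rw [he _ _ h1.1]
    have := Nat.card_le_card_of_injective f hf
    rw [Nat.card_prod, Nat.card_fin] at this
    rw [pow_succ]
    exact le_trans (Nat.mul_le_mul_right _ ih) this

end Counting

section Pinned

variable {α Y : Type} {m ℓ : ℕ} {lk : (Fin m ⊕ Y) × ℤ × Bool → (Fin m ⊕ Y) × ℤ × Bool → Prop}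

/-- A place of one of the `m` words of length `ℓ`. -/
def placeTag (Y : Type) (p : Fin m × Fin ℓ) (b : Bool) : (Fin m ⊕ Y) × ℤ × Bool :=
  (.inl p.1, ((p.2 : ℕ) : ℤ), b)

/-- The place `p` is related to a previous place. -/
def Pinned (lk : (Fin m ⊕ Y) × ℤ × Bool → (Fin m ⊕ Y) × ℤ × Bool → Prop)
    (p : Fin m × Fin ℓ) : Prop :=
  ∃ t, Relation.EqvGen lk (placeTag Y p true) t ∧
    ((∃ q : Fin m × Fin ℓ, toLex q < toLex p ∧ ∃ b, t = placeTag Y q b) ∨ ∃ y, t.1 = .inr y)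

lemma eqvGen_zFlip (hlk : ∀ t t', lk t t' → lk (zFlip t) (zFlip t'))
    {t t' : (Fin m ⊕ Y) × ℤ × Bool} (h : Relation.EqvGen lk t t') :
    Relation.EqvGen lk (zFlip t) (zFlip t') := by
  induction h with
  | rel _ _ h => exact .rel _ _ (hlk _ _ h)
  | refl => exact .refl _
  | symm _ _ _ ih => exact .symm _ _ ih
  | trans _ _ _ _ _ ih ih' => exact .trans _ _ _ ih ih'

lemma eqvGen_placeTag_symm (hlk : ∀ t t', lk t t' → lk (zFlip t) (zFlip t'))
    {p : Fin m × Fin ℓ} {t : (Fin m ⊕ Y) × ℤ × Bool} {b : Bool}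
    (h : Relation.EqvGen lk t (placeTag Y p b)) :
    ∃ t', (t' = t ∨ t' = zFlip t) ∧ Relation.EqvGen lk (placeTag Y p true) t' := by
  cases b
  · exact ⟨_, .inr rfl, (eqvGen_zFlip hlk h).symm⟩
  · exact ⟨_, .inl rfl, h.symm⟩

lemma cnt_determined_le (hlk : ∀ t t', lk t t' → lk (zFlip t) (zFlip t')) :
    cnt (Determined (ℓ := ℓ) lk) ≤ 2 * cnt (Pinned (ℓ := ℓ) lk) := by
  have h1 : cnt (Determined (ℓ := ℓ) lk) ≤
      cnt (fun p => Pinned (ℓ := ℓ) lk p ∨ (Determined (ℓ := ℓ) lk p ∧ ¬ Pinned (ℓ := ℓ) lk p)) :=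
    cnt_mono fun p hp => by tauto
  have h2 := cnt_or_le (Pinned (ℓ := ℓ) lk)
    (fun p => Determined (ℓ := ℓ) lk p ∧ ¬ Pinned (ℓ := ℓ) lk p)
  suffices h3 : cnt (fun p => Determined (ℓ := ℓ) lk p ∧ ¬ Pinned (ℓ := ℓ) lk p) ≤
      cnt (Pinned (ℓ := ℓ) lk) by omega
  have key : ∀ p : Fin m × Fin ℓ, ∃ q : Fin m × Fin ℓ,
      Determined (ℓ := ℓ) lk p ∧ ¬ Pinned (ℓ := ℓ) lk p →
      toLex p < toLex q ∧ ∃ b, Relation.EqvGen lk (placeTag Y p true) (placeTag Y q b) := by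
    intro p
    by_cases hp : Determined (ℓ := ℓ) lk p ∧ ¬ Pinned (ℓ := ℓ) lk p
    swap
    · exact ⟨p, fun h => absurd h hp⟩
    obtain ⟨⟨⟨k, z, b⟩, ht, ⟨q, hq, h3, h4⟩ | h3⟩, h2⟩ := hp
    · dsimp only at h3 h4
      subst h3 h4
      refine ⟨q, fun _ => ⟨?_, b, ht⟩⟩
      refine lt_of_le_of_ne (not_lt.1 fun hlt => h2 ⟨_, ht, .inl ⟨q, hlt, b, rfl⟩⟩) ?_
      exact fun h => hq (toLex.injective h).symm
    · exact absurd ⟨_, ht, .inr h3⟩ h2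
  choose f hf using key
  refine cnt_le_of_injOn f (fun p hp => ?_) fun p p' hp hp' h => ?_
  · obtain ⟨h1, b, h2⟩ := hf p hp
    obtain ⟨t, ht, h3⟩ := eqvGen_placeTag_symm hlk h2
    refine ⟨t, h3, .inl ⟨p, h1, ?_⟩⟩
    rcases ht with rfl | rfl
    · exact ⟨true, rfl⟩
    · exact ⟨false, rfl⟩
  · obtain ⟨-, b, h2⟩ := hf p hp
    obtain ⟨-, b', h2'⟩ := hf p' hp'
    rw [← h] at h2'
    have hrel : ∃ b'', Relation.EqvGen lk (placeTag Y p true) (placeTag Y p' b'') := by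
      by_cases hb : b = b'
      · subst hb
        exact ⟨true, h2.trans _ _ _ h2'.symm⟩
      · obtain rfl := Bool.eq_not_of_ne hb
        exact ⟨false, h2.trans _ _ _ (eqvGen_zFlip hlk h2').symm⟩
    obtain ⟨b'', hrel⟩ := hrel
    by_contra hne
    rcases lt_or_gt_of_ne (toLex.injective.ne hne) with hlt | hlt
    · obtain ⟨t, ht, h3⟩ := eqvGen_placeTag_symm hlk hrel
      refine hp'.2 ⟨t, h3, .inl ⟨p, hlt, ?_⟩⟩
      rcases ht with rfl | rfl
      · exact ⟨true, rfl⟩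
      · exact ⟨false, rfl⟩
    · exact hp.2 ⟨_, hrel, .inl ⟨p', hlt, _, rfl⟩⟩

/-- Related places carry the same letters. -/
def LinkCons {Q : Type} (lk : Q × ℤ × Bool → Q × ℤ × Bool → Prop) (lt : Q → ℤ → α × Bool) : Prop :=
  ∀ t t', lk t t' → zLetter lt t = zLetter lt t'

lemma LinkCons.eqvGen {Q : Type} {lk : Q × ℤ × Bool → Q × ℤ × Bool → Prop} {lt : Q → ℤ → α × Bool}
    (h : LinkCons lk lt) {t t' : Q × ℤ × Bool} (ht : Relation.EqvGen lk t t') :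
    zLetter lt t = zLetter lt t' := by
  induction ht with
  | rel _ _ h' => exact h _ _ h'
  | refl => rfl
  | symm _ _ _ ih => exact ih.symm
  | trans _ _ _ _ _ ih ih' => exact ih.trans ih'

variable [Fintype α] [DecidableEq α] [Inhabited α]

/-- The number of families of reduced words compatible with prescribed relations between the
letters. -/
theorem ncard_linkCons_le (lk : (Fin m ⊕ Y) × ℤ × Bool → (Fin m ⊕ Y) × ℤ × Bool → Prop)
    (aw : Y → List (α × Bool)) :
    Set.ncard {w : Fin m → Sphere α ℓ |
      LinkCons lk (zWord (Sum.elim (fun i => (w i).1.toWord) aw))} ≤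
      2 ^ m * (2 * Fintype.card α - 1) ^ (m * ℓ - cnt (Pinned (ℓ := ℓ) lk)) := by
  classical
  set q := 2 * Fintype.card α - 1 with hq
  have hα : 0 < Fintype.card α := Fintype.card_pos
  have _ : Fintype (Sphere α ℓ) := Fintype.ofFinite _
  let rd : (Fin m → Sphere α ℓ) → (Fin m ×ₗ Fin ℓ) → α × Bool :=
    fun w p => (w (ofLex p).1).1.toWord.getD (ofLex p).2 default
  have hrd : rd.Injective := by
    intro w w' h
    funext i
    refine Subtype.ext (FreeGroup.toWord_injective (List.ext_getElem ?_ fun z hz hz' => ?_))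
    · rw [(w i).2, (w' i).2]
    · have h1 := congrFun h (toLex (i, ⟨z, by rwa [(w i).2] at hz⟩))
      simp only [rd, ofLex_toLex] at h1
      rwa [List.getD_eq_getElem _ _ hz, List.getD_eq_getElem _ _ hz'] at h1
  let S : Finset (Fin m → Sphere α ℓ) := Finset.univ.filter fun w =>
    LinkCons lk (zWord (Sum.elim (fun i => (w i).1.toWord) aw))
  have hS : Set.ncard {w : Fin m → Sphere α ℓ |
      LinkCons lk (zWord (Sum.elim (fun i => (w i).1.toWord) aw))} = S.card := by
    rw [← Set.ncard_coe_finset]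
    congr 1
    ext w
    simp [S]
  rw [hS, ← Finset.card_image_of_injective S hrd]
  let c : Fin m ×ₗ Fin ℓ → ℕ := fun p =>
    (if ((ofLex p).2 : ℕ) = 0 then 2 else 1) * if Pinned lk (ofLex p) then 1 else q
  have hc1 : ∀ p, 1 ≤ if ((ofLex p : Fin m × Fin ℓ).2 : ℕ) = 0 then 2 else 1 := by
    intro p
    split_ifs <;> omega
  refine (card_le_prod_options (S.image rd) c ?_).trans ?_
  · intro p f hf
    obtain ⟨w, hw, rfl⟩ := Finset.mem_image.1 hf
    have hzl : ∀ (w : Fin m → Sphere α ℓ) (p : Fin m × Fin ℓ),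
        zLetter (zWord (Sum.elim (fun i => (w i).1.toWord) aw)) (placeTag Y p true) =
          rd w (toLex p) := by
      intro w p
      simp [zLetter, zWord, placeTag, orient, rd]
    by_cases hp : Pinned lk (ofLex p)
    · refine le_trans (Finset.card_le_one.2 ?_) (le_trans (hc1 p) (by simp [c, hp]))
      suffices h : ∀ w' ∈ S, (∀ q < p, rd w' q = rd w q) → rd w' p = rd w p by
        intro a ha b hb
        simp only [Finset.mem_image, Finset.mem_filter] at ha hb
        obtain ⟨_, ⟨⟨w', hw', rfl⟩, ha⟩, rfl⟩ := ha
        obtain ⟨_, ⟨⟨w'', hw'', rfl⟩, hb⟩, rfl⟩ := hb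
        rw [h w' hw' ha, h w'' hw'' hb]
      intro w' hw' hagree
      obtain ⟨t, ht, h⟩ := hp
      have h1 := ((Finset.mem_filter.1 hw).2).eqvGen ht
      have h2 := ((Finset.mem_filter.1 hw').2).eqvGen ht
      rw [hzl] at h1 h2
      rw [toLex_ofLex] at h1 h2
      rw [h1, h2]
      rcases h with ⟨q', hq', b, rfl⟩ | ⟨y, hy⟩
      · have h3 := hagree (toLex q') hq'
        cases b
        · rw [show placeTag Y q' false = zFlip (placeTag Y q' true) from rfl, zLetter_zFlip,
            zLetter_zFlip, hzl, hzl, h3]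
        · rw [hzl, hzl, h3]
      · simp [zLetter, zWord, hy]
    · simp only [c, if_neg hp]
      by_cases hz : ((ofLex p).2 : ℕ) = 0
      · rw [if_pos hz]
        refine le_trans (Finset.card_le_univ _) ?_
        rw [Fintype.card_prod, Fintype.card_bool]
        omega
      · rw [if_neg hz, one_mul, hq, ← card_ne_letter (letterInv (rd w (toLex
          ((ofLex p).1, ⟨(ofLex p).2 - 1, lt_of_le_of_lt (Nat.sub_le _ _) (ofLex p).2.2⟩))))]
        refine Finset.card_le_card fun a ha => ?_
        simp only [Finset.mem_image, Finset.mem_filter] at ha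
        obtain ⟨_, ⟨⟨w', hw', rfl⟩, ha⟩, rfl⟩ := ha
        have hlt : toLex ((ofLex p).1, (⟨(ofLex p).2 - 1, lt_of_le_of_lt (Nat.sub_le _ _)
            (ofLex p).2.2⟩ : Fin ℓ)) < toLex (ofLex p) :=
          Prod.Lex.toLex_lt_toLex.2 (.inr ⟨rfl, Fin.lt_def.2 (Nat.sub_lt (by omega) one_pos)⟩)
        rw [toLex_ofLex] at hlt
        rw [Finset.mem_filter, ← ha _ hlt]
        refine ⟨Finset.mem_univ _, ?_⟩
        have h1 := getD_succ_ne_letterInv (w' (ofLex p).1).1 (z := (ofLex p).2 - 1) (by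
          rw [(w' _).2]
          have := (ofLex p).2.2
          omega)
        rwa [show ((ofLex p).2 : ℕ) - 1 + 1 = (ofLex p).2 by omega] at h1
  · rw [Finset.prod_mul_distrib]
    refine Nat.mul_le_mul ?_ ?_
    · rw [Finset.prod_ite, Finset.prod_const, Finset.prod_const_one, mul_one]
      refine Nat.pow_le_pow_right (by norm_num) ?_
      have h := Finset.card_le_card_of_injOn (s := Finset.univ.filter
        fun p : Fin m ×ₗ Fin ℓ => ((ofLex p).2 : ℕ) = 0) (t := Finset.univ)
        (fun p => (ofLex p).1) (fun _ _ => Finset.mem_coe.2 (Finset.mem_univ _)) (by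
          intro p hp p' hp' h
          simp only [Finset.coe_filter, Finset.mem_univ, true_and, Set.mem_ofPred_eq] at hp hp'
          exact ofLex.injective (Prod.ext h (Fin.ext (hp.trans hp'.symm))))
      simpa using h
    · rw [Finset.prod_ite, Finset.prod_const_one, one_mul, Finset.prod_const]
      refine Nat.pow_le_pow_right (by omega) ?_
      have h := Finset.card_filter_add_card_filter_not (s := (Finset.univ : Finset (Fin m ×ₗ Fin ℓ)))
        (fun p => Pinned lk (ofLex p))
      have h2 : (Finset.univ.filter fun p : Fin m ×ₗ Fin ℓ => Pinned lk (ofLex p)).card =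
          cnt (Pinned (ℓ := ℓ) lk) := by
        rw [cnt_eq_card]
        exact Finset.card_equiv ofLex fun p => by simp
      have h3 : (Finset.univ : Finset (Fin m ×ₗ Fin ℓ)).card = m * ℓ := by
        rw [Finset.card_univ, Fintype.card_lex, Fintype.card_prod, Fintype.card_fin,
          Fintype.card_fin]
      omega

end Pinned

section Probability

/-- The number of families with a bad subfamily. -/
lemma ncard_exists_comp_mem_le {G Φ : Type*} [Finite G] [Fintype Φ] {N m K : ℕ}
    (T : Φ → Set (Fin m → G)) (hT : ∀ c, (T c).ncard ≤ K) :
    Set.ncard {r : Fin N → G | ∃ f : Fin m → Fin N, f.Injective ∧ ∃ c, r ∘ f ∈ T c} *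
      Nat.card G ^ m ≤ N ^ m * Fintype.card Φ * K * Nat.card G ^ N := by
  classical
  have _ : Fintype G := Fintype.ofFinite G
  have hone : ∀ (f : Fin m → Fin N) (c : Φ), f.Injective →
      Set.ncard {r : Fin N → G | r ∘ f ∈ T c} * Nat.card G ^ m ≤ K * Nat.card G ^ N := by
    intro f c hf
    have hmN : m ≤ N := by simpa using Fintype.card_le_of_injective f hf
    let g : {r : Fin N → G | r ∘ f ∈ T c} → T c × ({j // ¬ ∃ i, f i = j} → G) :=
      fun r => (⟨r.1 ∘ f, r.2⟩, fun j => r.1 j)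
    have hg : g.Injective := by
      rintro ⟨r, hr⟩ ⟨r', hr'⟩ h
      simp only [g, Prod.mk.injEq, Subtype.mk.injEq] at h
      refine Subtype.ext (funext fun j => ?_)
      by_cases hj : ∃ i, f i = j
      · obtain ⟨i, rfl⟩ := hj
        exact congrFun h.1 i
      · exact congrFun h.2 ⟨j, hj⟩
    have h1 := Nat.card_le_card_of_injective g hg
    have h2 : Nat.card ({j // ¬ ∃ i, f i = j} → G) = Nat.card G ^ (N - m) := by
      rw [Nat.card_fun, Nat.card_eq_fintype_card (α := {j // ¬ ∃ i, f i = j}),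
        Fintype.card_subtype_compl, Fintype.card_fin]
      congr 2
      rw [← Nat.card_eq_fintype_card]
      exact (Nat.card_range_of_injective hf).trans (Nat.card_fin m)
    rw [Nat.card_prod, h2, Nat.card_coe_set_eq, Nat.card_coe_set_eq] at h1
    calc _ ≤ (T c).ncard * Nat.card G ^ (N - m) * Nat.card G ^ m := Nat.mul_le_mul_right _ h1
      _ = (T c).ncard * Nat.card G ^ N := by rw [mul_assoc, ← pow_add, Nat.sub_add_cancel hmN]
      _ ≤ _ := Nat.mul_le_mul_right _ (hT c)
  let J : Finset ((Fin m → Fin N) × Φ) := Finset.univ.filter fun p => p.1.Injective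
  have hsub : {r : Fin N → G | ∃ f : Fin m → Fin N, f.Injective ∧ ∃ c, r ∘ f ∈ T c} ⊆
      ⋃ p ∈ J, {r : Fin N → G | r ∘ p.1 ∈ T p.2} := by
    rintro r ⟨f, hf, c, hc⟩
    simp only [Set.mem_iUnion]
    exact ⟨(f, c), by simp [J, hf], hc⟩
  have hJ : J.card ≤ N ^ m * Fintype.card Φ := by
    refine (Finset.card_le_univ _).trans ?_
    simp
  calc _ ≤ (∑ p ∈ J, Set.ncard {r : Fin N → G | r ∘ p.1 ∈ T p.2}) * Nat.card G ^ m := by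
        refine Nat.mul_le_mul_right _ ((Set.ncard_le_ncard hsub (Set.toFinite _)).trans ?_)
        exact Finset.set_ncard_biUnion_le _ _
    _ ≤ ∑ _p ∈ J, K * Nat.card G ^ N := by
        rw [Finset.sum_mul]
        exact Finset.sum_le_sum fun p hp => hone p.1 p.2 (Finset.mem_filter.1 hp).2
    _ = J.card * (K * Nat.card G ^ N) := by simp
    _ ≤ _ := by
        rw [mul_assoc]
        exact Nat.mul_le_mul_right _ hJ

variable {Y : Type}

/-- Some `m` of the relators satisfy, for some parameter, the relations prescribed between their
letters, and these relations determine many letters. -/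
def BadAt {α Φ : Type} [DecidableEq α] [Inhabited α] (m ℓ : ℕ) {N : ℕ}
    (lk : Φ → (Fin m ⊕ Y) × ℤ × Bool → (Fin m ⊕ Y) × ℤ × Bool → Prop) (aw : Y → List (α × Bool))
    (r : Fin N → FreeGroup α) : Prop :=
  ∃ f : Fin m → Fin N, f.Injective ∧ ∃ c,
    LinkCons (lk c) (zWord (Sum.elim (fun i => (r (f i)).toWord) aw)) ∧
      m * ℓ ≤ 8 * cnt (Determined (ℓ := ℓ) (lk c)) + 16 * m

variable {n : ℕ}

lemma ncard_relTuples (ℓ N : ℕ) (P : (Fin N → FreeGroup (Fin n)) → Prop) :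
    Set.ncard {r ∈ relTuples n ℓ N | P r} =
      Set.ncard {r : Fin N → Sphere (Fin n) ℓ | P fun i => (r i).1} := by
  symm
  refine Set.ncard_congr (fun r _ i => (r i).1) ?_ ?_ ?_
  · exact fun r hr => ⟨fun i => (r i).2, hr⟩
  · intro r r' _ _ h
    exact funext fun i => Subtype.ext (congrFun h i)
  · rintro r ⟨h1, h2⟩
    exact ⟨fun i => ⟨r i, h1 i⟩, h2, rfl⟩

variable [Inhabited (Fin n)]

/-- A bound for the probability of a bad event. -/
lemma relProb_badAt_le {Φ : Type} [Fintype Φ] (m ℓ N : ℕ)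
    {lk : Φ → (Fin m ⊕ Y) × ℤ × Bool → (Fin m ⊕ Y) × ℤ × Bool → Prop}
    (hlk : ∀ c t t', lk c t t' → lk c (zFlip t) (zFlip t')) (aw : Y → List (Fin n × Bool)) :
    relProb n ℓ N (BadAt m ℓ lk aw) ≤ (N : ℝ) ^ m * Fintype.card Φ *
      (2 ^ m * (2 * (n : ℝ) - 1) ^ (-((m : ℝ) * ℓ / 16 - m))) := by
  classical
  set q := 2 * n - 1 with hq
  have hn : 0 < n := Fin.pos default
  have hqr : (q : ℝ) = 2 * (n : ℝ) - 1 := by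
    rw [hq, Nat.cast_sub (by omega)]
    push_cast
    ring
  have hq1 : (1 : ℝ) ≤ q := by
    have : (1 : ℕ) ≤ q := by omega
    exact_mod_cast this
  let T : Φ → Set (Fin m → Sphere (Fin n) ℓ) := fun c =>
    {w | LinkCons (lk c) (zWord (Sum.elim (fun i => (w i).1.toWord) aw)) ∧
      m * ℓ ≤ 8 * cnt (Determined (ℓ := ℓ) (lk c)) + 16 * m}
  have hT : ∀ c, (T c).ncard ≤ ⌊(2 : ℝ) ^ m * (q : ℝ) ^ ((m : ℝ) * ℓ - (m * ℓ / 16 - m))⌋₊ := by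
    intro c
    by_cases hc : m * ℓ ≤ 8 * cnt (Determined (ℓ := ℓ) (lk c)) + 16 * m
    · refine Nat.le_floor ?_
      have h1 : (T c).ncard ≤ 2 ^ m * q ^ (m * ℓ - cnt (Pinned (ℓ := ℓ) (lk c))) := by
        have h := ncard_linkCons_le (α := Fin n) (ℓ := ℓ) (lk c) aw
        rw [Fintype.card_fin] at h
        exact (Set.ncard_le_ncard (fun w hw => hw.1) (Set.toFinite _)).trans h
      have h2 := cnt_determined_le (ℓ := ℓ) (hlk c)
      have h3 : cnt (Pinned (ℓ := ℓ) (lk c)) ≤ m * ℓ := by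
        unfold cnt
        refine (Finset.card_le_univ _).trans ?_
        simp
      refine (Nat.cast_le.2 h1).trans ?_
      push_cast
      refine mul_le_mul_of_nonneg_left ?_ (by positivity)
      rw [← Real.rpow_natCast]
      refine Real.rpow_le_rpow_of_exponent_le hq1 ?_
      rw [Nat.cast_sub h3]
      push_cast
      have h4 : (m : ℝ) * ℓ ≤ 16 * cnt (Pinned (ℓ := ℓ) (lk c)) + 16 * m := by
        have : m * ℓ ≤ 16 * cnt (Pinned (ℓ := ℓ) (lk c)) + 16 * m := by omega
        exact_mod_cast this
      linarith
    · have : T c = ∅ := by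
        ext w
        simp [T, hc]
      rw [this, Set.ncard_empty]
      exact Nat.zero_le _
  have hσ : q ^ ℓ ≤ Nat.card (Sphere (Fin n) ℓ) := by
    have := pow_le_card_sphere (α := Fin n) ℓ
    rwa [Fintype.card_fin] at this
  set σ := Nat.card (Sphere (Fin n) ℓ) with hσd
  have hσ0 : (0 : ℝ) < σ := by
    have : 0 < q ^ ℓ := Nat.pow_pos (by omega)
    exact_mod_cast lt_of_lt_of_le this hσ
  have hcount := ncard_exists_comp_mem_le (N := N) T hT
  have hden : Set.ncard (relTuples n ℓ N) = σ ^ N := by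
    have h := ncard_relTuples (n := n) ℓ N fun _ => True
    simp only [and_true, Set.ofPred_mem_eq] at h
    rw [h, Set.ofPred_true, Set.ncard_univ, Nat.card_fun, Nat.card_fin]
  have hnum : Set.ncard {r ∈ relTuples n ℓ N | BadAt m ℓ lk aw r} =
      Set.ncard {r : Fin N → Sphere (Fin n) ℓ |
        ∃ f : Fin m → Fin N, f.Injective ∧ ∃ c, r ∘ f ∈ T c} := ncard_relTuples ℓ N _
  rw [← hnum] at hcount
  unfold relProb
  rw [hden, Nat.cast_pow, div_le_iff₀ (pow_pos hσ0 N)]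
  set A := Set.ncard {r ∈ relTuples n ℓ N | BadAt m ℓ lk aw r}
  set K := ⌊(2 : ℝ) ^ m * (q : ℝ) ^ ((m : ℝ) * ℓ - (m * ℓ / 16 - m))⌋₊ with hK
  have hKle : (K : ℝ) ≤ (2 : ℝ) ^ m * (q : ℝ) ^ ((m : ℝ) * ℓ - (m * ℓ / 16 - m)) :=
    Nat.floor_le (by positivity)
  have hcount' : (A : ℝ) * (σ : ℝ) ^ m ≤ (N : ℝ) ^ m * Fintype.card Φ * K * (σ : ℝ) ^ N := by
    exact_mod_cast hcount
  have hσq : (q : ℝ) ^ ((m : ℝ) * ℓ) ≤ (σ : ℝ) ^ m := by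
    have h1 : ((q ^ ℓ) ^ m : ℕ) ≤ σ ^ m := Nat.pow_le_pow_left hσ m
    have h2 : (q : ℝ) ^ ((m : ℝ) * ℓ) = ((q ^ ℓ) ^ m : ℕ) := by
      rw [← Nat.cast_mul, Real.rpow_natCast, ← pow_mul, mul_comm]
      push_cast
      rfl
    rw [h2]
    exact_mod_cast h1
  rw [← hqr]
  have hsplit : (q : ℝ) ^ ((m : ℝ) * ℓ - (m * ℓ / 16 - m)) =
      (q : ℝ) ^ ((m : ℝ) * ℓ) * (q : ℝ) ^ (-((m : ℝ) * ℓ / 16 - m)) := by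
    rw [← Real.rpow_add (by linarith), sub_eq_add_neg]
  refine le_of_mul_le_mul_right ?_ (pow_pos hσ0 m)
  calc (A : ℝ) * (σ : ℝ) ^ m ≤ (N : ℝ) ^ m * Fintype.card Φ * K * (σ : ℝ) ^ N := hcount'
    _ ≤ (N : ℝ) ^ m * Fintype.card Φ * (2 ^ m * ((σ : ℝ) ^ m *
        (q : ℝ) ^ (-((m : ℝ) * ℓ / 16 - m)))) * (σ : ℝ) ^ N := by
      rw [hsplit] at hKle
      gcongr
      refine hKle.trans ?_
      gcongr
    _ = _ := by ring

/-- The probability of a bad event with polynomially many parameters tends to zero. -/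
theorem tendsto_badAt {d : ℝ} (hn : 2 ≤ n) (hd : d < 1 / 16) {m : ℕ} (hm : 0 < m) {Φ : ℕ → Type}
    [∀ ℓ, Fintype (Φ ℓ)] {A K : ℕ} (hΦ : ∀ ℓ, Fintype.card (Φ ℓ) ≤ A * (ℓ + 1) ^ K)
    {lk : ∀ ℓ, Φ ℓ → (Fin m ⊕ Y) × ℤ × Bool → (Fin m ⊕ Y) × ℤ × Bool → Prop}
    (hlk : ∀ ℓ c t t', lk ℓ c t t' → lk ℓ c (zFlip t) (zFlip t')) (aw : Y → List (Fin n × Bool)) :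
    Tendsto (fun ℓ => relProb n ℓ (numRel n d ℓ) (BadAt m ℓ (lk ℓ) aw)) atTop (nhds 0) := by
  set q : ℝ := 2 * (n : ℝ) - 1 with hq
  have hn' : (2 : ℝ) ≤ n := by exact_mod_cast hn
  have hq1 : 1 < q := by linarith
  have hq0 : 0 < q := by linarith
  set ρ : ℝ := q ^ ((m : ℝ) * (d - 1 / 16)) with hρ
  have hρ0 : 0 < ρ := Real.rpow_pos_of_pos hq0 _
  have hρ1 : ρ < 1 := by
    refine Real.rpow_lt_one_of_one_lt_of_neg hq1 ?_
    have : (0 : ℝ) < m := by exact_mod_cast hm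
    nlinarith
  have hbound : ∀ ℓ : ℕ, relProb n ℓ (numRel n d ℓ) (BadAt m ℓ (lk ℓ) aw) ≤
      (A * 2 ^ m * q ^ (m : ℝ) * ρ⁻¹) * (((ℓ + 1 : ℕ) : ℝ) ^ K * ρ ^ (ℓ + 1)) := by
    intro ℓ
    refine (relProb_badAt_le m ℓ (numRel n d ℓ) (hlk ℓ) aw).trans ?_
    rw [← hq]
    have h1 : ((numRel n d ℓ : ℕ) : ℝ) ≤ q ^ (d * ℓ) := Nat.floor_le (by positivity)
    have h2 : ((numRel n d ℓ : ℕ) : ℝ) ^ m ≤ q ^ ((m : ℝ) * d * ℓ) := by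
      calc ((numRel n d ℓ : ℕ) : ℝ) ^ m ≤ (q ^ (d * ℓ)) ^ m := by gcongr
        _ = q ^ ((m : ℝ) * d * ℓ) := by
          rw [← Real.rpow_natCast, ← Real.rpow_mul hq0.le]
          congr 1
          ring
    have h3 : (Fintype.card (Φ ℓ) : ℝ) ≤ A * ((ℓ + 1 : ℕ) : ℝ) ^ K := by exact_mod_cast hΦ ℓ
    have h4 : q ^ ((m : ℝ) * d * ℓ) * q ^ (-((m : ℝ) * ℓ / 16 - m)) =
        q ^ (m : ℝ) * ρ ^ ℓ := by
      rw [hρ, ← Real.rpow_natCast (q ^ _), ← Real.rpow_mul hq0.le, ← Real.rpow_add hq0,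
        ← Real.rpow_add hq0]
      congr 1
      ring
    calc _ ≤ q ^ ((m : ℝ) * d * ℓ) * (A * ((ℓ + 1 : ℕ) : ℝ) ^ K) *
          (2 ^ m * q ^ (-((m : ℝ) * ℓ / 16 - m))) := by gcongr
      _ = (A * 2 ^ m) * ((ℓ + 1 : ℕ) : ℝ) ^ K *
          (q ^ ((m : ℝ) * d * ℓ) * q ^ (-((m : ℝ) * ℓ / 16 - m))) := by ring
      _ = _ := by
        rw [h4, pow_succ]
        field_simp
  refine squeeze_zero (fun ℓ => ?_) hbound ?_
  · unfold relProb
    positivity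
  · have h := tendsto_pow_const_mul_const_pow_of_abs_lt_one K (r := ρ) (by
      rwa [abs_of_pos hρ0])
    have h' := (h.comp (tendsto_add_atTop_nat 1)).const_mul (A * 2 ^ m * q ^ (m : ℝ) * ρ⁻¹)
    simpa [Function.comp_def] using h'

end Probability

section Events

variable {Q κ Y α : Type}

/-- The relation gluing the places `u j` to the places `v j`, and their flips. -/
def pairLink (u v : κ → Q × ℤ × Bool) (t t' : Q × ℤ × Bool) : Prop :=
  ∃ j, (t = u j ∧ t' = v j) ∨ (t = zFlip (u j) ∧ t' = zFlip (v j))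

lemma pairLink.flip {u v : κ → Q × ℤ × Bool} {t t' : Q × ℤ × Bool} (h : pairLink u v t t') :
    pairLink u v (zFlip t) (zFlip t') := by
  obtain ⟨j, ⟨rfl, rfl⟩ | ⟨rfl, rfl⟩⟩ := h
  · exact ⟨j, .inr ⟨rfl, rfl⟩⟩
  · exact ⟨j, .inl ⟨by simp, by simp⟩⟩

lemma linkCons_pairLink {u v : κ → Q × ℤ × Bool} {lt : Q → ℤ → α × Bool}
    (h : ∀ j, zLetter lt (u j) = zLetter lt (v j)) : LinkCons (pairLink u v) lt := by
  rintro t t' ⟨j, ⟨rfl, rfl⟩ | ⟨rfl, rfl⟩⟩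
  · exact h j
  · rw [zLetter_zFlip, zLetter_zFlip, h j]

lemma determined_of_eqvGen {m ℓ : ℕ}
    {lk : (Fin m ⊕ Y) × ℤ × Bool → (Fin m ⊕ Y) × ℤ × Bool → Prop}
    (hlk : ∀ t t', lk t t' → lk (zFlip t) (zFlip t')) {p q : Fin m × Fin ℓ} {b b' : Bool}
    (hpq : q ≠ p) (h : Relation.EqvGen lk (placeTag Y p b) (placeTag Y q b')) :
    Determined lk p := by
  cases b
  · exact ⟨_, eqvGen_zFlip hlk h, .inl ⟨q, hpq, rfl, rfl⟩⟩
  · exact ⟨_, h, .inl ⟨q, hpq, rfl, rfl⟩⟩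

lemma card_le_cnt {T : Type} [Fintype T] [Fintype κ] {P : T → Prop} (g : κ → T)
    (hg : g.Injective) (h : ∀ j, P (g j)) : Fintype.card κ ≤ cnt P := by
  classical
  rw [cnt_eq_card, ← Finset.card_univ]
  exact Finset.card_le_card_of_injOn g (fun j _ => by simpa using h j) hg.injOn

section Trim

/-- The first and the last `ℓ / 16` positions in a word of length `ℓ`. -/
def endPos (ℓ j : ℕ) : ℕ := if j < ℓ / 16 then j else ℓ - 2 * (ℓ / 16) + j

/-- The relation expressing that a word of length `ℓ` ends with the inverse of its beginning. -/
def trimLink (Y : Type) (ℓ : ℕ) (_ : Unit) :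
    (Fin 1 ⊕ Y) × ℤ × Bool → (Fin 1 ⊕ Y) × ℤ × Bool → Prop :=
  pairLink (fun j : Fin (2 * (ℓ / 16)) => (.inl 0, ((endPos ℓ j : ℕ) : ℤ), true))
    fun j => (.inl 0, ((ℓ - 1 - endPos ℓ j : ℕ) : ℤ), false)

lemma trimLink_zFlip {ℓ : ℕ} (c : Unit) (t t' : (Fin 1 ⊕ Y) × ℤ × Bool)
    (h : trimLink Y ℓ c t t') : trimLink Y ℓ c (zFlip t) (zFlip t') := pairLink.flip h

lemma exists_lt_trim [DecidableEq α] [Inhabited α] {N ℓ : ℕ} {r : Fin N → FreeGroup α}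
    {aw : Y → List (α × Bool)} (h : ¬ BadAt 1 ℓ (trimLink Y ℓ) aw r) (i : Fin N) :
    ∃ o < ℓ / 16, (r i).toWord.getD o default ≠
      letterInv ((r i).toWord.getD (ℓ - 1 - o) default) := by
  by_contra! hc
  refine h ⟨fun _ => i, Function.injective_of_subsingleton _, (), ?_, ?_⟩
  · refine linkCons_pairLink fun j => ?_
    have hj := j.2
    simp only [zLetter, orient, zWord, Sum.elim_inl, Int.toNat_natCast]
    by_cases hj' : (j : ℕ) < ℓ / 16
    · simpa [endPos, hj', letterInv] using hc j hj'
    · have h1 := hc (ℓ - 1 - endPos ℓ j) (by simp only [endPos, hj', if_false]; omega)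
      have h2 : ℓ - 1 - (ℓ - 1 - endPos ℓ j) = endPos ℓ j := by
        simp only [endPos, hj', if_false]; omega
      rw [h2] at h1
      rw [h1]
      simp [letterInv]
  · have hlt : ∀ j : Fin (2 * (ℓ / 16)), endPos ℓ j < ℓ := fun j => by
      have := j.2
      unfold endPos
      split_ifs <;> omega
    have := card_le_cnt (P := Determined (ℓ := ℓ) (trimLink Y ℓ ()))
      (fun j : Fin (2 * (ℓ / 16)) => ((0, ⟨endPos ℓ j, hlt j⟩) : Fin 1 × Fin ℓ))
      (fun j j' hj => by
        have hj2 := j.2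
        have hj2' := j'.2
        simp only [Prod.mk.injEq, Fin.mk.injEq, true_and, endPos] at hj
        ext
        split_ifs at hj <;> omega) (fun j => by
        have hj2 := hlt j
        refine determined_of_eqvGen (trimLink_zFlip ())
          (q := (0, ⟨ℓ - 1 - endPos ℓ j, by omega⟩)) (b := true) (b' := false) ?_
          (.rel _ _ ⟨j, .inl ⟨rfl, rfl⟩⟩)
        intro hq
        have hj3 := j.2
        simp only [Prod.mk.injEq, Fin.mk.injEq, true_and, endPos] at hq
        split_ifs at hq <;> omega)
    rw [Fintype.card_fin] at this
    omega

end Trim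

section Repetition

/-- The position reached after `t` steps on a cycle of length `len`, starting from `z`. -/
def cycPos (len z : ℕ) (b : Bool) (t : ℕ) : ℕ :=
  if b then (z + t) % len else (z + (len - t)) % len

lemma mod_of_lt_two_mul {a len : ℕ} (h : a < 2 * len) :
    a % len = if a < len then a else a - len := by
  split_ifs with h'
  · exact Nat.mod_eq_of_lt h'
  · rw [Nat.mod_eq_sub_mod (by omega), Nat.mod_eq_of_lt (by omega)]

lemma cycPos_inj {len z t t' : ℕ} {b : Bool} (hz : z < len) (ht : t < len) (ht' : t' < len)
    (h : cycPos len z b t = cycPos len z b t') : t = t' := by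
  cases b
  · simp only [cycPos, Bool.false_eq_true, if_false] at h
    rw [mod_of_lt_two_mul (by omega), mod_of_lt_two_mul (by omega)] at h
    split_ifs at h <;> omega
  · simp only [cycPos, if_true] at h
    rw [mod_of_lt_two_mul (by omega), mod_of_lt_two_mul (by omega)] at h
    split_ifs at h <;> omega

lemma cycPos_lt {len z : ℕ} {b : Bool} (t : ℕ) (hz : z < len) : cycPos len z b t < len := by
  unfold cycPos
  split_ifs <;> exact Nat.mod_lt _ (by omega)

/-- A trimming, a position in the trimmed word, and an orientation. -/
abbrev CycParam (ℓ : ℕ) : Type := Fin (ℓ + 1) × Fin (ℓ + 1) × Bool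

/-- The place reached after `t` steps in the cyclic word obtained by trimming. -/
def cycTag {ℓ : ℕ} (x : Q) (c : CycParam ℓ) (t : ℕ) : Q × ℤ × Bool :=
  (x, ((c.1 + cycPos (ℓ - 2 * c.1) c.2.1 c.2.2 t : ℕ) : ℤ), c.2.2)

/-- The relation expressing that the same word of length `ℓ / 8` is read at two places. -/
def repLink (Y : Type) {m : ℕ} (x x' : Fin m) (ℓ : ℕ) (c : CycParam ℓ × CycParam ℓ) :
    (Fin m ⊕ Y) × ℤ × Bool → (Fin m ⊕ Y) × ℤ × Bool → Prop :=
  pairLink (fun t : Fin (ℓ / 8) => cycTag (.inl x) c.1 t) fun t => cycTag (.inl x') c.2 t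

lemma repLink_zFlip {m ℓ : ℕ} {x x' : Fin m} (c : CycParam ℓ × CycParam ℓ)
    (t t' : (Fin m ⊕ Y) × ℤ × Bool) (h : repLink Y x x' ℓ c t t') :
    repLink Y x x' ℓ c (zFlip t) (zFlip t') := pairLink.flip h

variable {ι : Type} {s : ι → List (α × Bool)}

lemma relShift_pow_apply (p : RelPos s) (t : ℕ) (ht : t ≤ (s p.1.1).length) :
    (((relShift s ^ t) p).1.1 = p.1.1) ∧
    ((((relShift s ^ t) p).1.2 : ℕ) = cycPos (s p.1.1).length p.1.2 p.2 t) ∧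
    ((relShift s ^ t) p).2 = p.2 := by
  have h := relTag_relShift_pow (X := Unit) p t ht
  simp only [relTag, Prod.mk.injEq, Sum.inl.injEq] at h
  exact h

variable [Inhabited α]

lemma relLetter_relShift_pow (p : RelPos s) (t : ℕ) (ht : t ≤ (s p.1.1).length) :
    relLetter s ((relShift s ^ t) p) =
      orient p.2 ((s p.1.1).getD (cycPos (s p.1.1).length p.1.2 p.2 t) default) := by
  obtain ⟨h1, h2, h3⟩ := relShift_pow_apply p t ht
  unfold relLetter
  rw [h2, h3, h1]

theorem smallCanc_of_not_badAt [DecidableEq α] {N ℓ : ℕ} {r : Fin N → FreeGroup α}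
    {s : Fin N → List (α × Bool)} {o : Fin N → ℕ} {aw : Y → List (α × Bool)}
    (hs : ∀ i, (s i).length = ℓ - 2 * o i) (ho : ∀ i, o i ≤ ℓ / 16)
    (hW : ∀ i, ∀ z < (s i).length, (r i).toWord.getD (z + o i) default = (s i).getD z default)
    (h1 : ¬ BadAt 1 ℓ (repLink Y 0 0 ℓ) aw r) (h2 : ¬ BadAt 2 ℓ (repLink Y 0 1 ℓ) aw r) :
    SmallCanc s (ℓ / 8) := by
  intro p p' h
  by_contra hne
  let code : RelPos s → CycParam ℓ := fun p =>
    (⟨o p.1.1, by have := ho p.1.1; omega⟩,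
      ⟨p.1.2, by have := p.1.2.2; have := hs p.1.1; omega⟩, p.2)
  have hlen : ∀ (p : RelPos s) (t : Fin (ℓ / 8)), (t : ℕ) < (s p.1.1).length := by
    intro p t
    have := t.2
    have := hs p.1.1
    have := ho p.1.1
    omega
  have hlt : ∀ (p : RelPos s) (t : ℕ),
      o p.1.1 + cycPos (s p.1.1).length p.1.2 p.2 t < ℓ := by
    intro p t
    have := cycPos_lt (b := p.2) t p.1.2.2
    have := hs p.1.1
    omega
  let g : ∀ {m : ℕ}, Fin m → RelPos s → Fin (ℓ / 8) → Fin m × Fin ℓ := fun x p t =>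
    (x, ⟨o p.1.1 + cycPos (s p.1.1).length p.1.2 p.2 t, hlt p t⟩)
  have htag : ∀ {m : ℕ} (x : Fin m) (p : RelPos s) (t : Fin (ℓ / 8)),
      cycTag (Sum.inl x : Fin m ⊕ Y) (code p) t = placeTag Y (g x p t) p.2 := by
    intro m x p t
    simp only [cycTag, code, placeTag, g, ← hs]
  have hg : ∀ {m : ℕ} (x : Fin m) (p : RelPos s), (g x p).Injective := by
    intro m x p t t' htt
    simp only [g, Prod.mk.injEq, Fin.mk.injEq, true_and, add_right_inj] at htt
    exact Fin.ext (cycPos_inj p.1.2.2 (hlen p t) (hlen p t') htt)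
  have hletter : ∀ {m : ℕ} (f : Fin m → Fin N) (x : Fin m) (p : RelPos s), f x = p.1.1 →
      ∀ t : Fin (ℓ / 8), zLetter (zWord (Sum.elim (fun i => (r (f i)).toWord) aw))
        (cycTag (.inl x) (code p) t) = relLetter s ((relShift s ^ (t : ℕ)) p) := by
    intro m f x p hf t
    rw [relLetter_relShift_pow p t (hlen p t).le, htag]
    simp only [zLetter, placeTag, zWord, Sum.elim_inl, g, hf, Int.toNat_natCast]
    rw [add_comm, hW _ _ (cycPos_lt _ p.1.2.2)]
  by_cases hi : p.1.1 = p'.1.1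
  · refine h1 ⟨fun _ => p.1.1, Function.injective_of_subsingleton _, (code p, code p'), ?_, ?_⟩
    · refine linkCons_pairLink fun t => ?_
      rw [hletter _ _ p rfl, hletter _ _ p' hi, h t t.2]
    · have := card_le_cnt (P := Determined (ℓ := ℓ) (repLink Y (0 : Fin 1) 0 ℓ (code p, code p')))
        (g 0 p) (hg 0 p) fun t => by
          refine determined_of_eqvGen (repLink_zFlip _) (q := g 0 p' t) (b := p.2) (b' := p'.2) ?_
            (.rel _ _ ⟨t, .inl ⟨(htag 0 p t).symm, (htag 0 p' t).symm⟩⟩)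
          intro hq
          simp only [g, Prod.mk.injEq, Fin.mk.injEq, true_and, ← hi, add_right_inj] at hq
          have hl := h t t.2
          rw [relLetter_relShift_pow p t (hlen p t).le,
            relLetter_relShift_pow p' t (hlen p' t).le] at hl
          simp only [← hi, hq] at hl
          by_cases hb : p.2 = p'.2
          · refine hne ((relShift s ^ (t : ℕ)).injective ?_)
            obtain ⟨e1, e2, e3⟩ := relShift_pow_apply p t (hlen p t).le
            obtain ⟨e1', e2', e3'⟩ := relShift_pow_apply p' t (hlen p' t).le
            refine relTag_inj (X := Unit) ?_
            simp only [relTag, e1, e2, e3, e1', e2', e3', hb, ← hi, hq]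
          · rw [Bool.eq_not_of_ne hb, orient_not] at hl
            exact letterInv_ne _ hl
      rw [Fintype.card_fin] at this
      omega
  · refine h2 ⟨![p.1.1, p'.1.1], ?_, (code p, code p'), ?_, ?_⟩
    · intro x y hxy
      fin_cases x <;> fin_cases y
      exacts [rfl, absurd hxy hi, absurd hxy (Ne.symm hi), rfl]
    · refine linkCons_pairLink fun t => ?_
      rw [hletter _ _ p rfl, hletter _ _ p' rfl, h t t.2]
    · have := card_le_cnt (P := Determined (ℓ := ℓ) (repLink Y (0 : Fin 2) 1 ℓ (code p, code p')))
        (Sum.elim (g 0 p) (g 1 p'))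
        (by
          refine (hg 0 p).sumElim (hg 1 p') fun t t' htt => ?_
          simp [g] at htt)
        (by
          have hrel : ∀ t, Relation.EqvGen (repLink Y (0 : Fin 2) 1 ℓ (code p, code p'))
              (placeTag Y (g 0 p t) p.2) (placeTag Y (g 1 p' t) p'.2) := fun t =>
            .rel _ _ ⟨t, .inl ⟨(htag 0 p t).symm, (htag 1 p' t).symm⟩⟩
          rintro (t | t)
          · exact determined_of_eqvGen (repLink_zFlip _) (by simp [g]) (hrel t)
          · exact determined_of_eqvGen (repLink_zFlip _) (by simp [g]) (hrel t).symm)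
      rw [Fintype.card_sum, Fintype.card_fin] at this
      omega

end Repetition

section Bands

/-- Bounded parameters for a band. -/
abbrev BandParam (Q : Type) (ℓ : ℕ) : Type :=
  (Q × Fin (ℓ + 1) × Bool) × (Q × Fin (ℓ + 1) × Bool) × Fin (ℓ + 1)

/-- The band with given parameters. -/
def BandParam.toBand {ℓ : ℕ} (c : BandParam Q ℓ) : Band Q where
  fst := (c.1.1, ((c.1.2.1 : ℕ) : ℤ), c.1.2.2)
  snd := (c.2.1.1, ((c.2.1.2.1 : ℕ) : ℤ), c.2.1.2.2)
  n := c.2.2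

/-- The relation given by a family of bands. -/
def bandLink (Q : Type) (M ℓ : ℕ) (c : Fin M → BandParam Q ℓ) (t t' : Q × ℤ × Bool) : Prop :=
  ∃ k, (c k).toBand.Link t t'

lemma bandLink_zFlip {M ℓ : ℕ} (c : Fin M → BandParam Q ℓ) (t t' : Q × ℤ × Bool)
    (h : bandLink Q M ℓ c t t') : bandLink Q M ℓ c (zFlip t) (zFlip t') :=
  h.imp fun _ => Band.Link.flip

lemma Band.Valid.exists_param {len : Q → ℕ} {β : Band Q} {ℓ : ℕ} (h : β.Valid len)
    (hlen : ∀ x, len x ≤ ℓ) : ∃ c : BandParam Q ℓ, ∀ t t', c.toBand.Link t t' ↔ β.Link t t' := by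
  obtain ⟨⟨x, z, b⟩, ⟨x', z', b'⟩, n⟩ := β
  rcases Nat.eq_zero_or_pos n with rfl | hn
  · exact ⟨((x, 0, b), (x', 0, b'), 0), fun t t' => by simp [Band.Link, BandParam.toBand]⟩
  have h0 := h 0 hn
  have h1 := h (n - 1) (by simp only; omega)
  have hx := hlen x
  have hx' := hlen x'
  simp only [InLen, adv] at h0 h1
  have hn' : n ≤ ℓ := by
    cases b <;> simp at h0 h1 <;> omega
  have hz : 0 ≤ z ∧ z ≤ ℓ := by
    cases b <;> simp at h0 <;> omega
  have hz' : 0 ≤ z' ∧ z' ≤ ℓ := by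
    cases b' <;> simp at h0 <;> omega
  refine ⟨((x, ⟨z.toNat, by omega⟩, b), (x', ⟨z'.toNat, by omega⟩, b'), ⟨n, by omega⟩),
    fun t t' => ?_⟩
  have e : BandParam.toBand (ℓ := ℓ) ((x, ⟨z.toNat, by omega⟩, b), (x', ⟨z'.toNat, by omega⟩, b'),
      ⟨n, by omega⟩) = ⟨(x, z, b), (x', z', b'), n⟩ := by
    simp [BandParam.toBand, hz.1, hz'.1]
  rw [e]

lemma card_bandParam [Fintype Q] (M ℓ : ℕ) :
    Fintype.card (Fin M → BandParam Q ℓ) ≤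
      (4 * Fintype.card Q ^ 2) ^ M * (ℓ + 1) ^ (3 * M) := by
  simp only [Fintype.card_fun, Fintype.card_prod, Fintype.card_fin, Fintype.card_bool]
  rw [pow_mul (ℓ + 1), ← mul_pow]
  refine (congrArg (· ^ M) ?_).le
  ring

end Bands

end Events

section Probability

variable {n : ℕ} {d : ℝ}

lemma ncard_relTuples_pos [Inhabited (Fin n)] (ℓ N : ℕ) : 0 < Set.ncard (relTuples n ℓ N) := by
  have h := ncard_relTuples (n := n) ℓ N fun _ => True
  simp only [and_true, Set.ofPred_mem_eq] at h
  rw [h, Set.ofPred_true, Set.ncard_univ, Nat.card_fun, Nat.card_fin]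
  have h1 := pow_le_card_sphere (α := Fin n) ℓ
  rw [Fintype.card_fin] at h1
  have hn : 0 < n := Fin.pos default
  exact Nat.pow_pos (lt_of_lt_of_le (Nat.pow_pos (by omega)) h1)

lemma finite_relTuples [Inhabited (Fin n)] (ℓ N : ℕ) : (relTuples n ℓ N).Finite :=
  Set.finite_of_ncard_pos (ncard_relTuples_pos ℓ N)

lemma relProb_mono [Inhabited (Fin n)] {ℓ N : ℕ} {P Q : (Fin N → FreeGroup (Fin n)) → Prop}
    (h : ∀ r ∈ relTuples n ℓ N, P r → Q r) : relProb n ℓ N P ≤ relProb n ℓ N Q := by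
  unfold relProb
  have : Set.ncard {r ∈ relTuples n ℓ N | P r} ≤ Set.ncard {r ∈ relTuples n ℓ N | Q r} :=
    Set.ncard_le_ncard (fun r hr => ⟨hr.1, h r hr.1 hr.2⟩)
      ((finite_relTuples ℓ N).subset (Set.sep_subset _ _))
  gcongr

lemma relProb_or_le (ℓ N : ℕ) (P Q : (Fin N → FreeGroup (Fin n)) → Prop) :
    relProb n ℓ N (fun r => P r ∨ Q r) ≤ relProb n ℓ N P + relProb n ℓ N Q := by
  unfold relProb
  rw [← add_div]
  have : Set.ncard {r ∈ relTuples n ℓ N | P r ∨ Q r} ≤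
      Set.ncard {r ∈ relTuples n ℓ N | P r} + Set.ncard {r ∈ relTuples n ℓ N | Q r} := by
    rw [Set.sep_or]
    exact Set.ncard_union_le _ _
  gcongr
  exact_mod_cast this

lemma relProb_add_not [Inhabited (Fin n)] (ℓ N : ℕ) (P : (Fin N → FreeGroup (Fin n)) → Prop) :
    relProb n ℓ N P + relProb n ℓ N (fun r => ¬ P r) = 1 := by
  unfold relProb
  rw [← add_div, div_eq_one_iff_eq (by exact_mod_cast (ncard_relTuples_pos ℓ N).ne')]
  have h := Set.ncard_inter_add_ncard_sdiff_eq_ncard (relTuples n ℓ N) {r | P r}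
    (finite_relTuples ℓ N)
  exact_mod_cast h

lemma wop_iff [Inhabited (Fin n)]
    {P : ∀ ℓ : ℕ, (Fin (numRel n d ℓ) → FreeGroup (Fin n)) → Prop} :
    wop n d P ↔ Tendsto (fun ℓ => relProb n ℓ (numRel n d ℓ) fun r => ¬ P ℓ r) atTop (nhds 0) := by
  have h : ∀ ℓ, relProb n ℓ (numRel n d ℓ) (P ℓ) =
      1 - relProb n ℓ (numRel n d ℓ) fun r => ¬ P ℓ r := fun ℓ =>
    eq_sub_of_add_eq (relProb_add_not ℓ _ _)
  have h' : ∀ ℓ, relProb n ℓ (numRel n d ℓ) (fun r => ¬ P ℓ r) =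
      1 - relProb n ℓ (numRel n d ℓ) (P ℓ) := fun ℓ => by rw [h]; ring
  unfold wop
  constructor
  · intro H
    simp only [h']
    simpa using H.const_sub 1
  · intro H
    simp only [h]
    simpa using H.const_sub 1

lemma relProb_nonneg (ℓ N : ℕ) (P : (Fin N → FreeGroup (Fin n)) → Prop) : 0 ≤ relProb n ℓ N P := by
  unfold relProb
  positivity

lemma wop.mono [Inhabited (Fin n)]
    {P Q : ∀ ℓ : ℕ, (Fin (numRel n d ℓ) → FreeGroup (Fin n)) → Prop} (hP : wop n d P)
    (h : ∀ᶠ ℓ in atTop, ∀ r ∈ relTuples n ℓ (numRel n d ℓ), P ℓ r → Q ℓ r) : wop n d Q := by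
  rw [wop_iff] at hP ⊢
  refine squeeze_zero' (Eventually.of_forall fun ℓ => relProb_nonneg _ _ _) ?_ hP
  filter_upwards [h] with ℓ hℓ
  exact relProb_mono fun r hr => mt (hℓ r hr)

lemma wop.and [Inhabited (Fin n)]
    {P Q : ∀ ℓ : ℕ, (Fin (numRel n d ℓ) → FreeGroup (Fin n)) → Prop} (hP : wop n d P)
    (hQ : wop n d Q) : wop n d fun ℓ r => P ℓ r ∧ Q ℓ r := by
  rw [wop_iff] at hP hQ ⊢
  refine squeeze_zero (fun ℓ => relProb_nonneg _ _ _) (fun ℓ => ?_) (by simpa using hP.add hQ)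
  simp only [not_and_or]
  exact relProb_or_le _ _ _ _

lemma wop.forall_mem [Inhabited (Fin n)] {κ : Type} (S : Finset κ)
    {P : κ → ∀ ℓ : ℕ, (Fin (numRel n d ℓ) → FreeGroup (Fin n)) → Prop}
    (hP : ∀ j ∈ S, wop n d (P j)) : wop n d fun ℓ r => ∀ j ∈ S, P j ℓ r := by
  classical
  induction S using Finset.induction_on with
  | empty =>
    rw [wop_iff]
    simp [relProb]
  | insert j S hj ih =>
    simp only [Finset.forall_mem_insert] at hP ⊢
    exact hP.1.and (ih hP.2)

end Probability

section Core

open FreeGroup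

variable {α : Type} [DecidableEq α] [Inhabited α]

/-- The middle part of a word. -/
def trim (w : List (α × Bool)) (o : ℕ) : List (α × Bool) := (w.drop o).take (w.length - 2 * o)

omit [DecidableEq α] [Inhabited α] in
lemma length_trim (w : List (α × Bool)) (o : ℕ) : (trim w o).length = w.length - 2 * o := by
  simp only [trim, List.length_take, List.length_drop]
  omega

omit [DecidableEq α] in
lemma getD_trim (w : List (α × Bool)) {o z : ℕ} (hz : z < w.length - 2 * o) :
    (trim w o).getD z default = w.getD (z + o) default := by
  rw [List.getD_eq_getElem _ _ (by rwa [length_trim]), List.getD_eq_getElem _ _ (by omega)]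
  simp only [trim, List.getElem_take, List.getElem_drop, add_comm]

lemma cycRed_trim (g : FreeGroup α) {o : ℕ}
    (ho : g.toWord.getD o default ≠ letterInv (g.toWord.getD (g.toWord.length - 1 - o) default)) :
    CycRed (trim g.toWord o) := by
  intro z hz
  rw [length_trim] at hz ⊢
  by_cases hz' : z + 1 < g.toWord.length - 2 * o
  · rw [Nat.mod_eq_of_lt hz', getD_trim _ hz', getD_trim _ hz, add_right_comm]
    exact getD_succ_ne_letterInv g (by omega)
  · have e : z + 1 = g.toWord.length - 2 * o := by omega
    rw [e, Nat.mod_self, getD_trim _ (by omega), getD_trim _ hz, zero_add]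
    convert ho using 3
    omega

omit [DecidableEq α] in
lemma exists_mk_eq_conj_trim (w : List (α × Bool)) {o : ℕ} (ho : 2 * o ≤ w.length)
    (h : ∀ j < o, w.getD j default = letterInv (w.getD (w.length - 1 - j) default)) :
    ∃ h : FreeGroup α, mk w = h * mk (trim w o) * h⁻¹ := by
  refine ⟨mk (w.take o), ?_⟩
  have e : w.drop (w.length - o) = invRev (w.take o) := by
    refine List.ext_getElem (by simp; omega) fun j hj hj' => ?_
    simp only [List.length_drop] at hj
    have h1 := h (o - 1 - j) (by omega)
    rw [List.getD_eq_getElem _ _ (by omega), List.getD_eq_getElem _ _ (by omega)] at h1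
    simp only [invRev, List.getElem_drop, List.getElem_reverse, List.getElem_map,
      List.getElem_take, List.length_map, List.length_take, min_eq_left (show o ≤ w.length by omega)]
    rw [h1]
    simp only [letterInv, Bool.not_not]
    congr 1
    omega
  rw [inv_mk, mul_mk, mul_mk, ← e]
  congr 1
  have e1 : w.drop o = trim w o ++ w.drop (w.length - o) := by
    conv_lhs => rw [← List.take_append_drop (w.length - 2 * o) (w.drop o)]
    rw [List.drop_drop, trim]
    congr 2
    omega
  rw [List.append_assoc, ← e1, List.take_append_drop]

omit [DecidableEq α] [Inhabited α] in
lemma normalClosure_relSet_eq {ι : Type} {r : ι → FreeGroup α} {s : ι → List (α × Bool)}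
    (h : ∀ i, ∃ h : FreeGroup α, r i = h * mk (s i) * h⁻¹) :
    Subgroup.normalClosure (relSet s) = Subgroup.normalClosure (Set.range r) := by
  apply le_antisymm
  · have key : ∀ i, mk (s i) ∈ Subgroup.normalClosure (Set.range r) := by
      intro i
      obtain ⟨g, hg⟩ := h i
      have e : mk (s i) = g⁻¹ * r i * g⁻¹⁻¹ := by
        rw [hg]
        group
      rw [e]
      exact Subgroup.normalClosure_normal.conj_mem _
        (Subgroup.subset_normalClosure (Set.mem_range_self i)) _
    refine Subgroup.normalClosure_le_normal ?_
    rintro _ ⟨⟨i, b⟩, rfl⟩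
    cases b
    · simp only [mk_relWord_false]
      exact inv_mem (key i)
    · exact key i
  · refine Subgroup.normalClosure_le_normal ?_
    rintro _ ⟨i, rfl⟩
    obtain ⟨g, hg⟩ := h i
    rw [hg]
    exact Subgroup.normalClosure_normal.conj_mem _
      (Subgroup.subset_normalClosure (show mk (s i) ∈ relSet s from ⟨(i, true), rfl⟩)) _

/-- A family of words without long repetitions at their ends can be trimmed to cyclically reduced
words. -/
lemma exists_core {N ℓ : ℕ} {r : Fin N → FreeGroup α} (hr : ∀ i, (r i).toWord.length = ℓ)
    (h : ∀ i, ∃ o < ℓ / 16, (r i).toWord.getD o default ≠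
      letterInv ((r i).toWord.getD (ℓ - 1 - o) default)) :
    ∃ o : Fin N → ℕ, (∀ i, o i ≤ ℓ / 16) ∧ (∀ i, CycRed (trim (r i).toWord (o i))) ∧
      Subgroup.normalClosure (relSet fun i => trim (r i).toWord (o i)) =
        Subgroup.normalClosure (Set.range r) := by
  classical
  have h' : ∀ i, ∃ o < ℓ / 16, (r i).toWord.getD o default ≠
      letterInv ((r i).toWord.getD (ℓ - 1 - o) default) ∧ ∀ j < o, (r i).toWord.getD j default =
      letterInv ((r i).toWord.getD (ℓ - 1 - j) default) := by
    intro i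
    have hex : ∃ o, (r i).toWord.getD o default ≠
      letterInv ((r i).toWord.getD (ℓ - 1 - o) default) := (h i).imp fun _ => And.right
    obtain ⟨o, ho, ho'⟩ := h i
    exact ⟨Nat.find hex, (Nat.find_min' hex ho').trans_lt ho, Nat.find_spec hex,
      fun j hj => not_not.1 (Nat.find_min hex hj)⟩
  choose o ho hne heq using h'
  refine ⟨o, fun i => (ho i).le, fun i => cycRed_trim _ (by rw [hr]; exact hne i),
    normalClosure_relSet_eq fun i => ?_⟩
  have := exists_mk_eq_conj_trim (r i).toWord (o := o i) (by rw [hr]; have := ho i; omega)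
    (by rw [hr]; exact heq i)
  rwa [mk_toWord] at this

end Core

section Lift

open FreeGroup

variable {n : ℕ} [Inhabited (Fin n)]

theorem exists_lift_of_not_badAt {N ℓ k m : ℕ} (V : Finset (FreeGroup (Fin k ⊕ Fin m)))
    (a : Fin m → FreeGroup (Fin n)) {r : Fin N → FreeGroup (Fin n)}
    (hr : ∀ i, (r i).toWord.length = ℓ) (hℓ : 8 ≤ ℓ)
    (ha : ∀ j, (a j).toWord.length ≤ 2 * (ℓ / 8))
    (htrim : ¬ BadAt 1 ℓ (trimLink (Fin m) ℓ) (fun j => (a j).toWord) r)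
    (hrep1 : ¬ BadAt 1 ℓ (repLink (Fin m) 0 0 ℓ) (fun j => (a j).toWord) r)
    (hrep2 : ¬ BadAt 2 ℓ (repLink (Fin m) 0 1 ℓ) (fun j => (a j).toWord) r)
    (hband : ∀ M ∈ Finset.Icc 1 (6 * ∑ w ∈ V, w.toWord.length),
      ¬ BadAt M ℓ (bandLink (Fin M ⊕ Fin m) (54 * ∑ w ∈ V, w.toWord.length) ℓ)
        (fun j => (a j).toWord) r)
    (b : Fin k → RandGroup r)
    (hb : ∀ w ∈ V, FreeGroup.lift (Sum.elim b (fun i => randProj r (a i))) w = 1) :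
    ∃ c : Fin k → FreeGroup (Fin n), (∀ w ∈ V, FreeGroup.lift (Sum.elim c a) w = 1) ∧
      ∀ i, randProj r (c i) = b i := by
  obtain ⟨o, ho, hcyc, hcl⟩ := exists_core hr (exists_lt_trim htrim)
  set s : Fin N → List (Fin n × Bool) := fun i => trim (r i).toWord (o i) with hs
  have hlen : ∀ i, (s i).length = ℓ - 2 * o i := fun i => by rw [hs, length_trim, hr]
  have hW : ∀ i, ∀ z < (s i).length,
      (r i).toWord.getD (z + o i) default = (s i).getD z default := fun i z hz =>
    (getD_trim _ (by rwa [hlen, ← hr i] at hz)).symm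
  have hSC := smallCanc_of_not_badAt hlen ho hW hrep1 hrep2
  have hker : ∀ g, randProj r g = 1 ↔ g ∈ Subgroup.normalClosure (relSet s) := fun g => by
    rw [hcl]
    exact QuotientGroup.eq_one_iff g
  choose v hv using fun i => QuotientGroup.mk'_surjective (Subgroup.normalClosure (Set.range r)) (b i)
  have hu₀ : ∀ w ∈ V, FreeGroup.lift (Sum.elim v a) w ∈ Subgroup.normalClosure (relSet s) := by
    intro w hw
    rw [← hker, ← hb w hw, ← MonoidHom.comp_apply]
    congr 1
    ext x
    rcases x with i | j
    · simp only [MonoidHom.comp_apply, FreeGroup.lift_apply_of, Sum.elim_inl]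
      exact hv i
    · simp
  obtain ⟨u, hcon, hu, F, hF0, ⟨C⟩⟩ := exists_cfg s V (Set.range .inr) (Sum.elim v a) hu₀
  have hua : ∀ j, u (.inr j) = a j := fun j => hcon _ ⟨j, rfl⟩
  have hwd : ∀ x z, z + 1 < (u x).toWord.length →
      (u x).toWord.getD (z + 1) default ≠ letterInv ((u x).toWord.getD z default) :=
    fun x z hz => getD_succ_ne_letterInv (u x) hz
  rcases Nat.eq_zero_or_pos F with rfl | hF
  · refine ⟨fun i => u (.inl i), fun w hw => ?_, fun i => ?_⟩
    · rw [← hF0 rfl w hw]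
      congr 2
      ext x
      rcases x with i | j
      · rfl
      · exact (hua j).symm
    · have h := (hker _).2 (hu (.inl i))
      rw [_root_.map_mul, _root_.map_inv, mul_inv_eq_one] at h
      exact h.trans (hv i)
  · exfalso
    have hFL := C.cells_le (Λ := ℓ / 8) (by omega) hSC hcyc
      (fun i => by rw [hlen]; have := ho i; omega) hwd (by
        rintro _ ⟨j, rfl⟩
        rw [hua]
        exact ha j)
    obtain ⟨M, hM, hML, f, hf, B, hBv, hBc, hcnt⟩ := C.exists_band_family (M := 7 * (ℓ / 8)) (ℓ := ℓ)
      hF hFL (by omega) (fun i => by rw [hlen]; have := ho i; omega) hcyc hwd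
      (fun i => (r i).toWord) o (fun i z hz => ⟨by rw [hlen] at hz; omega, hW i z hz⟩)
    have hB : ∀ x, (Sum.elim (fun _ : Fin M => ℓ) fun j => (u (.inr j)).toWord.length) x ≤ ℓ := by
      rintro (x | j)
      · exact le_rfl
      · have := ha j
        simp only [Sum.elim_inr, hua]
        omega
    choose c hc using fun k => (hBv k).exists_param hB
    have hlk : bandLink (Fin M ⊕ Fin m) (54 * ∑ w ∈ V, w.toWord.length) ℓ c =
        fun t t' => ∃ k, (B k).Link t t' := by
      funext t t'
      simp only [bandLink, hc]
    refine hband M (Finset.mem_Icc.2 ⟨hM, hML⟩) ⟨f, hf, c, ?_, ?_⟩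
    · rw [hlk]
      have e : (fun j => (a j).toWord) = (fun x => (u x).toWord) ∘ Sum.inr := by
        funext j
        simp only [Function.comp_apply, hua]
      rw [e]
      exact fun t t' h => Band.Rel.letter hBc (.rel _ _ h)
    · rw [hlk]
      have h1 : M * ℓ ≤ M * (8 * (7 * (ℓ / 8)) + 16) := Nat.mul_le_mul_left _ (by omega)
      calc M * ℓ ≤ 8 * (M * (7 * (ℓ / 8))) + 16 * M := by linarith
        _ ≤ _ := by omega

end Lift

/-- With overwhelming probability, every solution in the random group `Γ_ℓ` of density
`d < 1/16` of a fixed finite system of equations `V(x̄,ā) = 1` over `F_n` (a finite set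
`V` of words in the variables `x̄ = (x₁,…,x_k)` and in constant symbols `ā = (a₁,…,a_m)`
interpreted as fixed elements of `F_n`, and in `Γ_ℓ` as their images `π_ℓ(ā)`) is the
image, under the canonical quotient map `π_ℓ : F_n → Γ_ℓ`, of a solution of the same
system in `F_n`. -/
theorem randomGroup_solutions_lift_with_constants
    (n : ℕ) (hn : 2 ≤ n) (d : ℝ) (hd0 : 0 ≤ d) (hd : d < 1/16)
    (k m : ℕ) (V : Finset (FreeGroup (Fin k ⊕ Fin m)))
    (a : Fin m → FreeGroup (Fin n)) :
    wop n d (fun _ r =>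
      ∀ b : Fin k → RandGroup r,
        (∀ w ∈ V, FreeGroup.lift (Sum.elim b (fun i => randProj r (a i))) w = 1) →
          ∃ c : Fin k → FreeGroup (Fin n),
            (∀ w ∈ V, FreeGroup.lift (Sum.elim c a) w = 1) ∧
              ∀ i, randProj r (c i) = b i) := by
  have _ : Inhabited (Fin n) := ⟨⟨0, by omega⟩⟩
  set aw : Fin m → List (Fin n × Bool) := fun j => (a j).toWord with haw
  set L := ∑ w ∈ V, w.toWord.length with hL
  have hcyc : ∀ ℓ, Fintype.card (CycParam ℓ × CycParam ℓ) ≤ 4 * (ℓ + 1) ^ 4 := fun ℓ => by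
    simp only [Fintype.card_prod, Fintype.card_fin, Fintype.card_bool]
    exact le_of_eq (by ring)
  have htrim : wop n d fun ℓ r => ¬ BadAt 1 ℓ (trimLink (Fin m) ℓ) aw r := by
    simpa only [wop_iff, not_not] using tendsto_badAt (A := 1) (K := 0) (Φ := fun _ => Unit) hn hd
      one_pos (by simp) (fun _ => trimLink_zFlip) aw
  have hrep1 : wop n d fun ℓ r => ¬ BadAt 1 ℓ (repLink (Fin m) 0 0 ℓ) aw r := by
    simpa only [wop_iff, not_not] using tendsto_badAt hn hd one_pos hcyc (fun _ => repLink_zFlip) aw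
  have hrep2 : wop n d fun ℓ r => ¬ BadAt 2 ℓ (repLink (Fin m) 0 1 ℓ) aw r := by
    simpa only [wop_iff, not_not] using tendsto_badAt hn hd two_pos hcyc (fun _ => repLink_zFlip) aw
  have hband : wop n d fun ℓ r => ∀ M ∈ Finset.Icc 1 (6 * L),
      ¬ BadAt M ℓ (bandLink (Fin M ⊕ Fin m) (54 * L) ℓ) aw r := by
    refine wop.forall_mem _ fun M hM => ?_
    simpa only [wop_iff, not_not] using tendsto_badAt hn hd (Finset.mem_Icc.1 hM).1
      (fun ℓ => card_bandParam (Q := Fin M ⊕ Fin m) (54 * L) ℓ) (fun _ => bandLink_zFlip) aw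
  refine ((htrim.and hrep1).and (hrep2.and hband)).mono ?_
  filter_upwards [eventually_ge_atTop (8 + 8 * ∑ j, (a j).toWord.length)] with ℓ hℓ r hr h
  refine exists_lift_of_not_badAt V a hr (by omega) (fun j => ?_) h.1.1 h.1.2 h.2.1 h.2.2
  have := Finset.single_le_sum (f := fun j => (a j).toWord.length) (fun _ _ => Nat.zero_le _)
    (Finset.mem_univ j)
  omega
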